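/- Let G be a finite insoluble group such that for some x ∈ G, the set Sol_G(x) is the underlying set of a maximal subgroup Q of G where Q is a metacyclic 2-group, and suppose G contains a proper nonabelian minimal normal subgroup N. Then Q is either a dihedral group or a semidihedral group; moreover, if Q is dihedral, then G is isomorphic to PGL(2,p) and N is isomorphic to PSL(2,p), where p ≥ 7 is a Mersenne prime (p = 2^n − 1). -/

import Mathlib

open scoped MatrixGroups

/-- The solubilizer of an element `x` of a group `G`: the set of all `y ∈ G`
such that the subgroup generated by `x` and `y` is soluble. -/
def solubilizer {G : Type*} [Group G] (x : G) : Set G :=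
  {y | IsSolvable ↥(Subgroup.closure ({x, y} : Set G))}

/-- A group is metacyclic if it has a cyclic normal subgroup with cyclic quotient. -/
def IsMetacyclic (Q : Type*) [Group Q] : Prop :=
  ∃ C : Subgroup Q, ∃ _ : C.Normal, IsCyclic C ∧ IsCyclic (Q ⧸ C)

/-- The projective general linear group `PGL(n, R) = GL(n, R)/Z(GL(n, R))`. -/
abbrev ProjectiveGeneralLinearGroup (n : ℕ) (R : Type*) [CommRing R] : Type _ :=
  Matrix.GeneralLinearGroup (Fin n) R ⧸
    Subgroup.center (Matrix.GeneralLinearGroup (Fin n) R)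

/-- A group is a dihedral `2`-group if it is isomorphic to the dihedral group of
order `2 ^ m` for some `m ≥ 3`. -/
def IsDihedral2Group (Q : Type*) [Group Q] : Prop :=
  ∃ m : ℕ, 3 ≤ m ∧ Nonempty (Q ≃* DihedralGroup (2 ^ (m - 1)))

/-- A group is semidihedral if it has order `2 ^ m` for some `m ≥ 4` and is generated
by elements `a`, `b` with `a ^ (2 ^ (m - 1)) = b ^ 2 = 1` and
`b * a * b⁻¹ = a ^ (2 ^ (m - 2) - 1)`. -/
def IsSemidihedralGroup (Q : Type*) [Group Q] : Prop :=
  ∃ m : ℕ, 4 ≤ m ∧ Nat.card Q = 2 ^ m ∧ ∃ a b : Q,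
    orderOf a = 2 ^ (m - 1) ∧ orderOf b = 2 ∧
    b * a * b⁻¹ = a ^ (2 ^ (m - 2) - 1) ∧
    Subgroup.closure ({a, b} : Set Q) = ⊤

open scoped commutatorElement

theorem isSolvable_sup_zpowers {G : Type*} [Group G] {R : Subgroup G} (hR : Group.IsSolvable R)
    {x : G} (hx : x ∈ Subgroup.normalizer (R : Set G)) :
    Group.IsSolvable ↥(R ⊔ Subgroup.zpowers x) := by
  have hle : Subgroup.zpowers x ≤ Subgroup.normalizer (R : Set G) := by simpa using hx
  rw [sup_comm]
  have : (R.subgroupOf (Subgroup.zpowers x ⊔ R)).Normal :=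
    Subgroup.normal_subgroupOf_of_le_normalizer (sup_le hle Subgroup.le_normalizer)
  let e := QuotientGroup.quotientInfEquivProdNormalizerQuotient _ R hle
  have h1 : Group.IsSolvable
      ((Subgroup.zpowers x ⊔ R : Subgroup G) ⧸ R.subgroupOf (Subgroup.zpowers x ⊔ R)) :=
    have : Group.IsSolvable (Subgroup.zpowers x) :=
      Group.isSolvable_of_comm fun a b => Subtype.ext <| by
        obtain ⟨m, hm⟩ := a.2
        obtain ⟨n, hn⟩ := b.2
        simp only [Subgroup.coe_mul, ← hm, ← hn, ← zpow_add, add_comm]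
    have : Group.IsSolvable (Subgroup.zpowers x ⧸ R.subgroupOf (Subgroup.zpowers x)) :=
      Group.isSolvable_of_surjective
        (QuotientGroup.mk'_surjective (R.subgroupOf (Subgroup.zpowers x)))
    Group.isSolvable_of_surjective (f := e.toMonoidHom) e.surjective
  have h2 : Group.IsSolvable (R.subgroupOf (Subgroup.zpowers x ⊔ R)) :=
    Group.isSolvable_of_isSolvable_injective
      (f := (Subgroup.subgroupOfEquivOfLe (le_sup_right :
        R ≤ Subgroup.zpowers x ⊔ R)).toMonoidHom)
      (Subgroup.subgroupOfEquivOfLe le_sup_right).injective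
  refine Group.isSolvable_of_ker_le_range (R.subgroupOf (Subgroup.zpowers x ⊔ R)).subtype
    (QuotientGroup.mk' (R.subgroupOf (Subgroup.zpowers x ⊔ R))) ?_
  simp

/-- In a `p`-group containing two conjugates of an element `z`, whose centralizer is a Sylow
subgroup where `z` has no other conjugate, the two conjugates agree. -/
theorem eq_of_conj_mem_isPGroup {H : Type*} [Group H] [Finite H] {p : ℕ} [Fact p.Prime]
    (P : Sylow p H) {z : H} (hfix : ∀ n : H, n * z * n⁻¹ ∈ P → n * z * n⁻¹ = z)
    (R : Subgroup H) (hR : IsPGroup p R) (a b : H) (ha : a * z * a⁻¹ ∈ R)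
    (hb : b * z * b⁻¹ ∈ R) : a * z * a⁻¹ = b * z * b⁻¹ := by
  obtain ⟨S, hS⟩ := hR.exists_le_sylow
  obtain ⟨g, rfl⟩ := MulAction.exists_smul_eq H P S
  have key : ∀ a : H, a * z * a⁻¹ ∈ R → a * z * a⁻¹ = g * z * g⁻¹ := by
    intro a ha
    have h1 := hS ha
    rw [Sylow.coe_subgroup_smul, Subgroup.mem_pointwise_smul_iff_inv_smul_mem] at h1
    have h2 : (g⁻¹ * a) * z * (g⁻¹ * a)⁻¹ ∈ P := by
      convert h1 using 1
      simp [MulAut.smul_def, ← map_inv, MulAut.conj_apply]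
      group
      rfl
    have h3 := hfix _ h2
    calc a * z * a⁻¹ = g * ((g⁻¹ * a) * z * (g⁻¹ * a)⁻¹) * g⁻¹ := by group
      _ = _ := by rw [h3]
  rw [key a ha, key b hb]

theorem exists_conj_ne_of_perfect {H : Type*} [Group H] [Finite H] {p : ℕ} [Fact p.Prime]
    (P : Sylow p H) {z : H} (hC : ∀ y : H, y * z = z * y ↔ y ∈ P)
    (hperf : commutator H = ⊤) (hne : (P : Subgroup H) ≠ ⊥) :
    ∃ n : H, n * z * n⁻¹ ∈ P ∧ n * z * n⁻¹ ≠ z := by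
  by_contra! hfix
  have hz : z ∈ P := (hC z).1 rfl
  have hfoc : (P : Subgroup H).focalSubgroup ≤ ⁅(P : Subgroup H), (P : Subgroup H)⁆ := by
    rw [Subgroup.focalSubgroup_def, Subgroup.closure_le]
    rintro _ ⟨h1, y, hy, u, rfl⟩
    have hy' : u * y⁻¹ * u⁻¹ ∈ (P : Subgroup H) := by
      have := mul_mem (inv_mem hy) h1
      rwa [commutatorElement_def, mul_assoc, mul_assoc, ← mul_assoc, inv_mul_cancel, one_mul,
        ← mul_assoc] at this
    let C : Subgroup H := Subgroup.centralizer {y}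
    have hzC : z ∈ C := by
      rw [Subgroup.mem_centralizer_singleton_iff]
      exact ((hC y).2 hy).symm
    have hzP : ∀ g : H, IsPGroup p (Subgroup.zpowers (g * z * g⁻¹)) := by
      intro g
      obtain ⟨k, hk⟩ := P.2 ⟨z, hz⟩
      have hk' : (g * z * g⁻¹) ^ p ^ k = 1 := by
        have : z ^ p ^ k = 1 := by simpa using congrArg Subtype.val hk
        rw [conj_pow, this]; simp
      rintro ⟨_, m, rfl⟩
      refine ⟨k, Subtype.ext ?_⟩
      simp only [Subgroup.coe_pow, Subgroup.coe_one]
      rw [← zpow_natCast, ← zpow_mul, mul_comm, zpow_mul, zpow_natCast, hk', one_zpow]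
    have huC : u⁻¹ * z * u⁻¹⁻¹ ∈ C := by
      rw [Subgroup.mem_centralizer_singleton_iff]
      have h2 : (u * y⁻¹ * u⁻¹)⁻¹ * z = z * (u * y⁻¹ * u⁻¹)⁻¹ := (hC _).2 (inv_mem hy')
      have h3 : u * y * u⁻¹ * z = z * (u * y * u⁻¹) := by
        simpa [mul_assoc] using h2
      calc u⁻¹ * z * u⁻¹⁻¹ * y = u⁻¹ * (z * (u * y * u⁻¹)) * u := by group
        _ = _ := by rw [← h3]; group
    have hexS : ∀ g : H, g * z * g⁻¹ ∈ C →
        ∃ S : Sylow p C, g * z * g⁻¹ ∈ (S : Subgroup C).map C.subtype := by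
      intro g hg
      have : IsPGroup p ((Subgroup.zpowers (g * z * g⁻¹)).subgroupOf C) :=
        (hzP g).comap_of_injective C.subtype C.subtype_injective
      obtain ⟨S, hS⟩ := this.exists_le_sylow
      exact ⟨S, ⟨⟨_, hg⟩, hS (Subgroup.mem_subgroupOf.2 (Subgroup.mem_zpowers _)), rfl⟩⟩
    obtain ⟨S1, s1, hs1, hs1z⟩ := hexS 1 (by simpa using hzC)
    obtain ⟨S2, hS2⟩ := hexS u⁻¹ huC
    obtain ⟨c, rfl⟩ := MulAction.exists_smul_eq C S1 S2
    have hs1z' : (s1 : H) = z := by simpa using hs1z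
    have hc : (c : H) * z * (c : H)⁻¹ ∈ (((c • S1 : Sylow p C)) : Subgroup C).map C.subtype := by
      refine ⟨c * s1 * c⁻¹, ?_, by simp [hs1z']⟩
      rw [Sylow.coe_subgroup_smul]
      exact Subgroup.smul_mem_pointwise_smul s1 (MulAut.conj c) _ hs1
    have heq := eq_of_conj_mem_isPGroup P hfix _ ((c • S1).2.map C.subtype) _ _ hc hS2
    have hcy : (c : H) * y = y * c := Subgroup.mem_centralizer_singleton_iff.1 c.2
    have hucP : u * c ∈ P := by
      rw [← hC]
      calc u * c * z = u * (c * z * (c : H)⁻¹) * c := by group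
        _ = _ := by rw [heq]; group
    have : ⁅y, u⁆ = ⁅y, u * (c : H)⁆ := by
      have h5 : (c : H) * y⁻¹ * (c : H)⁻¹ = y⁻¹ := by
        have : (c : H) * y * (c : H)⁻¹ = y := by rw [hcy]; group
        rw [← conj_inv, this]
      simp only [commutatorElement_def]
      calc y * u * y⁻¹ * u⁻¹ = y * u * ((c : H) * y⁻¹ * (c : H)⁻¹) * u⁻¹ := by rw [h5]
        _ = _ := by group
    rw [this]
    exact Subgroup.commutator_mem_commutator hy hucP
  have h1 : (P : Subgroup H) ≤ ⁅(P : Subgroup H), (P : Subgroup H)⁆ := by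
    refine le_trans ?_ hfoc
    rw [← Subgroup.commutator_inf_eq_focalSubgroup, hperf]
    simp
  have hnil := P.2.isNilpotent
  have hlt := Group.IsSolvable.commutator_lt_of_ne_bot (G := P) (H := ⊤)
    (by
      intro h
      apply hne
      rw [Subgroup.eq_bot_iff_forall]
      intro y hy
      have : (⟨y, hy⟩ : P) ∈ (⊥ : Subgroup P) := by rw [← h]; trivial
      exact congrArg Subtype.val (Subgroup.mem_bot.1 this))
  have hmap := Subgroup.map_subtype_commutator (P : Subgroup H)
  apply hlt.ne
  apply Subgroup.map_injective (P : Subgroup H).subtype_injective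
  rw [commutator_def] at hmap
  refine le_antisymm (Subgroup.map_mono le_top) ?_
  rw [hmap]
  exact le_trans (by rintro _ ⟨y, -, rfl⟩; exact y.2) h1

theorem nonempty_mulEquiv_dihedralGroup {Q : Type*} [Group Q] {n : ℕ} [NeZero n] {c t : Q}
    (hc : orderOf c = n) (ht : t * t = 1) (htc : t ∉ Subgroup.zpowers c)
    (hconj : t * c * t = c⁻¹)
    (hall : ∀ y : Q, y ∈ Subgroup.zpowers c ∨ ∃ d ∈ Subgroup.zpowers c, y = t * d) :
    Nonempty (Q ≃* DihedralGroup n) := by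
  have htinv : t⁻¹ = t := inv_eq_of_mul_eq_one_left ht
  let f : ZMod n → Q := fun i => c ^ (i.val : ℤ)
  have hf : ∀ (k : ℤ) (i : ZMod n), (k : ZMod n) = i → c ^ k = f i := by
    intro k i h
    rw [zpow_eq_zpow_iff_modEq, hc, ← ZMod.intCast_eq_intCast_iff]
    simpa using h
  have hadd : ∀ i j, f i * f j = f (i + j) := fun i j => by
    rw [← hf (i.val + j.val) (i + j) (by simp), zpow_add]
  have hsub : ∀ i j, (f i)⁻¹ * f j = f (j - i) := fun i j => by
    rw [← hf (j.val - i.val) (j - i) (by simp), sub_eq_neg_add, zpow_add, zpow_neg]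
  have hct : ∀ i, f i * t = t * (f i)⁻¹ := fun i => by
    have : t * f i * t⁻¹ = (f i)⁻¹ := by
      simp only [f]
      rw [← conj_zpow, htinv, hconj, inv_zpow]
    calc f i * t = t⁻¹ * (t * f i * t⁻¹) * (t * t) := by group
      _ = _ := by rw [this, ht, htinv, mul_one]
  let F : DihedralGroup n →* Q :=
    { toFun := fun d => match d with
        | .r i => f i
        | .sr i => t * f i
      map_one' := by
        change f 0 = 1
        simp [f]
      map_mul' := by
        rintro (i | i) (j | j)
        · exact (hadd i j).symm
        · change t * f (j - i) = f i * (t * f j)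
          rw [← mul_assoc, hct, mul_assoc, hsub]
        · change t * f (i + j) = t * f i * f j
          rw [mul_assoc, hadd]
        · change f (j - i) = t * f i * (t * f j)
          rw [mul_assoc, ← mul_assoc (f i), hct, ← hsub, ← mul_assoc, ← mul_assoc, ht, one_mul] }
  have hinj : Function.Injective f := by
    intro i j h
    simp only [f] at h
    rw [zpow_eq_zpow_iff_modEq, hc, ← ZMod.intCast_eq_intCast_iff] at h
    simpa using h
  have hmem : ∀ i, f i ∈ Subgroup.zpowers c := fun i => ⟨_, rfl⟩
  have hne : ∀ i j, f i ≠ t * f j := fun i j h => htc <| by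
    have : t = f i * (f j)⁻¹ := by rw [h]; group
    rw [this]
    exact mul_mem (hmem _) (inv_mem (hmem _))
  refine ⟨(MulEquiv.ofBijective F ⟨?_, ?_⟩).symm⟩
  · rintro (i | i) (j | j) h
    · exact congrArg _ (hinj h)
    · exact absurd h (hne i j)
    · exact absurd h.symm (hne j i)
    · exact congrArg _ (hinj (mul_left_cancel h))
  · intro y
    rcases hall y with ⟨k, rfl⟩ | ⟨_, ⟨k, rfl⟩, rfl⟩
    · exact ⟨.r (k : ZMod n), (hf k _ rfl).symm⟩
    · exact ⟨.sr (k : ZMod n), congrArg _ (hf k _ rfl).symm⟩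

theorem dihedral_or_semidihedral_or_ncard_le {Q : Type*} [Group Q] [Finite Q]
    (h2 : ∃ n : ℕ, Nat.card Q = 2 ^ n) (hmeta : IsMetacyclic Q) :
    IsDihedral2Group Q ∨ IsSemidihedralGroup Q ∨ {y : Q | y ^ 2 = 1}.ncard ≤ 4 := by
  obtain ⟨C, hCn, hC, hQC⟩ := hmeta
  have hp : IsPGroup 2 Q := IsPGroup.iff_card.2 h2
  have hSC : {y : Q | y ∈ C ∧ y ^ 2 = 1}.ncard ≤ 2 := by
    have h : {y : Q | y ∈ C ∧ y ^ 2 = 1} = C.subtype '' {y : C | y ^ 2 = 1} := by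
      ext y
      constructor
      · rintro ⟨hy, h⟩
        exact ⟨⟨y, hy⟩, Subtype.ext h, rfl⟩
      · rintro ⟨y, h, rfl⟩
        exact ⟨y.2, by simpa using congrArg Subtype.val h⟩
    rw [h, Set.ncard_image_of_injective _ C.subtype_injective]
    classical
    have := Fintype.ofFinite C
    have h3 := IsCyclic.card_pow_eq_one_le (α := C) (n := 2) (by norm_num)
    rw [Set.ncard_eq_toFinset_card']
    convert h3 using 2
    ext; simp
  by_cases hA : ∀ y : Q, y ^ 2 = 1 → y ∈ C
  · refine Or.inr (Or.inr (le_trans (Set.ncard_le_ncard ?_) (hSC.trans (by norm_num))))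
    exact fun y hy => ⟨hA y hy, hy⟩
  push Not at hA
  obtain ⟨t, ht2, htC⟩ := hA
  have htt : t * t = 1 := by rw [← sq, ht2]
  have htinv : t⁻¹ = t := inv_eq_of_mul_eq_one_left htt
  have hcoset : ∀ y : Q, y ^ 2 = 1 → y ∉ C → t⁻¹ * y ∈ C := by
    intro y hy hyC
    classical
    have := Fintype.ofFinite (Q ⧸ C)
    have h3 := IsCyclic.card_pow_eq_one_le (α := Q ⧸ C) (n := 2) (by norm_num)
    by_contra hne
    have h4 : ({1, (t : Q ⧸ C), (y : Q ⧸ C)} : Finset (Q ⧸ C)).card ≤ 2 := by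
      refine le_trans (Finset.card_le_card ?_) h3
      intro a ha
      simp only [Finset.mem_insert, Finset.mem_singleton] at ha
      rw [Finset.mem_filter]
      refine ⟨Finset.mem_univ _, ?_⟩
      rcases ha with rfl | rfl | rfl
      · simp
      · rw [← QuotientGroup.mk_pow, ht2]; rfl
      · rw [← QuotientGroup.mk_pow, hy]; rfl
    rw [Finset.card_eq_three.2 ⟨1, (t : Q ⧸ C), (y : Q ⧸ C), ?_, ?_, ?_, rfl⟩] at h4
    · omega
    · intro h
      exact htC ((QuotientGroup.eq_one_iff t).1 h.symm)
    · intro h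
      exact hyC ((QuotientGroup.eq_one_iff y).1 h.symm)
    · intro h
      exact hne (QuotientGroup.eq.1 h)
  obtain ⟨⟨c, hcC⟩, hc⟩ := hC.exists_generator
  have hCz : C = Subgroup.zpowers c := by
    ext y
    constructor
    · intro hy
      obtain ⟨k, hk⟩ := hc ⟨y, hy⟩
      exact ⟨k, by simpa using congrArg Subtype.val hk⟩
    · rintro ⟨k, rfl⟩
      exact zpow_mem hcC k
  by_cases hB : ∀ y : Q, y ^ 2 = 1 → t⁻¹ * y ∈ C → (t⁻¹ * y) ^ 2 = 1
  · refine Or.inr (Or.inr (le_trans (Set.ncard_le_ncard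
      (t := {y : Q | y ∈ C ∧ y ^ 2 = 1} ∪ (t * ·) '' {y : Q | y ∈ C ∧ y ^ 2 = 1}) ?_)
      ((Set.ncard_union_le _ _).trans ?_)))
    · intro y hy
      by_cases hyC : y ∈ C
      · exact Or.inl ⟨hyC, hy⟩
      · have := hcoset y hy hyC
        exact Or.inr ⟨t⁻¹ * y, ⟨this, hB y hy this⟩, by simp⟩
    · rw [Set.ncard_image_of_injective _ (mul_right_injective t)]
      omega
  have hconj : ∀ g : Q, ∃ i : ℤ, g * c * g⁻¹ = c ^ i := by
    intro g
    have := hCn.conj_mem c hcC g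
    rw [hCz] at this
    obtain ⟨i, hi⟩ := this
    exact ⟨i, hi.symm⟩
  obtain ⟨k, hk⟩ := (IsPGroup.iff_orderOf.1 hp) c
  obtain ⟨i, hi⟩ := hconj t
  have hmod : ∀ a b : ℤ, c ^ a = c ^ b ↔ (2 : ℤ) ^ k ∣ b - a := by
    intro a b
    rw [zpow_eq_zpow_iff_modEq, hk, Int.modEq_iff_dvd]
    push_cast
    rfl
  have h3 : c ^ (i * i) = c ^ (1 : ℤ) := by
    rw [zpow_mul, ← hi, conj_zpow, ← hi, htinv, zpow_one]
    rw [← mul_assoc, ← mul_assoc, htt, one_mul, mul_assoc, htt, mul_one]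
  rw [hmod] at h3
  have hB' : 2 ≤ k ∧ i % 4 = 3 := by
    push Not at hB
    obtain ⟨y, hy, hyC, hne⟩ := hB
    rw [hCz] at hyC
    obtain ⟨j, hj⟩ := hyC
    have hj : t⁻¹ * y = c ^ j := hj.symm
    have hy' : y = t * c ^ j := by rw [← hj]; group
    have h1 : c ^ (i * j + j) = c ^ (0 : ℤ) := by
      have : t * c ^ j * t⁻¹ = c ^ (i * j) := by rw [← conj_zpow, hi, zpow_mul]
      rw [zpow_add, ← this, htinv, zpow_zero, ← hy, sq, hy']
      simp only [mul_assoc]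
    have h2 : c ^ (2 * j) ≠ c ^ (0 : ℤ) := by
      rw [hj] at hne
      rwa [mul_comm, zpow_mul, zpow_zero, zpow_ofNat]
    rw [Ne, hmod] at h2
    rw [hmod] at h1
    have hk2 : 2 ≤ k := by
      by_contra hlt
      apply h2
      refine dvd_trans (pow_dvd_pow 2 (show k ≤ 1 by omega)) ⟨-j, by ring⟩
    refine ⟨hk2, ?_⟩
    by_contra h4
    have h5 : (4 : ℤ) ∣ 1 - i * i := dvd_trans (pow_dvd_pow 2 hk2) h3
    have h6 : i % 4 = 1 := by
      have h7 : i % 4 = 0 ∨ i % 4 = 1 ∨ i % 4 = 2 := by omega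
      obtain ⟨w, hw⟩ := h5
      have h8 : i = 4 * (i / 4) + i % 4 := by omega
      rcases h7 with h | h | h
      · rw [h] at h8; rw [h8] at hw; ring_nf at hw; omega
      · exact h
      · rw [h] at h8; rw [h8] at hw; ring_nf at hw; omega
    have h7 : IsCoprime ((2 : ℤ) ^ k) ((i + 1) / 2) := by
      apply IsCoprime.pow_left
      rw [Int.isCoprime_iff_gcd_eq_one]
      have : ((i + 1) / 2) % 2 = 1 := by omega
      rw [← Int.isCoprime_iff_gcd_eq_one]
      refine ⟨-((i + 1) / 2 / 2), 1, by omega⟩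
    apply h2
    have h8 : (2 : ℤ) ^ k ∣ (0 - 2 * j) * ((i + 1) / 2) := by
      have : i + 1 = 2 * ((i + 1) / 2) := by omega
      convert h1 using 1
      calc (0 - 2 * j) * ((i + 1) / 2) = - j * (2 * ((i + 1) / 2)) := by ring
        _ = _ := by rw [← this]; ring
    exact h7.dvd_of_dvd_mul_right h8
  obtain ⟨hk2, hi4⟩ := hB'
  have hall : ∀ y : Q, y ∈ C ∨ t⁻¹ * y ∈ C := by
    intro y
    by_contra! hy
    have htC' : (t : Q ⧸ C) ≠ 1 := fun h => htC ((QuotientGroup.eq_one_iff t).1 h)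
    have hex : ∃ w : Q ⧸ C, w ^ 2 = t := by
      obtain ⟨g, hg⟩ := hQC.exists_generator
      obtain ⟨m, hm⟩ := hg t
      have hm : g ^ m = t := hm
      rcases Int.even_or_odd' m with ⟨j, rfl | rfl⟩
      · exact ⟨g ^ j, by rw [← zpow_natCast, ← zpow_mul, ← hm, mul_comm]; rfl⟩
      exfalso
      obtain ⟨s, hs⟩ := (IsPGroup.iff_orderOf.1 (hp.to_quotient C)) g
      have h1 : g ^ ((2 * j + 1) * 2) = 1 := by
        rw [zpow_mul, hm, zpow_ofNat, ← QuotientGroup.mk_pow, ht2]; rfl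
      rw [← orderOf_dvd_iff_zpow_eq_one, hs] at h1
      have hs1 : s ≤ 1 := by
        by_contra! hs1
        have h5 : (4 : ℤ) ∣ (2 * j + 1) * 2 := by
          refine dvd_trans ?_ h1
          push_cast
          exact pow_dvd_pow 2 hs1
        omega
      have hg2 : g ^ (2 : ℤ) = 1 := by
        rw [← orderOf_dvd_iff_zpow_eq_one, hs]
        push_cast
        exact pow_dvd_pow 2 hs1
      have htg : (t : Q ⧸ C) = g := by
        rw [← hm, zpow_add, zpow_mul, hg2, one_zpow, one_mul, zpow_one]
      obtain ⟨b, hb⟩ := hg y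
      have hb : g ^ b = y := hb
      rcases Int.even_or_odd' b with ⟨d, rfl | rfl⟩
      · rw [zpow_mul, hg2, one_zpow] at hb
        exact hy.1 ((QuotientGroup.eq_one_iff y).1 hb.symm)
      · rw [zpow_add, zpow_mul, hg2, one_zpow, one_mul, zpow_one, ← htg] at hb
        exact hy.2 (QuotientGroup.eq.1 hb)
    obtain ⟨w, hw⟩ := hex
    obtain ⟨w, rfl⟩ := QuotientGroup.mk_surjective w
    have hwt : (w ^ 2)⁻¹ * t ∈ C := QuotientGroup.eq.1 (by rw [QuotientGroup.mk_pow, hw])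
    obtain ⟨m, hm⟩ := hconj w
    rw [hCz] at hwt
    obtain ⟨l, hl⟩ := hwt
    have hl : (w ^ 2)⁻¹ * t = c ^ l := hl.symm
    have ht : t = w ^ 2 * c ^ l := by rw [← hl]; group
    have h1 : t * c * t⁻¹ = c ^ (m * m) := by
      rw [ht]
      calc w ^ 2 * c ^ l * c * (w ^ 2 * c ^ l)⁻¹ = w * (w * c * w⁻¹) * w⁻¹ := by
            rw [sq]; group
        _ = _ := by rw [hm, ← conj_zpow, hm, zpow_mul]
    rw [hi, hmod] at h1
    have h5 : (4 : ℤ) ∣ m * m - i := dvd_trans (pow_dvd_pow 2 hk2) h1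
    have h7 : m % 4 = 0 ∨ m % 4 = 1 ∨ m % 4 = 2 ∨ m % 4 = 3 := by omega
    obtain ⟨w, hw⟩ := h5
    have h8 : m = 4 * (m / 4) + m % 4 := by omega
    have h9 : i = 4 * (i / 4) + 3 := by omega
    rcases h7 with h | h | h | h <;>
    · rw [h] at h8; rw [h8, h9] at hw; ring_nf at hw; omega
  obtain ⟨k, rfl⟩ : ∃ k', k = k' + 1 := ⟨k - 1, by omega⟩
  have hdvd : (2 : ℤ) ^ k ∣ i + 1 := by
    have h7 : IsCoprime ((2 : ℤ) ^ k) ((i - 1) / 2) := by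
      apply IsCoprime.pow_left
      refine ⟨-((i - 1) / 2 / 2), 1, by omega⟩
    have h8 : (2 : ℤ) ^ k ∣ (i + 1) * ((i - 1) / 2) := by
      obtain ⟨w, hw⟩ := h3
      refine ⟨-w, ?_⟩
      have : i - 1 = 2 * ((i - 1) / 2) := by omega
      have h9 : 2 * ((i + 1) * ((i - 1) / 2)) = 2 * (2 ^ k * -w) := by
        calc 2 * ((i + 1) * ((i - 1) / 2)) = (i + 1) * (2 * ((i - 1) / 2)) := by ring
          _ = -(1 - i * i) := by rw [← this]; ring
          _ = _ := by rw [hw]; ring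
      exact mul_left_cancel₀ (by norm_num) h9
    exact h7.dvd_of_dvd_mul_right h8
  obtain ⟨w, hw⟩ := hdvd
  rcases Int.even_or_odd' w with ⟨v, rfl | rfl⟩
  · left
    refine ⟨k + 2, by omega, nonempty_mulEquiv_dihedralGroup (c := c) (t := t) hk htt
      (hCz ▸ htC) ?_ fun y => ?_⟩
    · have : c ^ i = c ^ (-1 : ℤ) := by
        rw [hmod]
        exact ⟨-v, by linear_combination -hw⟩
      rw [zpow_neg_one] at this
      rw [← this, ← hi, htinv]
    · rw [← hCz]
      exact (hall y).imp id fun h => ⟨_, h, by simp⟩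
  · right; left
    have hk3 : 2 ≤ k := by
      by_contra hlt
      obtain rfl : k = 1 := by omega
      omega
    have hcl : ∀ y : Q, y ∈ C → y ∈ Subgroup.closure ({c, t} : Set Q) := by
      intro y hy
      have : Subgroup.zpowers c ≤ Subgroup.closure ({c, t} : Set Q) :=
        Subgroup.zpowers_le.2 (Subgroup.subset_closure (by simp))
      exact this (hCz ▸ hy)
    refine ⟨k + 2, by omega, ?_, c, t, hk, ?_, ?_, ?_⟩
    · have h1 : C.index = 2 := by
        rw [Subgroup.index_eq_two_iff]
        refine ⟨t, fun b => ?_⟩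
        by_cases hb : b ∈ C
        · right
          refine ⟨hb, fun h => htC ?_⟩
          exact (Subgroup.mul_mem_cancel_left C hb).1 h
        · left
          refine ⟨?_, hb⟩
          have h4 := (hall b).resolve_left hb
          have h5 := hCn.conj_mem _ h4 t
          rw [htinv, mul_assoc, mul_assoc, ← mul_assoc, htt, one_mul] at h5
          exact h5
      have h4 := C.card_mul_index
      rw [h1, hCz, Nat.card_zpowers, hk] at h4
      rw [← h4]
      ring
    · exact orderOf_eq_prime ht2 (fun h => htC (h ▸ one_mem C))
    · rw [hi, ← zpow_natCast, hmod]
      refine ⟨-v, ?_⟩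
      rw [Nat.add_sub_cancel, Nat.cast_sub Nat.one_le_two_pow]
      push_cast
      linear_combination -hw
    · rw [eq_top_iff]
      intro y _
      rcases hall y with h | h
      · exact hcl y h
      · have := mul_mem (Subgroup.subset_closure (show t ∈ ({c, t} : Set Q) by simp)) (hcl _ h)
        simpa using this

section ProjectiveLine

open OnePoint Matrix

variable {F : Type*} [Field F] [DecidableEq F]

theorem ker_toPermHom_GL_onePoint :
    (MulAction.toPermHom (GL (Fin 2) F) (OnePoint F)).ker =
      Subgroup.center (GL (Fin 2) F) := by
  ext M
  rw [MonoidHom.mem_ker, GeneralLinearGroup.mem_center_iff_val_mem_range_scalar, Equiv.ext_iff]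
  simp only [MulAction.toPermHom_apply, MulAction.toPerm_apply, Equiv.Perm.coe_one, id_eq]
  constructor
  · intro h
    have h1 := smul_infty_eq_self_iff.1 (h ∞)
    have hd : M 0 0 * M 1 1 ≠ 0 := by
      have := M.det_ne_zero
      rw [det_fin_two, h1] at this
      simpa using this
    have h11 : M 1 1 ≠ 0 := right_ne_zero_of_mul hd
    have h2 := h (0 : F)
    have h3 := h (1 : F)
    rw [smul_some_eq_ite] at h2 h3
    simp only [h1, zero_add, h11, if_false, OnePoint.coe_eq_coe, mul_zero, mul_one] at h2 h3
    have h01 : M 0 1 = 0 := by simpa [h11] using h2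
    rw [h01, add_zero, div_eq_one_iff_eq h11] at h3
    refine ⟨M 1 1, ?_⟩
    ext i j
    fin_cases i <;> fin_cases j <;> simp [h1, h01, h3]
  · rintro ⟨a, ha⟩ x
    have h10 : M 1 0 = 0 := by rw [← ha]; simp
    have h01 : M 0 1 = 0 := by rw [← ha]; simp
    have h00 : M 0 0 = a := by rw [← ha]; simp
    have h11 : M 1 1 = a := by rw [← ha]; simp
    have ha0 : a ≠ 0 := by
      have := M.det_ne_zero
      rw [det_fin_two, h10, h00] at this
      aesop
    induction x with
    | infty => exact smul_infty_eq_self_iff.2 h10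
    | coe k =>
      rw [smul_some_eq_ite, h10, h01, h00, h11]
      simp [ha0]

theorem card_ProjectiveGeneralLinearGroup_two (p : ℕ) [Fact p.Prime] :
    Nat.card (ProjectiveGeneralLinearGroup 2 (ZMod p)) = p * (p ^ 2 - 1) := by
  have hp := (Fact.out : p.Prime).two_le
  have h1 := Subgroup.card_eq_card_quotient_mul_card_subgroup
    (Subgroup.center (GL (Fin 2) (ZMod p)))
  have h2 : Nat.card (Subgroup.center (GL (Fin 2) (ZMod p))) = p - 1 := by
    rw [GeneralLinearGroup.center_eq_range_scalar]
    rw [← Nat.card_congr (MonoidHom.ofInjective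
      (f := GeneralLinearGroup.scalar (R := ZMod p) (Fin 2)) ?_).toEquiv]
    · rw [Nat.card_eq_fintype_card, ZMod.card_units]
    · intro a b h
      have := congrArg (fun M : GL (Fin 2) (ZMod p) => M 0 0) h
      simpa [Units.ext_iff] using this
  rw [h2, card_GL_field, Fin.prod_univ_two] at h1
  simp only [ZMod.card, Fin.val_zero, Fin.val_one, pow_zero, pow_one,
    Nat.card_eq_fintype_card] at h1 ⊢
  have h3 : p ^ 2 - p = p * (p - 1) := by rw [Nat.mul_sub, sq, mul_one]
  rw [h3, ← mul_assoc] at h1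
  rw [mul_comm p]
  exact (Nat.eq_of_mul_eq_mul_right (by omega) h1).symm

/-- A group acting faithfully on a set in bijection with the projective line, by projective
transformations, is isomorphic to `PGL(2, p)` as soon as it has the same order. -/
theorem nonempty_mulEquiv_PGL_of_action {G X : Type*} [Group G] [Finite G] [MulAction G X]
    {p : ℕ} [Fact p.Prime] (θ : OnePoint (ZMod p) ≃ X)
    (hfaith : ∀ g : G, (∀ x : X, g • x = x) → g = 1)
    (hproj : ∀ g : G, ∃ M : GL (Fin 2) (ZMod p), ∀ i, g • θ i = θ (M • i))
    (hcard : Nat.card G = p * (p ^ 2 - 1)) :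
    Nonempty (G ≃* ProjectiveGeneralLinearGroup 2 (ZMod p)) := by
  let ρ := MulAction.toPermHom (GL (Fin 2) (ZMod p)) (OnePoint (ZMod p))
  let σ : G →* Equiv.Perm (OnePoint (ZMod p)) :=
    (θ.symm.permCongrHom.toMonoidHom).comp (MulAction.toPermHom G X)
  have hσ : ∀ g i, θ (σ g i) = g • θ i := by
    intro g i
    simp [σ, Equiv.permCongrHom, Equiv.permCongr]
  have hσinj : Function.Injective σ := by
    rw [injective_iff_map_eq_one]
    intro g hg
    refine hfaith g fun x => ?_
    obtain ⟨i, rfl⟩ := θ.surjective x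
    rw [← hσ, hg]
    rfl
  let e : ProjectiveGeneralLinearGroup 2 (ZMod p) ≃* ρ.range :=
    (QuotientGroup.quotientMulEquivOfEq ker_toPermHom_GL_onePoint.symm).trans
      (QuotientGroup.quotientKerEquivRange ρ)
  have hle : σ.range ≤ ρ.range := by
    rintro _ ⟨g, rfl⟩
    obtain ⟨M, hM⟩ := hproj g
    refine ⟨M, Equiv.ext fun i => θ.injective ?_⟩
    rw [hσ, hM]
    rfl
  have heq : σ.range = ρ.range := by
    apply Subgroup.eq_of_le_of_card_ge hle
    rw [← Nat.card_congr e.toEquiv, card_ProjectiveGeneralLinearGroup_two, ← hcard,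
      Nat.card_congr (MonoidHom.ofInjective hσinj).toEquiv]
  exact ⟨(MonoidHom.ofInjective hσinj).trans ((MulEquiv.subgroupCongr heq).trans e.symm)⟩

end ProjectiveLine

section ProjectiveSpecial

open Matrix

theorem mk_mem_range_toPGL {F : Type*} [Field F] (M : GL (Fin 2) F)
    (h : IsSquare (M.val.det)) :
    (QuotientGroup.mk M : ProjectiveGeneralLinearGroup 2 F) ∈
      (ProjectiveSpecialLinearGroup.toPGL (n := Fin 2) (R := F)).range := by
  obtain ⟨a, ha⟩ := h
  have ha0 : a ≠ 0 := by
    rintro rfl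
    exact M.det_ne_zero (by simpa using ha)
  let S : SpecialLinearGroup (Fin 2) F := ⟨a⁻¹ • M.val, by
    rw [det_smul, ha, Fintype.card_fin]; field_simp⟩
  refine ⟨QuotientGroup.mk S, ?_⟩
  rw [ProjectiveSpecialLinearGroup.toPGL_mk]
  change ProjGenLinGroup.mk _ = ProjGenLinGroup.mk M
  rw [ProjGenLinGroup.mk_eq_mk_iff]
  refine ⟨Units.mk0 a ha0, Units.ext ?_⟩
  have hS : (SpecialLinearGroup.toGL S).val = a⁻¹ • M.val := rfl
  rw [Units.val_mul, hS, GeneralLinearGroup.coe_scalar]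
  simp [ha0, ← Matrix.smul_eq_mul_diagonal, smul_smul]

theorem isSquare_mul_of_not_isSquare {F : Type*} [Field F] [Finite F] {a b : F}
    (ha : ¬ IsSquare a) (hb : ¬ IsSquare b) : IsSquare (a * b) := by
  classical
  have := Fintype.ofFinite F
  have hF : ringChar F ≠ 2 := fun h => ha (FiniteField.isSquare_of_char_two h a)
  have ha0 : a ≠ 0 := by rintro rfl; exact ha (by simp)
  have hb0 : b ≠ 0 := by rintro rfl; exact hb (by simp)
  rw [← quadraticChar_one_iff_isSquare (mul_ne_zero ha0 hb0), map_mul,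
    quadraticChar_neg_one_iff_not_isSquare.2 ha, quadraticChar_neg_one_iff_not_isSquare.2 hb]
  norm_num

theorem nonempty_mulEquiv_PSL_of_index_two {F : Type*} [Field F] [Finite F] (hF : (2 : F) ≠ 0)
    (N : Subgroup (ProjectiveGeneralLinearGroup 2 F)) (hN : N.index = 2) :
    Nonempty (N ≃* PSL(2, F)) := by
  let f : PSL(2, F) →* ProjectiveGeneralLinearGroup 2 F :=
    ProjectiveSpecialLinearGroup.toPGL (n := Fin 2) (R := F)
  have hf : Function.Injective f := ProjectiveSpecialLinearGroup.toPGL_injective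
  have hle : f.range ≤ N := by
    rintro _ ⟨S, rfl⟩
    obtain ⟨S, rfl⟩ := QuotientGroup.mk_surjective S
    induction S using SL2.transvection_induction with
    | htransvec i j h c =>
      have : SpecialLinearGroup.transvection h c =
          SpecialLinearGroup.transvection h (c / 2) ^ 2 := by
        rw [sq, ← SpecialLinearGroup.transvection_add]
        congr 1
        field_simp
        ring
      rw [this, QuotientGroup.mk_pow, map_pow]
      exact Subgroup.sq_mem_of_index_two hN _
    | hmul A B hA hB =>
      rw [QuotientGroup.mk_mul, map_mul]
      exact mul_mem hA hB
  have hge : N ≤ f.range := by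
    intro M hM
    by_contra hMr
    have hdet : ∀ A : GL (Fin 2) F,
        (QuotientGroup.mk A : ProjectiveGeneralLinearGroup 2 F) ∉ f.range →
          ¬ IsSquare A.val.det := fun A hA h => hA (mk_mem_range_toPGL A h)
    have htop : N = ⊤ := by
      rw [eq_top_iff]
      intro A _
      by_contra hA
      obtain ⟨M, rfl⟩ := QuotientGroup.mk_surjective M
      obtain ⟨A, rfl⟩ := QuotientGroup.mk_surjective A
      have h1 := isSquare_mul_of_not_isSquare (hdet M hMr) (hdet A fun h => hA (hle h))
      have h2 : (QuotientGroup.mk (M * A) : ProjectiveGeneralLinearGroup 2 F) ∈ f.range :=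
        mk_mem_range_toPGL (M * A) (by rwa [Units.val_mul, det_mul])
      exact hA ((Subgroup.mul_mem_cancel_left N hM).1 (hle h2))
    rw [htop, Subgroup.index_top] at hN
    omega
  exact ⟨(MulEquiv.subgroupCongr (le_antisymm hge hle)).trans (MonoidHom.ofInjective hf).symm⟩

end ProjectiveSpecial

section Identification

open OnePoint Matrix

theorem nonempty_mulEquiv_PGL_of_regular {G : Type*} [Group G] [Finite G] {p : ℕ}
    [Fact p.Prime] {y z : G} (hy : orderOf y = p)
    (hCy : ∀ g : G, g * y = y * g → g ∈ Subgroup.zpowers y) (L : Subgroup G)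
    (hLn : ∀ l ∈ L, l * y * l⁻¹ ∈ Subgroup.zpowers y)
    (hLt : ∀ a ∈ Subgroup.zpowers y, a ≠ 1 → ∃ l ∈ L, l * y * l⁻¹ = a)
    (hLcard : Nat.card L = p - 1) (hz : z * z = 1) (hzL : ∀ l ∈ L, z * l * z⁻¹ = l⁻¹)
    (hzy : z * y * z⁻¹ ∉ Subgroup.zpowers y) (hcard : Nat.card G = p * (p ^ 2 - 1)) :
    Nonempty (G ≃* ProjectiveGeneralLinearGroup 2 (ZMod p)) := by
  have hp := (Fact.out : p.Prime).two_le
  have hzinv : z⁻¹ = z := inv_eq_of_mul_eq_one_left hz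
  let Y : ZMod p → G := fun i => y ^ (i.val : ℤ)
  have hY : ∀ (k : ℤ) (i : ZMod p), (k : ZMod p) = i → y ^ k = Y i := by
    intro k i h
    rw [zpow_eq_zpow_iff_modEq, hy, ← ZMod.intCast_eq_intCast_iff]
    simpa using h
  have hadd : ∀ i j, Y i * Y j = Y (i + j) := fun i j => by
    rw [← hY (i.val + j.val) (i + j) (by simp), _root_.zpow_add]
  have hinv : ∀ i, (Y i)⁻¹ = Y (-i) := fun i => by
    rw [← hY (-i.val) (-i) (by simp), _root_.zpow_neg]
  have hY1 : Y 1 = y := by rw [← hY 1 1 (by simp), zpow_one]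
  have hY0 : Y 0 = 1 := by rw [← hY 0 0 (by simp), zpow_zero]
  have hinj : Function.Injective Y := by
    intro i j h
    simp only [Y] at h
    rw [zpow_eq_zpow_iff_modEq, hy, ← ZMod.intCast_eq_intCast_iff] at h
    simpa using h
  have hrange : ∀ a, a ∈ Subgroup.zpowers y ↔ ∃ i, Y i = a := by
    intro a
    constructor
    · rintro ⟨k, rfl⟩
      exact ⟨k, (hY k _ rfl).symm⟩
    · rintro ⟨i, rfl⟩
      exact ⟨_, rfl⟩
  have hconj : ∀ (g : G) (m : ZMod p), g * y * g⁻¹ = Y m → ∀ i, g * Y i * g⁻¹ = Y (m * i) := by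
    intro g m h i
    change g * y ^ (i.val : ℤ) * g⁻¹ = _
    rw [← conj_zpow, h]
    change (y ^ (m.val : ℤ)) ^ (i.val : ℤ) = _
    rw [← _root_.zpow_mul]
    exact hY _ _ (by simp)
  have hm0 : ∀ (g : G) (m : ZMod p), g * y * g⁻¹ = Y m → m ≠ 0 := by
    rintro g m h rfl
    rw [hY0] at h
    have : y = 1 := by
      calc y = g⁻¹ * (g * y * g⁻¹) * g := by group
        _ = 1 := by rw [h]; group
    rw [this, orderOf_one] at hy
    omega
  let B : Subgroup G :=
    { carrier := {g | ∃ m, g * y * g⁻¹ = Y m}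
      mul_mem' := by
        rintro a b ⟨m, hm⟩ ⟨n, hn⟩
        refine ⟨m * n, ?_⟩
        rw [← hconj a m hm n, ← hn]
        group
      one_mem' := ⟨1, by rw [hY1]; group⟩
      inv_mem' := by
        rintro g ⟨m, hm⟩
        refine ⟨m⁻¹, ?_⟩
        have := hconj g m hm m⁻¹
        rw [mul_inv_cancel₀ (hm0 g m hm), hY1] at this
        rw [← this]
        group }
  have hLB : ∀ l ∈ L, l ∈ B := fun l hl => by
    obtain ⟨m, hm⟩ := (hrange _).1 (hLn l hl)
    exact ⟨m, hm.symm⟩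
  have hYB : ∀ i, Y i ∈ B := fun i => ⟨1, by
    rw [hinv, ← hY1, hadd, hadd]; congr 1; ring⟩
  have hzB : z ∉ B := by
    rintro ⟨m, hm⟩
    exact hzy ((hrange _).2 ⟨m, hm.symm⟩)
  have hBL : ∀ b ∈ B, ∃ l ∈ L, ∃ i, b = l * Y i := by
    rintro b ⟨m, hm⟩
    obtain ⟨l, hl, hlm⟩ := hLt (Y m) ((hrange _).2 ⟨m, rfl⟩) (by
      rw [← hY0]; exact hinj.ne (hm0 b m hm))
    have : l⁻¹ * b * y = y * (l⁻¹ * b) := by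
      calc l⁻¹ * b * y = l⁻¹ * (b * y * b⁻¹) * b := by group
        _ = _ := by rw [hm, ← hlm]; group
    obtain ⟨i, hi⟩ := (hrange _).1 (hCy _ this)
    exact ⟨l, hl, i, by rw [hi]; group⟩
  have hcardB : Nat.card B = (p - 1) * p := by
    have : Nat.card (L × ZMod p) = Nat.card B := by
      refine Nat.card_eq_of_bijective
        (fun x => (⟨x.1 * Y x.2, mul_mem (hLB _ x.1.2) (hYB _)⟩ : B)) ⟨?_, ?_⟩
      · rintro ⟨⟨l, hl⟩, i⟩ ⟨⟨l', hl'⟩, j⟩ h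
        have h : l * Y i = l' * Y j := congrArg Subtype.val h
        have h1 : l'⁻¹ * l = Y (j - i) := by
          rw [sub_eq_add_neg, ← hadd, ← hinv]
          calc l'⁻¹ * l = l'⁻¹ * (l * Y i) * (Y i)⁻¹ := by group
            _ = _ := by rw [h]; group
        have h2 : Y (j - i) ∈ L := h1 ▸ mul_mem (inv_mem hl') hl
        have h3 : orderOf (Y (j - i)) ∣ p - 1 := by
          rw [← hLcard]
          exact Subgroup.orderOf_dvd_natCard L h2
        have h4 : orderOf (Y (j - i)) ∣ p := by
          have := orderOf_dvd_of_mem_zpowers ((hrange (Y (j - i))).2 ⟨_, rfl⟩)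
          rwa [hy] at this
        have h5 : Y (j - i) = Y 0 := by
          rw [hY0, ← orderOf_eq_one_iff]
          have h6 := (Nat.dvd_sub_iff_right (show 1 ≤ p by omega) h4).1 h3
          exact Nat.dvd_one.1 h6
        have h6 : i = j := (sub_eq_zero.1 (hinj h5)).symm
        subst h6
        simpa using h
      · rintro ⟨b, hb⟩
        obtain ⟨l, hl, i, rfl⟩ := hBL b hb
        exact ⟨(⟨l, hl⟩, i), rfl⟩
    rw [← this, Nat.card_prod, hLcard, Nat.card_zmod]
  have hcardX : Nat.card (G ⧸ B) = p + 1 := by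
    have h1 := B.card_eq_card_quotient_mul_card_subgroup
    rw [hcard, hcardB] at h1
    obtain ⟨q, rfl⟩ : ∃ q, p = q + 1 := ⟨p - 1, by omega⟩
    have h2 : (q + 1) ^ 2 - 1 = (q + 2) * q := by
      have : (q + 1) ^ 2 = (q + 2) * q + 1 := by ring
      omega
    rw [h2, Nat.add_sub_cancel] at h1
    refine (Nat.eq_of_mul_eq_mul_right (show 0 < q * (q + 1) by
      have : 0 < q := by omega
      positivity) ?_).symm
    rw [← h1]
    ring
  let θ' : OnePoint (ZMod p) → G ⧸ B := fun x =>
    x.elim (QuotientGroup.mk 1) fun i => QuotientGroup.mk (Y i * z)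
  have hθinj : Function.Injective θ' := by
    have h1 : ∀ i, (QuotientGroup.mk 1 : G ⧸ B) ≠ QuotientGroup.mk (Y i * z) := by
      intro i h
      rw [QuotientGroup.eq, inv_one, one_mul] at h
      exact hzB ((Subgroup.mul_mem_cancel_left B (hYB i)).1 h)
    intro a b h
    induction a with
    | infty =>
      induction b with
      | infty => rfl
      | coe j => exact absurd h (h1 j)
    | coe i =>
      induction b with
      | infty => exact absurd h.symm (h1 i)
      | coe j =>
        have h : (QuotientGroup.mk (Y i * z) : G ⧸ B) = QuotientGroup.mk (Y j * z) := h
        rw [QuotientGroup.eq] at h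
        by_contra hij
        have hk : j - i ≠ 0 := fun h => hij (by rw [sub_eq_zero.1 h])
        have hb : z * Y (j - i) * z⁻¹ ∈ B := by
          convert h using 1
          rw [sub_eq_neg_add, ← hadd, ← hinv, _root_.mul_inv_rev, hzinv]
          group
        obtain ⟨m, hm⟩ := hb
        have hpow : ∀ n : ℕ, (z * Y (j - i) * z⁻¹) ^ n * y * ((z * Y (j - i) * z⁻¹) ^ n)⁻¹
            = Y (m ^ n) := by
          intro n
          induction n with
          | zero => simp [hY1]
          | succ n ih =>
            rw [pow_succ m, mul_comm, ← hconj _ m hm, ← ih, pow_succ']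
            generalize z * Y (j - i) * z⁻¹ = w
            simp only [_root_.mul_inv_rev, mul_assoc]
        have h2 := hpow p
        have h3 : Y (j - i) ^ p = 1 := by
          have := orderOf_dvd_of_mem_zpowers ((hrange (Y (j - i))).2 ⟨_, rfl⟩)
          rw [hy] at this
          exact orderOf_dvd_iff_pow_eq_one.1 this
        rw [conj_pow, h3, ZMod.pow_card, ← hm] at h2
        have h4 : z * Y (j - i) * z⁻¹ * y = y * (z * Y (j - i) * z⁻¹) := by
          simp only [mul_one, mul_inv_cancel, one_mul, inv_one] at h2
          exact (eq_mul_inv_iff_mul_eq.1 h2).symm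
        obtain ⟨n, hn⟩ := (hrange _).1 (hCy _ h4)
        apply hzy
        rw [hrange]
        refine ⟨n * (j - i)⁻¹, ?_⟩
        have h5 : ∀ (a : ZMod p) (k : ℕ), Y a ^ k = Y (a * k) := by
          intro a k
          induction k with
          | zero => simp [hY0]
          | succ k ih => rw [pow_succ, ih, hadd]; congr 1; push_cast; ring
        have h6 := congrArg (· ^ ((j - i)⁻¹.val)) hn
        simp only [conj_pow, h5, ZMod.natCast_val, ZMod.cast_id', id_eq, mul_inv_cancel₀ hk,
          hY1] at h6
        exact h6
  let θ : OnePoint (ZMod p) ≃ G ⧸ B := Equiv.ofBijective θ' (by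
    refine hθinj.bijective_of_nat_card_le ?_
    rw [hcardX]
    exact (Finite.card_option (α := ZMod p)).trans (by rw [Nat.card_zmod]) |>.ge)
  have hθinf : θ ∞ = QuotientGroup.mk 1 := rfl
  have hθi : ∀ i : ZMod p, θ i = QuotientGroup.mk (Y i * z) := fun i => rfl
  have hBact : ∀ g b : G, b ∈ B → (QuotientGroup.mk (g * b) : G ⧸ B) = QuotientGroup.mk g :=
    fun g b hb => by rw [eq_comm, QuotientGroup.eq]; simpa using hb
  have hgmk : ∀ g h : G, g • (QuotientGroup.mk h : G ⧸ B) = QuotientGroup.mk (g * h) :=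
    fun g h => rfl
  have hYact : ∀ j i : ZMod p, Y j • θ i = θ ((j + i : ZMod p)) := by
    intro j i
    rw [hθi, hθi, hgmk, ← mul_assoc, hadd]
  have hYinf : ∀ j : ZMod p, Y j • θ ∞ = θ ∞ := by
    intro j
    rw [hθinf, hgmk, mul_one]
    simpa using hBact 1 _ (hYB j)
  have hLinf : ∀ l ∈ L, l • θ ∞ = θ ∞ := by
    intro l hl
    rw [hθinf, hgmk, mul_one]
    simpa using hBact 1 _ (hLB l hl)
  have hLact : ∀ l ∈ L, ∀ m, l * y * l⁻¹ = Y m → ∀ i : ZMod p,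
      l • θ i = θ ((m * i : ZMod p)) := by
    intro l hl m hm i
    rw [hθi, hθi, hgmk, ← hconj l m hm,
      ← hBact (l * Y i * l⁻¹ * z) (z * l * z⁻¹) (hzL l hl ▸ inv_mem (hLB l hl))]
    congr 1
    calc l * (Y i * z) = l * Y i * (z * z) * z := by rw [hz, mul_one, mul_assoc]
      _ = l * Y i * l⁻¹ * (z * z) * l * z := by rw [hz]; group
      _ = _ := by simp only [mul_assoc, hzinv]
  have hzinf : z • θ ∞ = θ (0 : ZMod p) := by
    rw [hθinf, hθi, hgmk, hY0, mul_one, one_mul]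
  have hz0 : z • θ (0 : ZMod p) = θ ∞ := by
    rw [← hzinf, smul_smul, hz, one_smul]
  obtain ⟨c, hc0, hc⟩ : ∃ c : ZMod p, c ≠ 0 ∧ z • θ (1 : ZMod p) = θ c := by
    obtain ⟨x, hx⟩ := θ.surjective (z • θ (1 : ZMod p))
    induction x with
    | infty =>
      rw [← hz0] at hx
      have := θ.injective (MulAction.injective z hx)
      simp at this
    | coe c =>
      refine ⟨c, ?_, hx.symm⟩
      rintro rfl
      rw [← hzinf] at hx
      have := θ.injective (MulAction.injective z hx)
      simp at this
  have hzact : ∀ i : ZMod p, i ≠ 0 → z • θ i = θ ((c / i : ZMod p)) := by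
    intro i hi
    obtain ⟨l, hl, hli⟩ := hLt (Y i) ((hrange _).2 ⟨i, rfl⟩) (by
      rw [← hY0]; exact hinj.ne hi)
    have h1 := hLact l hl i hli 1
    rw [mul_one] at h1
    have h2 := hLact l hl i hli (c / i)
    rw [mul_div_cancel₀ _ hi, ← hc] at h2
    apply MulAction.injective l
    change l • z • θ i = l • θ ((c / i : ZMod p))
    rw [h2, ← h1, smul_smul, smul_smul]
    congr 1
    calc l * z * l = l * (z * l * z⁻¹) * z := by group
      _ = z := by rw [hzL l hl]; group
  let good : G → Prop := fun g => ∃ M : GL (Fin 2) (ZMod p), ∀ i, g • θ i = θ (M • i)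
  have hgood_mul : ∀ a b, good a → good b → good (a * b) := by
    rintro a b ⟨M, hM⟩ ⟨M', hM'⟩
    exact ⟨M * M', fun i => by rw [← smul_smul, hM', hM, smul_smul]⟩
  have hgY : ∀ j, good (Y j) := by
    intro j
    refine ⟨GeneralLinearGroup.mkOfDetNeZero !![1, j; 0, 1] (by simp), fun i => ?_⟩
    induction i with
    | infty => rw [hYinf, smul_infty_eq_self_iff.2 (by simp [GeneralLinearGroup.mkOfDetNeZero])]
    | coe i =>
      rw [hYact, smul_some_eq_ite]
      simp [GeneralLinearGroup.mkOfDetNeZero, add_comm]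
  have hgL : ∀ l ∈ L, good l := by
    intro l hl
    obtain ⟨m, hm⟩ := hLB l hl
    have hm' := hm0 l m hm
    refine ⟨GeneralLinearGroup.mkOfDetNeZero !![m, 0; 0, 1] (by simpa), fun i => ?_⟩
    induction i with
    | infty =>
      rw [hLinf l hl, smul_infty_eq_self_iff.2 (by simp [GeneralLinearGroup.mkOfDetNeZero])]
    | coe i =>
      rw [hLact l hl m hm, smul_some_eq_ite]
      simp [GeneralLinearGroup.mkOfDetNeZero]
  have hgz : good z := by
    refine ⟨GeneralLinearGroup.mkOfDetNeZero !![0, c; 1, 0] (by simpa), fun i => ?_⟩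
    induction i with
    | infty =>
      rw [hzinf, smul_infty_eq_ite]
      simp [GeneralLinearGroup.mkOfDetNeZero]
    | coe i =>
      rw [smul_some_eq_ite]
      by_cases hi : i = 0
      · simp [GeneralLinearGroup.mkOfDetNeZero, hi, hz0]
      · simp [GeneralLinearGroup.mkOfDetNeZero, hi, hzact i hi]
  have hgB : ∀ b ∈ B, good b := by
    intro b hb
    obtain ⟨l, hl, i, rfl⟩ := hBL b hb
    exact hgood_mul _ _ (hgL l hl) (hgY i)
  have hproj : ∀ g, good g := by
    intro g
    obtain ⟨x, hx⟩ := θ.surjective (QuotientGroup.mk g)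
    induction x with
    | infty =>
      rw [hθinf, QuotientGroup.eq, inv_one, one_mul] at hx
      exact hgB g hx
    | coe i =>
      rw [hθi, QuotientGroup.eq] at hx
      have := hgood_mul _ _ (hgood_mul _ _ (hgY i) hgz) (hgB _ hx)
      rwa [mul_inv_cancel_left] at this
  refine nonempty_mulEquiv_PGL_of_action θ ?_ hproj hcard
  intro g hg
  have hgB : g ∈ B := by
    have := hg (θ ∞)
    rw [hθinf, hgmk, mul_one, eq_comm, QuotientGroup.eq] at this
    simpa using this
  obtain ⟨m, hm⟩ := hgB
  have h1 : g * y * g⁻¹ * y⁻¹ = Y (m - 1) := by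
    rw [hm, sub_eq_add_neg, ← hadd, ← hinv, hY1]
  have h2 : (g * y * g⁻¹ * y⁻¹) • θ (0 : ZMod p) = θ (0 : ZMod p) := by
    have h3 : ∀ x : G ⧸ B, g⁻¹ • x = x := fun x => by rw [inv_smul_eq_iff, hg]
    rw [mul_smul, mul_smul, mul_smul, hg, h3, smul_inv_smul]
  rw [h1, hYact, add_zero] at h2
  have h3 := θ.injective h2
  rw [OnePoint.coe_eq_coe, sub_eq_zero] at h3
  rw [h3, hY1, mul_inv_eq_iff_eq_mul] at hm
  obtain ⟨i, rfl⟩ := (hrange _).1 (hCy g hm)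
  have h4 := hg (θ (0 : ZMod p))
  rw [hYact, add_zero] at h4
  have h5 := θ.injective h4
  rw [OnePoint.coe_eq_coe] at h5
  rw [h5, hY0]

end Identification

section GeneralLemmas

variable {G : Type*} [Group G]

theorem inverts_of_no_fixed_points [Finite G] {A : Subgroup G} {τ : G} (hτ : τ * τ = 1)
    (hA : ∀ a ∈ A, τ * a * τ⁻¹ ∈ A) (hfix : ∀ a ∈ A, τ * a = a * τ → a = 1) :
    ∀ a ∈ A, τ * a * τ⁻¹ = a⁻¹ := by
  have hττ : τ⁻¹ = τ := inv_eq_of_mul_eq_one_left hτ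
  let φ : A →* A :=
    { toFun := fun a => ⟨τ * a * τ⁻¹, hA a a.2⟩
      map_one' := by simp
      map_mul' := fun a b => by
        ext
        simp }
  have h1 : MonoidHom.FixedPointFree φ := by
    rintro ⟨a, ha⟩ h
    have h : τ * a * τ⁻¹ = a := congrArg Subtype.val h
    ext
    exact hfix a ha (mul_inv_eq_iff_eq_mul.1 h)
  have h2 : Function.Involutive φ := by
    rintro ⟨a, ha⟩
    ext
    change τ * (τ * a * τ⁻¹) * τ⁻¹ = a
    rw [hττ]
    calc τ * (τ * a * τ) * τ = (τ * τ) * a * (τ * τ) := by group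
      _ = a := by rw [hτ]; group
  intro a ha
  have h3 := congrFun (h1.coe_eq_inv_of_involutive h2) ⟨a, ha⟩
  exact congrArg Subtype.val h3

theorem commute_of_inverts {A : Subgroup G} {τ : G} (h : ∀ a ∈ A, τ * a * τ⁻¹ = a⁻¹) :
    ∀ a ∈ A, ∀ b ∈ A, a * b = b * a := by
  intro a ha b hb
  have h1 := h _ (mul_mem ha hb)
  have h2 : τ * (a * b) * τ⁻¹ = (τ * a * τ⁻¹) * (τ * b * τ⁻¹) := by group
  rw [h2, h a ha, h b hb] at h1
  have := congrArg (·⁻¹) h1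
  simpa using this.symm

theorem exists_conj_mem_of_not_dvd_index [Finite G] {U : Subgroup G} {p : ℕ} [Fact p.Prime]
    (hU : ¬ p ∣ U.index) {w : G} {n : ℕ} (hw : w ^ p ^ n = 1) : ∃ g : G, g * w * g⁻¹ ∈ U := by
  obtain ⟨P⟩ : Nonempty (Sylow p U) := inferInstance
  let P₁ : Subgroup G := (P : Subgroup U).map U.subtype
  have hP₁ : IsPGroup p P₁ := P.2.map _
  have hidx : ¬ p ∣ P₁.index := by
    rw [Subgroup.index_map_subtype, Nat.Prime.dvd_mul Fact.out]
    rintro (h | h)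
    · exact P.not_dvd_index h
    · exact hU h
  let S : Sylow p G := hP₁.toSylow hidx
  have hwp : IsPGroup p (Subgroup.zpowers w) := by
    rintro ⟨_, ⟨i, rfl⟩⟩
    refine ⟨n, ?_⟩
    ext
    change (w ^ i) ^ p ^ n = 1
    rw [← zpow_natCast, zpow_comm, zpow_natCast, hw, one_zpow]
  obtain ⟨T, hT⟩ := hwp.exists_le_sylow
  obtain ⟨g, hg⟩ := MulAction.exists_smul_eq G T S
  refine ⟨g, ?_⟩
  have h1 : g * w * g⁻¹ ∈ (g • T : Sylow p G) := by
    rw [← SetLike.mem_coe, Sylow.coe_smul]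
    exact ⟨w, hT (Subgroup.mem_zpowers w), rfl⟩
  rw [hg] at h1
  obtain ⟨x, -, hx⟩ := (show g * w * g⁻¹ ∈ P₁ from h1)
  rw [← hx]
  exact x.2

theorem exists_involution_mem_zpowers [Finite G] {w : G} (hw : ¬ Odd (orderOf w)) :
    ∃ i ∈ Subgroup.zpowers w, i * i = 1 ∧ i ≠ 1 := by
  obtain ⟨m, hm⟩ := Nat.not_odd_iff_even.1 hw
  have h0 := orderOf_pos w
  refine ⟨w ^ m, ⟨m, by simp⟩, ?_, ?_⟩
  · rw [← pow_add, ← hm, pow_orderOf_eq_one]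
  · intro h
    have := Nat.le_of_dvd (by omega) (orderOf_dvd_of_pow_eq_one h)
    omega

theorem involution_unique_of_mem_zpowers [Finite G] {w i j : G} (hi : i ∈ Subgroup.zpowers w)
    (hj : j ∈ Subgroup.zpowers w) (hi2 : i * i = 1) (hj2 : j * j = 1) (hi1 : i ≠ 1)
    (hj1 : j ≠ 1) : i = j := by
  have key : ∀ x ∈ Subgroup.zpowers w, x * x = 1 → x ≠ 1 →
      ∃ m, orderOf w = m + m ∧ x = w ^ m := by
    intro x hx hx2 hx1
    classical
    rw [mem_zpowers_iff_mem_range_orderOf, Finset.mem_image] at hx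
    obtain ⟨n, hn, rfl⟩ := hx
    rw [Finset.mem_range] at hn
    refine ⟨n, ?_, rfl⟩
    rw [← pow_add] at hx2
    obtain ⟨c, hc⟩ := orderOf_dvd_of_pow_eq_one hx2
    have h0 : n ≠ 0 := by
      rintro rfl
      simp at hx1
    have hc2 : c < 2 := by
      by_contra! h
      nlinarith
    interval_cases c <;> omega
  obtain ⟨m, hm, rfl⟩ := key i hi hi2 hi1
  obtain ⟨n, hn, rfl⟩ := key j hj hj2 hj1
  congr 1
  omega

theorem orderOf_conj_mul_inv (g w : G) : orderOf (g * w * g⁻¹) = orderOf w :=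
  MulEquiv.orderOf_eq (MulAut.conj g) w

theorem orderOf_conj_inv_mul (g w : G) : orderOf (g⁻¹ * w * g) = orderOf w := by
  simpa using orderOf_conj_mul_inv g⁻¹ w

theorem eq_one_of_odd_of_sq {g : G} (h : Odd (orderOf g)) (h2 : g * g = 1) : g = 1 := by
  have h3 : orderOf g ∣ 2 := orderOf_dvd_of_pow_eq_one (by rw [pow_two, h2])
  rcases (Nat.dvd_prime Nat.prime_two).1 h3 with h4 | h4
  · exact orderOf_eq_one_iff.1 h4
  · rw [h4] at h
    exact absurd h (by decide)

theorem ncard_conj_mul [Finite G] {X M : Set G}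
    (hM : ∀ x ∈ X, ∀ g : G, g * x * g⁻¹ ∈ X ↔ g ∈ M) :
    {y : G | ∃ g, ∃ x ∈ X, g * x * g⁻¹ = y}.ncard * M.ncard = Nat.card G * X.ncard := by
  classical
  have := Fintype.ofFinite G
  set Y := {y : G | ∃ g, ∃ x ∈ X, g * x * g⁻¹ = y} with hY
  have h := Finset.sum_card_bipartiteAbove_eq_sum_card_bipartiteBelow
    (s := Y.toFinset) (t := Finset.univ) (r := fun y g => g⁻¹ * y * g ∈ X)
  have h1 : ∀ y ∈ Y.toFinset,
      (Finset.univ.bipartiteAbove (fun y g => g⁻¹ * y * g ∈ X) y).card = M.ncard := by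
    intro y hy
    rw [Set.mem_toFinset] at hy
    obtain ⟨g, x, hx, rfl⟩ := hy
    rw [Set.ncard_eq_toFinset_card']
    refine Finset.card_bij (fun k _ => k⁻¹ * g) ?_ ?_ ?_
    · intro k hk
      rw [Finset.mem_bipartiteAbove] at hk
      rw [Set.mem_toFinset, ← hM x hx]
      convert hk.2 using 1
      group
    · intro a _ b _ hab
      simpa using hab
    · intro m hm
      rw [Set.mem_toFinset, ← hM x hx] at hm
      refine ⟨g * m⁻¹, ?_, by group⟩
      rw [Finset.mem_bipartiteAbove]
      refine ⟨Finset.mem_univ _, ?_⟩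
      convert hm using 1
      group
  have h2 : ∀ g ∈ (Finset.univ : Finset G),
      (Y.toFinset.bipartiteBelow (fun y g => g⁻¹ * y * g ∈ X) g).card = X.ncard := by
    intro g _
    rw [Set.ncard_eq_toFinset_card']
    refine Finset.card_bij (fun y _ => g⁻¹ * y * g) ?_ ?_ ?_
    · intro y hy
      rw [Finset.mem_bipartiteBelow] at hy
      rw [Set.mem_toFinset]
      exact hy.2
    · intro a _ b _ hab
      simpa using hab
    · intro x hx
      rw [Set.mem_toFinset] at hx
      refine ⟨g * x * g⁻¹, ?_, by group⟩
      rw [Finset.mem_bipartiteBelow, Set.mem_toFinset]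
      refine ⟨⟨g, x, hx, rfl⟩, ?_⟩
      convert hx using 1
      group
  rw [Finset.sum_congr rfl h1, Finset.sum_congr rfl h2, Finset.sum_const, Finset.sum_const,
    smul_eq_mul, smul_eq_mul, Finset.card_univ, ← Nat.card_eq_fintype_card] at h
  rw [Set.ncard_eq_toFinset_card' Y]
  exact h

theorem dvd_ncard_of_conj_invariant [Finite G] {F : Set G} {d : ℕ}
    (hF : ∀ y ∈ F, ∀ g : G, g * y * g⁻¹ ∈ F)
    (hd : ∀ y ∈ F, d ∣ {y' : G | IsConj y y'}.ncard) : d ∣ F.ncard := by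
  classical
  have := Fintype.ofFinite G
  rw [Set.ncard_eq_toFinset_card',
    Finset.card_eq_sum_card_image (fun y => ConjClasses.mk y) F.toFinset]
  refine Finset.dvd_sum fun c hc => ?_
  obtain ⟨y, hy, rfl⟩ := Finset.mem_image.1 hc
  rw [Set.mem_toFinset] at hy
  refine (hd y hy).trans (dvd_of_eq ?_)
  rw [Set.ncard_eq_toFinset_card']
  congr 1
  ext y'
  simp only [Finset.mem_filter, Set.mem_toFinset, ConjClasses.mk_eq_mk_iff_isConj,
    Set.mem_ofPred_eq]
  constructor
  · intro h
    obtain ⟨g, rfl⟩ := isConj_iff.1 h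
    exact ⟨hF y hy g, h.symm⟩
  · exact fun h => h.2.symm

theorem odd_card_of_forall_odd_orderOf [Finite G] {V : Subgroup G}
    (hV : ∀ v ∈ V, Odd (orderOf v)) : Odd (Nat.card V) := by
  by_contra h
  obtain ⟨v, hv⟩ := exists_prime_orderOf_dvd_card' 2 (Nat.not_odd_iff_even.1 h).two_dvd
  have h1 := hV v v.2
  rw [Subgroup.orderOf_coe, hv] at h1
  exact absurd h1 (by decide)

theorem odd_orderOf_of_mem_odd_card {V : Subgroup G} (hV : Odd (Nat.card V)) {v : G}
    (hv : v ∈ V) : Odd (orderOf v) :=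
  Odd.of_dvd_nat hV (Subgroup.orderOf_dvd_natCard V hv)

/-- A finite group with an involution `z` whose centralizer is `{1, z}` is a generalized
dihedral group with respect to the subgroup of elements of odd order. -/
theorem exists_odd_subgroup_of_centralizer_eq_pair [Finite G] {z : G} (hz : z * z = 1)
    (hz1 : z ≠ 1) (hC : ∀ g : G, g * z = z * g → g = 1 ∨ g = z) :
    ∃ V : Subgroup G, Odd (Nat.card V) ∧ (∀ v ∈ V, z * v * z⁻¹ = v⁻¹) ∧
      ∀ b, b ∈ V ∨ z * b ∈ V := by
  have hzz : z⁻¹ = z := inv_eq_of_mul_eq_one_left hz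
  have hinv : ∀ k : G, z * (z * (k * z * k⁻¹)) * z⁻¹ = (z * (k * z * k⁻¹))⁻¹ := by
    intro k
    simp only [_root_.mul_inv_rev, inv_inv, hzz, mul_assoc]
    rw [← mul_assoc z z, hz, one_mul]
  have hodd : ∀ k : G, Odd (orderOf (z * (k * z * k⁻¹))) := by
    intro k
    by_contra h
    obtain ⟨i, ⟨m, rfl⟩, hi2, hi1⟩ := exists_involution_mem_zpowers h
    simp only at hi2 hi1
    have h1 : z * (z * (k * z * k⁻¹)) ^ m * z⁻¹ = (z * (k * z * k⁻¹)) ^ m := by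
      rw [← conj_zpow, hinv, inv_zpow, inv_eq_of_mul_eq_one_left hi2]
    rcases hC _ (mul_inv_eq_iff_eq_mul.1 h1).symm with h2 | h2
    · exact hi1 h2
    · have h3 : Commute z (z * (k * z * k⁻¹)) := by
        have := (Commute.refl (z * (k * z * k⁻¹))).zpow_left m
        rwa [h2] at this
      have h4 : k * z * k⁻¹ * z = z * (k * z * k⁻¹) := by
        have := h3.eq
        rw [mul_assoc z (k * z * k⁻¹)] at this
        exact (mul_left_cancel this).symm
      rcases hC _ h4 with h5 | h5
      · apply hz1
        calc z = k⁻¹ * (k * z * k⁻¹) * k := by group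
          _ = 1 := by rw [h5]; group
      · rw [h5, hz, orderOf_one] at h
        exact h odd_one
  have hcover : ∀ b : G, (∃ k, b = k * z * k⁻¹) ∨ ∃ k, b = z * (k * z * k⁻¹) := by
    have hcount := ncard_conj_mul (X := {z}) (M := {1, z}) (by
      rintro x rfl g
      rw [Set.mem_singleton_iff, mul_inv_eq_iff_eq_mul, Set.mem_insert_iff,
        Set.mem_singleton_iff]
      refine ⟨hC g, ?_⟩
      rintro (rfl | rfl) <;> simp)
    rw [Set.ncard_pair hz1.symm, Set.ncard_singleton, mul_one] at hcount
    set K := {y : G | ∃ g, ∃ x ∈ ({z} : Set G), g * x * g⁻¹ = y} with hK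
    have hKmem : ∀ b, b ∈ K ↔ ∃ k, b = k * z * k⁻¹ := by
      intro b
      simp [hK, eq_comm]
    have hdisj : Disjoint K ((z * ·) '' K) := by
      rw [Set.disjoint_left]
      rintro b hb ⟨c, hc, rfl⟩
      obtain ⟨k, hk⟩ := (hKmem _).1 hb
      obtain ⟨l, rfl⟩ := (hKmem _).1 hc
      simp only at hk
      have h1 := eq_one_of_odd_of_sq (hodd l) (by
        rw [hk]
        calc k * z * k⁻¹ * (k * z * k⁻¹) = k * (z * z) * k⁻¹ := by group
          _ = 1 := by rw [hz]; group)
      rw [h1] at hk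
      apply hz1
      calc z = k⁻¹ * (k * z * k⁻¹) * k := by group
        _ = 1 := by rw [← hk]; group
    have hunion : K ∪ (z * ·) '' K = Set.univ := by
      apply Set.eq_of_subset_of_ncard_le (Set.subset_univ _)
      rw [Set.ncard_union_eq hdisj, Set.ncard_image_of_injective _ (mul_right_injective z),
        Set.ncard_univ]
      omega
    intro b
    have hb : b ∈ K ∪ (z * ·) '' K := hunion ▸ Set.mem_univ b
    rcases hb with hb | ⟨c, hc, rfl⟩
    · exact Or.inl ((hKmem b).1 hb)
    · obtain ⟨k, rfl⟩ := (hKmem c).1 hc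
      exact Or.inr ⟨k, rfl⟩
  have hform : ∀ v : G, Odd (orderOf v) → ∃ k, v = z * (k * z * k⁻¹) := by
    intro v hv
    rcases hcover v with ⟨k, rfl⟩ | h
    · refine ⟨1, ?_⟩
      rw [eq_one_of_odd_of_sq hv]
      · simp [hz]
      · calc k * z * k⁻¹ * (k * z * k⁻¹) = k * (z * z) * k⁻¹ := by group
          _ = 1 := by rw [hz]; group
    · exact h
  have hzv : ∀ v : G, Odd (orderOf v) → z * v * z⁻¹ = v⁻¹ := by
    intro v hv
    obtain ⟨k, rfl⟩ := hform v hv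
    exact hinv k
  have hcomm : ∀ v w : G, Odd (orderOf v) → Odd (orderOf w) → v * w = w * v := by
    intro v w hv hw
    obtain ⟨k, rfl⟩ := hform v hv
    have h1 : k * z * k⁻¹ * w * (k * z * k⁻¹)⁻¹ = w⁻¹ := by
      have h2 : Odd (orderOf (k⁻¹ * w * k)) := by
        rwa [orderOf_conj_inv_mul]
      calc k * z * k⁻¹ * w * (k * z * k⁻¹)⁻¹ = k * (z * (k⁻¹ * w * k) * z⁻¹) * k⁻¹ := by group
        _ = w⁻¹ := by rw [hzv _ h2]; group
    rw [← mul_inv_eq_iff_eq_mul]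
    have h3 : Odd (orderOf w⁻¹) := by rwa [orderOf_inv]
    calc z * (k * z * k⁻¹) * w * (z * (k * z * k⁻¹))⁻¹
        = z * (k * z * k⁻¹ * w * (k * z * k⁻¹)⁻¹) * z⁻¹ := by group
      _ = w := by rw [h1, hzv _ h3, inv_inv]
  let V : Subgroup G :=
    { carrier := {v | Odd (orderOf v)}
      mul_mem' := fun {a b} ha hb =>
        Odd.of_dvd_nat (ha.mul hb) (Commute.orderOf_mul_dvd_mul_orderOf (hcomm a b ha hb))
      one_mem' := by simp
      inv_mem' := by simp }
  refine ⟨V, odd_card_of_forall_odd_orderOf fun v hv => hv, hzv, fun b => ?_⟩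
  rcases hcover b with ⟨k, rfl⟩ | ⟨k, rfl⟩
  · exact Or.inr (hodd k)
  · exact Or.inl (hodd k)

theorem exists_odd_subgroup_of_centralizer_inf_eq_pair [Finite G] {B : Subgroup G} {z : G}
    (hzB : z ∈ B) (hz : z * z = 1) (hz1 : z ≠ 1)
    (hC : ∀ g ∈ B, g * z = z * g → g = 1 ∨ g = z) :
    ∃ V : Subgroup G, V ≤ B ∧ Odd (Nat.card V) ∧ (∀ v ∈ V, z * v * z⁻¹ = v⁻¹) ∧
      ∀ b ∈ B, b ∈ V ∨ z * b ∈ V := by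
  obtain ⟨V, h1, h2, h3⟩ := exists_odd_subgroup_of_centralizer_eq_pair (G := B) (z := ⟨z, hzB⟩)
    (Subtype.ext hz) (fun h => hz1 (congrArg Subtype.val h)) (by
      rintro ⟨g, hg⟩ h
      rcases hC g hg (congrArg Subtype.val h) with h | h
      · exact Or.inl (Subtype.ext h)
      · exact Or.inr (Subtype.ext h))
  refine ⟨V.map B.subtype, Subgroup.map_subtype_le V, ?_, ?_, ?_⟩
  · rwa [Subgroup.card_map_of_injective B.subtype_injective]
  · rintro _ ⟨v, hv, rfl⟩
    exact congrArg Subtype.val (h2 v hv)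
  · intro b hb
    rcases h3 ⟨b, hb⟩ with h | h
    · exact Or.inl ⟨_, h, rfl⟩
    · exact Or.inr ⟨_, h, rfl⟩

end GeneralLemmas

section Arithmetic

theorem eq_or_eq_of_four_mul_dvd {k e u : ℕ} (hk : 2 ≤ k) (he : e = 2 ^ k) (hu : Odd u)
    (h : 4 * e * u ∣ (e + u) ^ 2 - 1) : u = e + 1 ∨ u + 1 = e := by
  have he4 : 4 ≤ e := he ▸ Nat.pow_le_pow_right two_pos hk
  obtain ⟨f, hf⟩ : ∃ f, e = 2 * f := ⟨2 ^ (k - 1), by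
    rw [he, ← pow_succ', Nat.sub_add_cancel (by omega)]⟩
  obtain ⟨t, ht⟩ := hu
  have h1 : (4 * e * u : ℤ) ∣ (e + u) ^ 2 - 1 := by
    have := Int.natCast_dvd_natCast.2 h
    rw [Nat.cast_sub (Nat.one_le_pow _ _ (by omega))] at this
    exact_mod_cast this
  obtain ⟨c, hc⟩ := h1
  obtain ⟨b, hb⟩ : ∃ b : ℤ, (e : ℤ) - u - 1 = 2 * b := ⟨f - t - 1, by omega⟩
  have h2 : (2 : ℤ) ^ k ∣ b * (b + 1) := by
    refine ⟨u * (c - 1), ?_⟩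
    have h3 : ((2 : ℤ) ^ k) = e := by rw [he]; norm_cast
    rw [h3]
    have h4 : (u : ℤ) = e - 1 - 2 * b := by linarith
    have h5 : ((e : ℤ) - u) ^ 2 - 1 = 4 * e * u * (c - 1) := by linear_combination hc
    have h6 : (e : ℤ) - u = 2 * b + 1 := by linarith
    rw [h6] at h5
    linarith
  have h3 : (e : ℤ) ∣ b ∨ (e : ℤ) ∣ b + 1 := by
    have h4 : ((e : ℕ) : ℤ) = 2 ^ k := by rw [he]; norm_cast
    rw [h4]
    by_cases h5 : (2 : ℤ) ∣ b
    · exact Or.inl (Int.prime_two.pow_dvd_of_dvd_mul_right k (by omega) h2)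
    · exact Or.inr (Int.prime_two.pow_dvd_of_dvd_mul_left k h5 h2)
  obtain ⟨d, hd⟩ : (u : ℤ) ∣ e ^ 2 - 1 := ⟨4 * e * c - 2 * e - u, by linear_combination hc⟩
  have hd1 : 0 < d := by
    by_contra! h
    nlinarith
  rcases h3 with ⟨j, hj⟩ | ⟨j, hj⟩
  · have hu' : (u : ℤ) = e - 1 - 2 * e * j := by linarith
    have hj0 : j ≤ 0 := by
      by_contra! h
      nlinarith
    rcases hj0.lt_or_eq with hj0 | rfl
    · exfalso
      have hde : d < e - 1 := by
        by_contra! h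
        nlinarith
      obtain ⟨w, hw⟩ : (e : ℤ) ∣ d - 1 := ⟨d - 2 * j * d - e, by
        rw [hu'] at hd; linear_combination hd⟩
      have hw0 : w = 0 := by
        by_contra hne
        rcases lt_or_gt_of_ne hne with h | h <;> nlinarith
      subst hw0
      have hd' : d = 1 := by linarith
      subst hd'
      have : (e : ℤ) * (e - 1 + 2 * j) = 0 := by linear_combination hd + hu'
      rcases mul_eq_zero.1 this with h | h <;> omega
    · right
      omega
  · have hu' : (u : ℤ) = e + 1 - 2 * e * j := by linarith
    have hj0 : j ≤ 0 := by
      by_contra! h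
      nlinarith
    rcases hj0.lt_or_eq with hj0 | rfl
    · exfalso
      have hde : d < e - 1 := by
        by_contra! h
        nlinarith
      obtain ⟨w, hw⟩ : (e : ℤ) ∣ d + 1 := ⟨e - d + 2 * j * d, by
        rw [hu'] at hd; linear_combination -hd⟩
      rcases le_or_gt w 0 with h | h <;> nlinarith
    · left
      omega

theorem exists_odd_cofactor (ρ i : ℕ) (hρ : Odd ρ) :
    ∃ c : ℕ, Odd c ∧ ρ ^ (2 * i + 1) + 1 = (ρ + 1) * c := by
  induction i with
  | zero => exact ⟨1, odd_one, by simp⟩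
  | succ i ih =>
    obtain ⟨c, hc, h⟩ := ih
    obtain ⟨t, rfl⟩ := hρ
    obtain ⟨d, rfl⟩ := hc
    refine ⟨2 * (4 * t ^ 2 * d + 2 * t ^ 2 + 4 * t * d + t + d) + 1, ⟨_, rfl⟩, ?_⟩
    have h1 : (2 * t + 1) ^ (2 * (i + 1) + 1) = (2 * t + 1) ^ 2 * (2 * t + 1) ^ (2 * i + 1) := by
      ring
    zify at h h1 ⊢
    rw [h1]
    linear_combination (2 * t + 1) ^ 2 * h

theorem exponent_eq_one_of_prime_pow_add_one_eq {ρ j m : ℕ} (hρ : ρ.Prime) (hm : 3 ≤ m)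
    (h : ρ ^ j + 1 = 2 ^ m) : j = 1 := by
  obtain ⟨m, rfl⟩ := Nat.exists_eq_add_of_le' hm
  rw [pow_add] at h
  have hodd : Odd ρ := by
    rcases hρ.eq_two_or_odd' with rfl | h2
    · rcases j with _ | j
      · omega
      · rw [pow_succ] at h
        omega
    · exact h2
  rcases Nat.even_or_odd' j with ⟨i, rfl | rfl⟩
  · have h1 := Nat.eight_dvd_sq_sub_one_of_odd (hodd.pow (n := i))
    have h2 : 0 < (ρ ^ i) ^ 2 := pow_pos (pow_pos hρ.pos _) _
    rw [← pow_mul, mul_comm i] at h1 h2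
    omega
  · obtain ⟨c, hc, h1⟩ := exists_odd_cofactor ρ i hodd
    have h2 : c = 1 := by
      have : c ∣ 2 ^ (m + 3) := ⟨ρ + 1, by rw [pow_add, ← h, h1, mul_comm]⟩
      exact Nat.Coprime.eq_one_of_dvd (Nat.Coprime.pow_right _ (Nat.coprime_two_right.2 hc)) this
    rw [h2, mul_one] at h1
    have h3 : ρ ^ (2 * i + 1) = ρ ^ 1 := by rw [pow_one]; omega
    exact Nat.pow_right_injective hρ.two_le h3

end Arithmetic

/-- A subgroup `N` of index two, together with a dihedral Sylow `2`-subgroup of order `4 * e`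
generated by `r` and `s`, which is the centralizer of its central involution `z`. -/
structure DihedralConfig {G : Type*} [Group G] (N : Subgroup G) (e : ℕ) (r s z : G) : Prop where
  normal : N.Normal
  index : N.index = 2
  e_eq : ∃ k, 2 ≤ k ∧ e = 2 ^ k
  orderOf_r : orderOf r = 2 * e
  z_eq : z = r ^ e
  s_mul_s : s * s = 1
  s_conj_r : s * r * s⁻¹ = r⁻¹
  r_notMem : r ∉ N
  s_notMem : s ∉ N
  centralizer : ∀ g, g * z = z * g → ∃ i : ℕ, g = r ^ i ∨ g = s * r ^ i
  isConj : IsConj z (s * r)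
  card : ∃ m, Odd m ∧ Nat.card G = 4 * e * m
  eq_bot : ∀ A : Subgroup G, Odd (Nat.card A) → (∀ a ∈ A, ∀ b ∈ A, a * b = b * a) →
    (∀ a ∈ A, r * a * r⁻¹ ∈ A) → A = ⊥

namespace DihedralConfig

variable {G : Type*} [Group G] {N : Subgroup G} {e : ℕ} {r s z : G}

theorem four_le (h : DihedralConfig N e r s z) : 4 ≤ e := by
  obtain ⟨k, hk, rfl⟩ := h.e_eq
  exact Nat.pow_le_pow_right two_pos hk

theorem exists_half (h : DihedralConfig N e r s z) : ∃ f, e = 2 * f ∧ Even f := by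
  obtain ⟨k, hk, rfl⟩ := h.e_eq
  refine ⟨2 ^ (k - 1), ?_, ?_⟩
  · rw [← pow_succ', Nat.sub_add_cancel (by omega)]
  · exact (Nat.even_pow.2 ⟨even_two, by omega⟩)

theorem coprime_of_odd (h : DihedralConfig N e r s z) {n : ℕ} (hn : Odd n) :
    n.Coprime (4 * e) := by
  obtain ⟨k, hk, rfl⟩ := h.e_eq
  rw [show 4 * 2 ^ k = 2 ^ (k + 2) by ring]
  exact Nat.Coprime.pow_right _ (Nat.coprime_two_right.2 hn)

theorem mul_mem_iff (h : DihedralConfig N e r s z) (a b : G) : a * b ∈ N ↔ (a ∈ N ↔ b ∈ N) :=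
  Subgroup.mul_mem_iff_of_index_two h.index

theorem conj_mem_iff (h : DihedralConfig N e r s z) (a g : G) : g * a * g⁻¹ ∈ N ↔ a ∈ N :=
  ⟨fun hg => by
    have := h.normal.conj_mem _ hg g⁻¹
    simpa [mul_assoc] using this, fun ha => h.normal.conj_mem a ha g⟩

theorem mem_of_odd (h : DihedralConfig N e r s z) {g : G} (hg : Odd (orderOf g)) : g ∈ N := by
  obtain ⟨m, hm⟩ := hg
  have h1 : g ^ 2 ∈ N := Subgroup.sq_mem_of_index_two h.index g
  have h2 : g * (g ^ 2) ^ m = 1 := by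
    rw [← pow_mul, ← pow_succ', ← hm, pow_orderOf_eq_one]
  rw [eq_inv_of_mul_eq_one_left h2]
  exact inv_mem (pow_mem h1 m)

theorem z_mul_z (h : DihedralConfig N e r s z) : z * z = 1 := by
  rw [h.z_eq, ← pow_add, ← two_mul, ← h.orderOf_r, pow_orderOf_eq_one]

theorem z_inv (h : DihedralConfig N e r s z) : z⁻¹ = z := inv_eq_of_mul_eq_one_left h.z_mul_z

theorem s_inv (h : DihedralConfig N e r s z) : s⁻¹ = s := inv_eq_of_mul_eq_one_left h.s_mul_s

theorem z_ne_one (h : DihedralConfig N e r s z) : z ≠ 1 := by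
  rw [h.z_eq]
  intro h1
  have := Nat.le_of_dvd (by have := h.four_le; omega) (orderOf_dvd_of_pow_eq_one h1)
  rw [h.orderOf_r] at this
  have := h.four_le
  omega

theorem s_ne_one (h : DihedralConfig N e r s z) : s ≠ 1 := by
  rintro rfl
  exact h.s_notMem (one_mem N)

theorem s_conj_pow (h : DihedralConfig N e r s z) (i : ℕ) : s * r ^ i * s⁻¹ = (r ^ i)⁻¹ := by
  rw [← conj_pow, h.s_conj_r, inv_pow]

theorem s_mul_pow (h : DihedralConfig N e r s z) (i : ℕ) : s * r ^ i = (r ^ i)⁻¹ * s := by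
  rw [← h.s_conj_pow]
  group

theorem s_comm_z (h : DihedralConfig N e r s z) : s * z = z * s := by
  rw [h.z_eq, h.s_mul_pow, ← h.z_eq, h.z_inv]

theorem pow_comm_z (h : DihedralConfig N e r s z) (i : ℕ) : r ^ i * z = z * r ^ i := by
  rw [h.z_eq, ← pow_add, ← pow_add, add_comm]

theorem reflection_comm_z (h : DihedralConfig N e r s z) (i : ℕ) :
    s * r ^ i * z = z * (s * r ^ i) := by
  rw [mul_assoc, h.pow_comm_z, ← mul_assoc, h.s_comm_z, mul_assoc]

theorem pow_mem_iff (h : DihedralConfig N e r s z) (i : ℕ) : r ^ i ∈ N ↔ Even i := by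
  induction i with
  | zero => simp
  | succ i ih =>
    rw [pow_succ, h.mul_mem_iff, ih, Nat.even_add_one]
    have := h.r_notMem
    tauto

theorem reflection_mem_iff (h : DihedralConfig N e r s z) (i : ℕ) : s * r ^ i ∈ N ↔ Odd i := by
  rw [h.mul_mem_iff, h.pow_mem_iff, ← Nat.not_even_iff_odd]
  have := h.s_notMem
  tauto

theorem z_mem (h : DihedralConfig N e r s z) : z ∈ N := by
  rw [h.z_eq, h.pow_mem_iff]
  obtain ⟨f, hf, -⟩ := h.exists_half
  exact ⟨f, by omega⟩

theorem reflection_sq (h : DihedralConfig N e r s z) (i : ℕ) :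
    s * r ^ i * (s * r ^ i) = 1 := by
  nth_rw 1 [h.s_mul_pow]
  calc (r ^ i)⁻¹ * s * (s * r ^ i) = (r ^ i)⁻¹ * (s * s) * r ^ i := by group
    _ = 1 := by rw [h.s_mul_s]; group

theorem eq_one_or_eq_z_of_pow_sq (h : DihedralConfig N e r s z) {i : ℕ}
    (hi : r ^ i * r ^ i = 1) : r ^ i = 1 ∨ r ^ i = z := by
  rw [← pow_add] at hi
  have h1 := orderOf_dvd_of_pow_eq_one hi
  rw [h.orderOf_r, ← two_mul] at h1
  obtain ⟨c, rfl⟩ := Nat.dvd_of_mul_dvd_mul_left two_pos h1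
  rw [pow_mul, ← h.z_eq]
  rcases Nat.even_or_odd' c with ⟨d, rfl | rfl⟩
  · left
    rw [pow_mul, pow_two, h.z_mul_z, one_pow]
  · right
    rw [pow_succ, pow_mul, pow_two, h.z_mul_z, one_pow, one_mul]

theorem reflection_eq_conj (h : DihedralConfig N e r s z) (j : ℕ) :
    s * r ^ (2 * j) = (r ^ j)⁻¹ * s * r ^ j := by
  rw [two_mul, pow_add, ← mul_assoc, h.s_mul_pow]

theorem reflection_ne_z (h : DihedralConfig N e r s z) (i : ℕ) : s * r ^ i ≠ z := by
  intro hi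
  have h1 : s = z * (r ^ i)⁻¹ := eq_mul_inv_of_mul_eq hi
  have h2 : s * r ^ 1 = r ^ 1 * s := by
    rw [h1, h.z_eq]
    group
  rw [h.s_mul_pow, mul_left_inj] at h2
  have h3 : r ^ 1 * r ^ 1 = 1 := by
    nth_rw 1 [← h2]
    group
  have h4 : orderOf r ∣ 2 := orderOf_dvd_of_pow_eq_one (by rwa [← pow_add] at h3)
  have := Nat.le_of_dvd two_pos h4
  have := h.four_le
  have := h.orderOf_r
  omega

theorem mem_centralizer_iff (h : DihedralConfig N e r s z) (g : G) :
    g * z = z * g ↔ ∃ i < 2 * e, g = r ^ i ∨ g = s * r ^ i := by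
  constructor
  · intro hg
    obtain ⟨i, hi⟩ := h.centralizer g hg
    refine ⟨i % (2 * e), Nat.mod_lt _ (by have := h.four_le; omega), ?_⟩
    rwa [← h.orderOf_r, pow_mod_orderOf]
  · rintro ⟨i, -, rfl | rfl⟩
    · exact h.pow_comm_z i
    · exact h.reflection_comm_z i

theorem reflection_ne_pow (h : DihedralConfig N e r s z) (i j : ℕ) : s * r ^ i ≠ r ^ j := by
  intro hij
  have h1 := h.reflection_sq i
  have h2 := h1
  rw [hij] at h1
  rcases h.eq_one_or_eq_z_of_pow_sq h1 with h3 | h3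
  · rw [h3] at hij
    have h4 : s = (r ^ i)⁻¹ := eq_inv_of_mul_eq_one_left hij
    refine h.reflection_ne_z (i + e) ?_
    rw [pow_add, ← mul_assoc, hij, one_mul, h.z_eq]
  · exact h.reflection_ne_z i (hij.trans h3)

theorem ncard_centralizer (h : DihedralConfig N e r s z) :
    {g : G | g * z = z * g}.ncard = 4 * e := by
  classical
  have h1 : {g : G | g * z = z * g} = ((Finset.range (2 * e)).image (fun i => r ^ i) ∪
      (Finset.range (2 * e)).image (fun i => s * r ^ i) : Finset G) := by
    ext g
    rw [Set.mem_ofPred_eq, h.mem_centralizer_iff]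
    simp only [Finset.coe_union, Finset.coe_image, Finset.coe_range, Set.mem_union, Set.mem_image,
      Set.mem_Iio]
    constructor
    · rintro ⟨i, hi, rfl | rfl⟩
      · exact Or.inl ⟨i, hi, rfl⟩
      · exact Or.inr ⟨i, hi, rfl⟩
    · rintro (⟨i, hi, rfl⟩ | ⟨i, hi, rfl⟩)
      · exact ⟨i, hi, Or.inl rfl⟩
      · exact ⟨i, hi, Or.inr rfl⟩
  have hinj : Set.InjOn (fun i => r ^ i) (Finset.range (2 * e) : Finset ℕ) := by
    rw [← h.orderOf_r, Finset.coe_range]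
    exact pow_injOn_Iio_orderOf
  rw [h1, Set.ncard_coe_finset, Finset.card_union_of_disjoint, Finset.card_image_of_injOn hinj,
    Finset.card_image_of_injOn, Finset.card_range]
  · ring
  · intro i hi j hj hij
    exact hinj hi hj (mul_left_cancel hij)
  · rw [Finset.disjoint_left]
    intro g h2 h3
    obtain ⟨i, -, rfl⟩ := Finset.mem_image.1 h2
    obtain ⟨j, -, hj⟩ := Finset.mem_image.1 h3
    exact h.reflection_ne_pow j i hj

theorem eq_one_of_odd_of_comm_z (h : DihedralConfig N e r s z) {g : G}
    (hg : Odd (orderOf g)) (hgz : g * z = z * g) : g = 1 := by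
  obtain ⟨i, rfl | rfl⟩ := h.centralizer g hgz
  · have h1 : orderOf (r ^ i) ∣ 2 * e := h.orderOf_r ▸ orderOf_pow_dvd i
    have h2 := h.coprime_of_odd hg
    have h3 : orderOf (r ^ i) ∣ 4 * e := h1.trans ⟨2, by ring⟩
    exact orderOf_eq_one_iff.1 (Nat.Coprime.eq_one_of_dvd h2 h3)
  · exact eq_one_of_odd_of_sq hg (h.reflection_sq i)

variable [Finite G]

theorem exists_conj_comm_z (h : DihedralConfig N e r s z) {i : G} (hi : i * i = 1) :
    ∃ g : G, g * i * g⁻¹ * z = z * (g * i * g⁻¹) := by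
  have h1 : Nat.card (Subgroup.centralizer {z}) = 4 * e := by
    rw [← h.ncard_centralizer, ← Nat.card_coe_set_eq]
    refine Nat.card_congr (Equiv.setCongr ?_)
    ext g
    simp [Subgroup.mem_centralizer_singleton_iff, eq_comm]
  obtain ⟨m, hm, hG⟩ := h.card
  have h2 : (Subgroup.centralizer {z}).index = m := by
    have h3 := (Subgroup.centralizer {z}).card_mul_index
    rw [h1, hG] at h3
    exact Nat.eq_of_mul_eq_mul_left (by have := h.four_le; omega) h3
  have := Fact.mk Nat.prime_two
  obtain ⟨g, hg⟩ := exists_conj_mem_of_not_dvd_index (U := Subgroup.centralizer {z}) (p := 2)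
    (w := i) (n := 1) (by rw [h2]; exact hm.not_two_dvd_nat) (by rw [pow_one, pow_two, hi])
  refine ⟨g, ?_⟩
  rw [Subgroup.mem_centralizer_singleton_iff] at hg
  exact hg

theorem isConj_z_of_mem (h : DihedralConfig N e r s z) {i : G} (hi : i * i = 1) (hi1 : i ≠ 1)
    (hiN : i ∈ N) : IsConj z i := by
  obtain ⟨g, hg⟩ := h.exists_conj_comm_z hi
  have hgi : IsConj (g * i * g⁻¹) i := (isConj_iff.2 ⟨g, rfl⟩ : IsConj i _).symm
  refine IsConj.trans ?_ hgi
  have h1 : g * i * g⁻¹ * (g * i * g⁻¹) = 1 := by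
    calc g * i * g⁻¹ * (g * i * g⁻¹) = g * (i * i) * g⁻¹ := by group
      _ = 1 := by rw [hi]; group
  have h2 : g * i * g⁻¹ ≠ 1 := by simpa using hi1
  have h3 : g * i * g⁻¹ ∈ N := (h.conj_mem_iff _ _).2 hiN
  obtain ⟨j, hj | hj⟩ := h.centralizer _ hg
  · rw [hj] at h1 h2 ⊢
    rw [(h.eq_one_or_eq_z_of_pow_sq h1).resolve_left h2]
  · rw [hj] at h3 ⊢
    obtain ⟨c, rfl⟩ := (h.reflection_mem_iff j).1 h3
    refine h.isConj.trans (isConj_iff.2 ⟨(r ^ c)⁻¹, ?_⟩)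
    rw [pow_succ, ← mul_assoc s (r ^ (2 * c)) r, h.reflection_eq_conj]
    group

theorem isConj_s_of_notMem (h : DihedralConfig N e r s z) {i : G} (hi : i * i = 1)
    (hiN : i ∉ N) : IsConj s i := by
  obtain ⟨g, hg⟩ := h.exists_conj_comm_z hi
  have hgi : IsConj (g * i * g⁻¹) i := (isConj_iff.2 ⟨g, rfl⟩ : IsConj i _).symm
  refine IsConj.trans ?_ hgi
  have h1 : g * i * g⁻¹ * (g * i * g⁻¹) = 1 := by
    calc g * i * g⁻¹ * (g * i * g⁻¹) = g * (i * i) * g⁻¹ := by group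
      _ = 1 := by rw [hi]; group
  have h3 : g * i * g⁻¹ ∉ N := fun h3 => hiN ((h.conj_mem_iff _ _).1 h3)
  obtain ⟨j, hj | hj⟩ := h.centralizer _ hg
  · rw [hj] at h1 h3
    rcases h.eq_one_or_eq_z_of_pow_sq h1 with h4 | h4
    · rw [h4] at h3
      exact absurd (one_mem N) h3
    · rw [h4] at h3
      exact absurd h.z_mem h3
  · rw [hj] at h3 ⊢
    rw [h.reflection_mem_iff, Nat.not_odd_iff_even] at h3
    obtain ⟨c, rfl⟩ := h3
    rw [← two_mul, h.reflection_eq_conj]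
    exact isConj_iff.2 ⟨(r ^ c)⁻¹, by rw [inv_inv]⟩

theorem eq_one_of_odd_of_comm_involution (h : DihedralConfig N e r s z) {v i : G}
    (hv : Odd (orderOf v)) (hi : i * i = 1) (hi1 : i ≠ 1) (hiN : i ∈ N)
    (hvi : v * i = i * v) : v = 1 := by
  obtain ⟨g, rfl⟩ := isConj_iff.1 (h.isConj_z_of_mem hi hi1 hiN)
  have h1 : g⁻¹ * v * g = 1 := by
    refine h.eq_one_of_odd_of_comm_z (by rwa [orderOf_conj_inv_mul]) ?_
    calc g⁻¹ * v * g * z = g⁻¹ * (v * (g * z * g⁻¹)) * g := by group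
      _ = _ := by rw [hvi]; group
  calc v = g * (g⁻¹ * v * g) * g⁻¹ := by group
    _ = 1 := by rw [h1]; group

end DihedralConfig

/-- A dihedral configuration together with the subgroup `U` of elements of odd order of the
centralizer of `s`. -/
structure DihedralCore {G : Type*} [Group G] (N : Subgroup G) (e : ℕ) (r s z : G)
    (U : Subgroup G) : Prop extends DihedralConfig N e r s z where
  odd : Odd (Nat.card U)
  inverts : ∀ v ∈ U, z * v * z⁻¹ = v⁻¹
  comm_s : ∀ v ∈ U, v * s = s * v
  cover : ∀ g ∈ N, g * s = s * g → g ∈ U ∨ z * g ∈ U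

theorem DihedralConfig.exists_core {G : Type*} [Group G] [Finite G] {N : Subgroup G} {e : ℕ}
    {r s z : G} (h : DihedralConfig N e r s z) : ∃ U, DihedralCore N e r s z U := by
  obtain ⟨U, hU, hodd, hinv, hcover⟩ := exists_odd_subgroup_of_centralizer_inf_eq_pair
    (B := Subgroup.centralizer {s} ⊓ N) (z := z)
    ⟨Subgroup.mem_centralizer_singleton_iff.2 h.s_comm_z.symm, h.z_mem⟩ h.z_mul_z h.z_ne_one (by
      rintro g ⟨hgs, hgN⟩ hgz
      have hgs : g * s = s * g := Subgroup.mem_centralizer_singleton_iff.1 hgs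
      obtain ⟨i, rfl | rfl⟩ := h.centralizer g hgz
      · apply h.eq_one_or_eq_z_of_pow_sq
        rw [h.s_mul_pow, mul_left_inj] at hgs
        nth_rw 1 [hgs]
        group
      · exfalso
        rw [mul_assoc, mul_right_inj, h.s_mul_pow, mul_left_inj] at hgs
        have h1 : r ^ i * r ^ i = 1 := by
          nth_rw 1 [hgs]
          group
        have h2 : r ^ i ∈ N := by
          rcases h.eq_one_or_eq_z_of_pow_sq h1 with h3 | h3
          · rw [h3]
            exact one_mem N
          · rw [h3]
            exact h.z_mem
        exact h.s_notMem ((h.mul_mem_iff _ _).1 hgN |>.2 h2))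
  refine ⟨U, { toDihedralConfig := h, odd := hodd, inverts := hinv, comm_s := ?_, cover := ?_ }⟩
  · exact fun v hv => Subgroup.mem_centralizer_singleton_iff.1 (hU hv).1
  · exact fun g hgN hgs => hcover g ⟨Subgroup.mem_centralizer_singleton_iff.2 hgs, hgN⟩

theorem DihedralConfig.reflection_ne_one {G : Type*} [Group G] {N : Subgroup G} {e : ℕ}
    {r s z : G} (h : DihedralConfig N e r s z) (i : ℕ) : s * r ^ i ≠ 1 := fun h1 =>
  h.reflection_ne_pow i 0 (by rw [h1, pow_zero])

theorem conj_mem_zpowers_iff {G : Type*} [Group G] (g a b : G) :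
    g * a * g⁻¹ ∈ Subgroup.zpowers (g * b * g⁻¹) ↔ a ∈ Subgroup.zpowers b := by
  simp only [Subgroup.mem_zpowers_iff, conj_zpow, mul_left_inj, mul_right_inj]

theorem ncard_eq_of_conj {G : Type*} [Group G] {A B : Set G} (g : G)
    (h : ∀ t, t ∈ A ↔ g * t * g⁻¹ ∈ B) : A.ncard = B.ncard := by
  rw [← Set.ncard_image_of_injective A (MulAut.conj g).injective]
  congr 1
  ext t
  constructor
  · rintro ⟨a, ha, rfl⟩
    exact (h a).1 ha
  · intro ht
    have h1 : g * (g⁻¹ * t * g) * g⁻¹ = t := by group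
    exact ⟨g⁻¹ * t * g, (h _).2 (by rwa [h1]), h1⟩

namespace DihedralCore

variable {G : Type*} [Group G] {N : Subgroup G} {e : ℕ} {r s z : G} {U : Subgroup G}

theorem z_mul_mul_z (h : DihedralCore N e r s z U) {v : G} (hv : v ∈ U) :
    z * v * (z * v) = 1 := by
  have := h.inverts v hv
  rw [h.z_inv] at this
  rw [← mul_assoc, this, inv_mul_cancel]

theorem odd_orderOf (h : DihedralCore N e r s z U) {v : G} (hv : v ∈ U) : Odd (orderOf v) :=
  odd_orderOf_of_mem_odd_card h.odd hv

theorem le (h : DihedralCore N e r s z U) : U ≤ N := fun _ hv => h.mem_of_odd (h.odd_orderOf hv)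

theorem z_notMem (h : DihedralCore N e r s z U) : z ∉ U := fun hz =>
  h.z_ne_one (eq_one_of_odd_of_sq (h.odd_orderOf hz) h.z_mul_z)

theorem mem_of_odd_of_comm (h : DihedralCore N e r s z U) {g : G} (hg : Odd (orderOf g))
    (hgs : g * s = s * g) : g ∈ U := by
  rcases h.cover g (h.mem_of_odd hg) hgs with h1 | h1
  · exact h1
  · have h2 := h.z_mul_mul_z h1
    rw [← mul_assoc z z g, h.z_mul_z, one_mul] at h2
    rw [eq_one_of_odd_of_sq hg h2]
    exact one_mem U

theorem commute (h : DihedralCore N e r s z U) {a b : G} (ha : a ∈ U) (hb : b ∈ U) :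
    a * b = b * a :=
  commute_of_inverts h.inverts a ha b hb

theorem conj_involution_iff (h : DihedralCore N e r s z U) (g t : G) :
    (g * t * g⁻¹ * (g * t * g⁻¹) = 1 ∧ g * t * g⁻¹ ∉ N) ↔ t * t = 1 ∧ t ∉ N := by
  rw [h.conj_mem_iff, show g * t * g⁻¹ * (g * t * g⁻¹) = g * (t * t) * g⁻¹ by group,
    conj_eq_one_iff]

theorem eq_reflection_of_notMem (h : DihedralCore N e r s z U) {t : G} (ht : t * t = 1)
    (htN : t ∉ N) (htz : t * z = z * t) : ∃ c < e, t = s * r ^ (2 * c) := by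
  obtain ⟨i, hi, rfl | rfl⟩ := (h.mem_centralizer_iff t).1 htz
  · exfalso
    rcases h.eq_one_or_eq_z_of_pow_sq ht with h1 | h1
    · exact htN (h1 ▸ one_mem N)
    · exact htN (h1 ▸ h.z_mem)
  · rw [h.reflection_mem_iff, Nat.not_odd_iff_even] at htN
    obtain ⟨c, rfl⟩ := htN
    exact ⟨c, by omega, by rw [two_mul]⟩

theorem eq_reflection_of_mem (h : DihedralCore N e r s z U) {t : G} (ht : t * t = 1)
    (ht1 : t ≠ 1) (htN : t ∈ N) (htz : t * z = z * t) (hne : t ≠ z) :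
    ∃ c, t = s * r ^ (2 * c + 1) := by
  obtain ⟨i, hi, rfl | rfl⟩ := (h.mem_centralizer_iff t).1 htz
  · exact absurd (h.eq_one_or_eq_z_of_pow_sq ht) (by tauto)
  · rw [h.reflection_mem_iff] at htN
    obtain ⟨c, rfl⟩ := htN
    exact ⟨c, rfl⟩

theorem z_mem_zpowers_mul_reflection (h : DihedralCore N e r s z U) (a b : ℕ) :
    z ∈ Subgroup.zpowers (s * r ^ (2 * b + 1) * (s * r ^ (2 * a))) := by
  refine ⟨e, ?_⟩
  have h1 : s * r ^ (2 * b + 1) * (s * r ^ (2 * a)) = (r ^ (2 * b + 1))⁻¹ * r ^ (2 * a) := by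
    nth_rw 1 [h.s_mul_pow]
    calc _ = (r ^ (2 * b + 1))⁻¹ * (s * s) * r ^ (2 * a) := by group
      _ = _ := by rw [h.s_mul_s, mul_one]
  have h2 : Commute (r ^ (2 * b + 1))⁻¹ (r ^ (2 * a)) :=
    (Commute.pow_pow_self r _ _).inv_left
  simp only [zpow_natCast]
  rw [h1, h2.mul_pow, inv_pow, ← pow_mul, ← pow_mul, mul_comm _ e, mul_comm _ e, pow_mul, pow_mul,
    ← h.z_eq, pow_succ, pow_mul, pow_mul, pow_two, h.z_mul_z, one_pow, one_pow, one_mul, mul_one,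
    h.z_inv]

theorem ncard_involutions_notMem_comm_z (h : DihedralCore N e r s z U) :
    {t : G | (t * t = 1 ∧ t ∉ N) ∧ t * z = z * t}.ncard = e := by
  classical
  have h1 : {t : G | (t * t = 1 ∧ t ∉ N) ∧ t * z = z * t} =
      ((Finset.range e).image (fun c => s * r ^ (2 * c)) : Finset G) := by
    ext t
    simp only [Finset.coe_image, Finset.coe_range, Set.mem_image, Set.mem_Iio]
    constructor
    · rintro ⟨⟨ht, htN⟩, htz⟩
      obtain ⟨c, hc, rfl⟩ := h.eq_reflection_of_notMem ht htN htz
      exact ⟨c, hc, rfl⟩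
    · rintro ⟨c, -, rfl⟩
      refine ⟨⟨h.reflection_sq _, ?_⟩, h.reflection_comm_z _⟩
      rw [h.reflection_mem_iff, Nat.not_odd_iff_even]
      exact even_two_mul c
  rw [h1, Set.ncard_coe_finset, Finset.card_image_of_injOn, Finset.card_range]
  intro a ha b hb hab
  rw [Finset.coe_range, Set.mem_Iio] at ha hb
  have := pow_injOn_Iio_orderOf (x := r) (by rw [h.orderOf_r, Set.mem_Iio]; omega)
    (by rw [h.orderOf_r, Set.mem_Iio]; omega) (mul_left_cancel hab)
  omega

variable [Finite G]

theorem ncard_centralizer_s (h : DihedralCore N e r s z U) :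
    {g : G | g * s = s * g}.ncard = 4 * Nat.card U := by
  set T : Set G := (U : Set G) ∪ (z * ·) '' (U : Set G) with hT
  have hTN : ∀ g ∈ T, g ∈ N := by
    rintro g (hg | ⟨g, hg, rfl⟩)
    · exact h.le hg
    · exact mul_mem h.z_mem (h.le hg)
  have hTs : ∀ g ∈ T, g * s = s * g := by
    rintro g (hg | ⟨g, hg, rfl⟩)
    · exact h.comm_s g hg
    · change z * g * s = s * (z * g)
      rw [mul_assoc, h.comm_s g hg, ← mul_assoc, ← mul_assoc, h.s_comm_z]
  have hcT : ∀ g ∈ N, g * s = s * g → g ∈ T := by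
    intro g hgN hgs
    rcases h.cover g hgN hgs with h1 | h1
    · exact Or.inl h1
    · exact Or.inr ⟨z * g, h1, by simp only; rw [← mul_assoc, h.z_mul_z, one_mul]⟩
  have hU : (U : Set G).ncard = Nat.card U := Nat.card_coe_set_eq _ |>.symm
  have h1 : T.ncard = 2 * Nat.card U := by
    rw [hT, Set.ncard_union_eq, Set.ncard_image_of_injective _ (mul_right_injective z), hU]
    · ring
    · rw [Set.disjoint_left]
      rintro _ hg ⟨g, hg', rfl⟩
      exact h.z_notMem ((Subgroup.mul_mem_cancel_right U hg').1 hg)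
  have h2 : {g : G | g * s = s * g} = T ∪ (s * ·) '' T := by
    ext g
    rw [Set.mem_ofPred_eq]
    constructor
    · intro hg
      by_cases hgN : g ∈ N
      · exact Or.inl (hcT g hgN hg)
      · refine Or.inr ⟨s * g, hcT _ ?_ ?_, ?_⟩
        · rw [h.mul_mem_iff]
          have := h.s_notMem
          tauto
        · rw [mul_assoc, hg]
        · simp only
          rw [← mul_assoc, h.s_mul_s, one_mul]
    · rintro (hg | ⟨g, hg, rfl⟩)
      · exact hTs g hg
      · change s * g * s = s * (s * g)
        rw [mul_assoc, hTs g hg]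
  rw [h2, Set.ncard_union_eq, Set.ncard_image_of_injective _ (mul_right_injective s), h1]
  · ring
  · rw [Set.disjoint_left]
    rintro _ hg ⟨g, hg', rfl⟩
    have := hTN _ hg
    rw [h.mul_mem_iff] at this
    exact h.s_notMem (this.2 (hTN g hg'))

theorem ncard_involutions_notMem_mul (h : DihedralCore N e r s z U) :
    {i : G | i * i = 1 ∧ i ∉ N}.ncard * (4 * Nat.card U) = Nat.card G := by
  have h1 := ncard_conj_mul (X := {s}) (M := {g : G | g * s = s * g}) (by
    rintro x rfl g
    rw [Set.mem_singleton_iff, mul_inv_eq_iff_eq_mul]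
    rfl)
  rw [h.ncard_centralizer_s, Set.ncard_singleton, mul_one] at h1
  convert h1 using 3
  ext i
  constructor
  · rintro ⟨h2, h3⟩
    obtain ⟨g, hg⟩ := isConj_iff.1 (h.isConj_s_of_notMem h2 h3)
    exact ⟨g, s, rfl, hg⟩
  · rintro ⟨g, x, rfl, rfl⟩
    refine ⟨?_, fun h2 => h.s_notMem ((h.conj_mem_iff _ _).1 h2)⟩
    calc g * x * g⁻¹ * (g * x * g⁻¹) = g * (x * x) * g⁻¹ := by group
      _ = 1 := by rw [h.s_mul_s]; group

theorem exists_reflection_mem_zpowers (h : DihedralCore N e r s z U) {t : G} (ht : t * t = 1)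
    (htN : t ∉ N) :
    ∃ i < 2 * e, s * r ^ i ∈ Subgroup.zpowers (z * t) := by
  have htt : t⁻¹ = t := inv_eq_of_mul_eq_one_left ht
  have hztN : z * t ∉ N := by
    rw [h.mul_mem_iff]
    have := h.z_mem
    tauto
  obtain ⟨w, hw, hw2, hw1⟩ := exists_involution_mem_zpowers
    (w := z * t) fun h1 => hztN (h.mem_of_odd h1)
  have hwz : w * z = z * w := by
    obtain ⟨m, rfl⟩ := hw
    have h1 : z * (z * t) ^ m * z⁻¹ = (z * t) ^ m := by
      rw [← conj_zpow, ← mul_assoc z z, h.z_mul_z, one_mul]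
      have h2 : t * z⁻¹ = (z * t)⁻¹ := by rw [_root_.mul_inv_rev, htt]
      rw [h2, inv_zpow, inv_eq_of_mul_eq_one_left hw2]
    exact (mul_inv_eq_iff_eq_mul.1 h1).symm
  have hwne : w ≠ z := by
    rintro rfl
    have h1 : Commute w (w * t) := by
      obtain ⟨m, hm⟩ := hw
      have := (Commute.refl (w * t)).zpow_left m
      simp only at hm
      rwa [hm] at this
    have h2 : w * t = t * w := by
      have := h1.eq
      rw [mul_assoc w t w] at this
      exact mul_left_cancel this
    have h3 : w * t * (w * t) = 1 := by
      nth_rw 2 [h2]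
      rw [mul_assoc, ← mul_assoc t t, ht, one_mul, h.z_mul_z]
    refine hztN ?_
    rw [involution_unique_of_mem_zpowers (Subgroup.mem_zpowers (w * t)) hw h3 hw2 ?_ hw1]
    · exact h.z_mem
    · intro h4
      rw [h4] at hztN
      exact hztN (one_mem N)
  obtain ⟨i, hi, rfl | rfl⟩ := (h.mem_centralizer_iff w).1 hwz
  · rcases h.eq_one_or_eq_z_of_pow_sq hw2 with h1 | h1
    · exact absurd h1 hw1
    · exact absurd h1 hwne
  · exact ⟨i, hi, hw⟩

theorem ncard_fiber_zero (h : DihedralCore N e r s z U) :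
    {t : G | (t * t = 1 ∧ t ∉ N) ∧ s ∈ Subgroup.zpowers (z * t)}.ncard = Nat.card U := by
  have hU : (U : Set G).ncard = Nat.card U := Nat.card_coe_set_eq _ |>.symm
  rw [← hU, ← Set.ncard_image_of_injective (U : Set G) (mul_right_injective (z * s))]
  congr 1
  ext t
  constructor
  · rintro ⟨⟨ht, htN⟩, hs⟩
    have hztN : z * t ∉ N := by
      rw [h.mul_mem_iff]
      have := h.z_mem
      tauto
    have hst : s * t = t * s := by
      have h1 : s * (z * t) = z * t * s := by
        obtain ⟨m, hm⟩ := hs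
        have := (Commute.refl (z * t)).zpow_left m
        simp only at hm
        rw [hm] at this
        exact this.eq
      rw [← mul_assoc, h.s_comm_z, mul_assoc, mul_assoc] at h1
      exact mul_left_cancel h1
    have hN : z * t * s ∈ N := by
      rw [h.mul_mem_iff]
      have := h.s_notMem
      tauto
    have hcomm : z * t * s * s = s * (z * t * s) := by
      simp only [← mul_assoc, h.s_comm_z]
      rw [mul_assoc z s t, hst, ← mul_assoc]
    rcases h.cover _ hN hcomm with h1 | h1
    · refine ⟨_, h1, ?_⟩
      change z * s * (z * t * s) = t
      calc z * s * (z * t * s) = z * (s * (z * t * s)) := by group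
        _ = z * z * t * (s * s) := by rw [← hcomm]; group
        _ = t := by rw [h.z_mul_z, h.s_mul_s]; group
    · exfalso
      have h2 : z * (z * t * s) = t * s := by
        rw [← mul_assoc, ← mul_assoc, h.z_mul_z, one_mul]
      rw [h2] at h1
      have h3 := h.z_mul_mul_z h1
      have h4 : z * t * (z * t) = 1 := by
        calc z * t * (z * t) = z * t * (s * s) * (z * t) := by rw [h.s_mul_s, mul_one]
          _ = z * (t * s) * (s * z) * t := by group
          _ = z * (t * s) * z * (s * t) := by rw [h.s_comm_z]; group
          _ = 1 := by rw [hst, ← h3]; group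
      have h5 := involution_unique_of_mem_zpowers hs (Subgroup.mem_zpowers _) h.s_mul_s h4
        h.s_ne_one (fun h5 => hztN (h5 ▸ one_mem N))
      apply h.z_notMem
      convert h1 using 1
      calc z = z * t * t := by rw [mul_assoc, ht, mul_one]
        _ = s * t := by rw [← h5]
        _ = t * s := hst
  · rintro ⟨v, hv, rfl⟩
    have hvs := h.comm_s v hv
    refine ⟨⟨?_, ?_⟩, ?_⟩
    · change z * s * v * (z * s * v) = 1
      calc z * s * v * (z * s * v) = z * (s * v) * (z * s) * v := by group
        _ = z * v * (s * s) * (z * v) := by rw [← hvs, ← h.s_comm_z]; group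
        _ = 1 := by rw [h.s_mul_s, mul_one, h.z_mul_mul_z hv]
    · change z * s * v ∉ N
      rw [h.mul_mem_iff, h.mul_mem_iff]
      have := h.s_notMem
      have := h.z_mem
      have := h.le hv
      tauto
    · have h1 : z * (z * s * v) = s * v := by
        rw [← mul_assoc, ← mul_assoc, h.z_mul_z, one_mul]
      change s ∈ Subgroup.zpowers (z * (z * s * v))
      rw [h1]
      have h2 : (s * v) ^ orderOf v = s := by
        rw [Commute.mul_pow hvs.symm, pow_orderOf_eq_one, mul_one]
        obtain ⟨m, hm⟩ := h.odd_orderOf hv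
        rw [hm, pow_succ, pow_mul, pow_two, h.s_mul_s, one_pow, one_mul]
      exact ⟨orderOf v, by simpa using h2⟩

theorem ncard_fiber_even (h : DihedralCore N e r s z U) (j : ℕ) :
    {t : G | (t * t = 1 ∧ t ∉ N) ∧ s * r ^ (2 * j) ∈ Subgroup.zpowers (z * t)}.ncard =
      Nat.card U := by
  rw [← h.ncard_fiber_zero]
  refine ncard_eq_of_conj (r ^ j) fun t => ?_
  rw [Set.mem_ofPred_eq, Set.mem_ofPred_eq, h.conj_involution_iff]
  refine and_congr_right fun _ => ?_
  rw [h.reflection_eq_conj, ← conj_mem_zpowers_iff (r ^ j)]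
  have h1 : r ^ j * (z * t) * (r ^ j)⁻¹ = z * (r ^ j * t * (r ^ j)⁻¹) := by
    rw [← mul_assoc, h.pow_comm_z]
    group
  have h2 : r ^ j * ((r ^ j)⁻¹ * s * r ^ j) * (r ^ j)⁻¹ = s := by group
  rw [h1, h2]

theorem ncard_fiber_odd (h : DihedralCore N e r s z U) (j : ℕ) :
    {t : G | (t * t = 1 ∧ t ∉ N) ∧ s * r ^ (2 * j + 1) ∈ Subgroup.zpowers (z * t)}.ncard =
      e := by
  set w := s * r ^ (2 * j + 1) with hw
  have hwz : w * z = z * w := h.reflection_comm_z _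
  have hwN : w ∈ N := (h.reflection_mem_iff _).2 (odd_two_mul_add_one j)
  obtain ⟨g, hg⟩ := isConj_iff.1 (h.isConj_z_of_mem (h.reflection_sq _)
    (h.reflection_ne_one _) hwN)
  rw [← hw] at hg
  rw [← h.ncard_involutions_notMem_comm_z]
  refine ncard_eq_of_conj g⁻¹ fun t => ?_
  rw [Set.mem_ofPred_eq, Set.mem_ofPred_eq, h.conj_involution_iff]
  refine and_congr_right fun ⟨ht, htN⟩ => ?_
  have hgw : g⁻¹ * w * g⁻¹⁻¹ = z := by rw [← hg]; group
  rw [← conj_mem_zpowers_iff g⁻¹, hgw]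
  have h1 : g⁻¹ * (z * t) * g⁻¹⁻¹ = (g⁻¹ * z * g⁻¹⁻¹) * (g⁻¹ * t * g⁻¹⁻¹) := by group
  have hz' : (g⁻¹ * z * g⁻¹⁻¹) * z = z * (g⁻¹ * z * g⁻¹⁻¹) := by
    calc (g⁻¹ * z * g⁻¹⁻¹) * z = (g⁻¹ * z * g⁻¹⁻¹) * (g⁻¹ * w * g⁻¹⁻¹) := by rw [hgw]
      _ = g⁻¹ * (z * w) * g⁻¹⁻¹ := by group
      _ = g⁻¹ * (w * z) * g⁻¹⁻¹ := by rw [hwz]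
      _ = (g⁻¹ * w * g⁻¹⁻¹) * (g⁻¹ * z * g⁻¹⁻¹) := by group
      _ = z * (g⁻¹ * z * g⁻¹⁻¹) := by rw [hgw]
  rw [h1]
  have hz'sq : (g⁻¹ * z * g⁻¹⁻¹) * (g⁻¹ * z * g⁻¹⁻¹) = 1 := by
    calc _ = g⁻¹ * (z * z) * g⁻¹⁻¹ := by group
      _ = 1 := by rw [h.z_mul_z]; group
  have hz'1 : g⁻¹ * z * g⁻¹⁻¹ ≠ 1 := by
    rw [Ne, conj_eq_one_iff]
    exact h.z_ne_one
  have hz'N : g⁻¹ * z * g⁻¹⁻¹ ∈ N := (h.conj_mem_iff _ _).2 h.z_mem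
  have hz'ne : g⁻¹ * z * g⁻¹⁻¹ ≠ z := by
    intro h2
    nth_rw 2 [← hgw] at h2
    exact h.reflection_ne_z _ (mul_left_cancel (mul_right_cancel h2)).symm
  have ht' := (h.conj_involution_iff g⁻¹ t).2 ⟨ht, htN⟩
  generalize g⁻¹ * t * g⁻¹⁻¹ = t' at *
  generalize g⁻¹ * z * g⁻¹⁻¹ = z' at *
  constructor
  · rintro ⟨m, hm⟩
    have h2 := (Commute.refl (z' * t')).zpow_left m
    simp only at hm
    rw [hm] at h2
    have h3 := h2.eq
    rw [← mul_assoc, ← hz', mul_assoc, mul_assoc] at h3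
    exact (mul_left_cancel h3).symm
  · intro ht'z
    obtain ⟨a, -, rfl⟩ := h.eq_reflection_of_notMem ht'.1 ht'.2 ht'z
    obtain ⟨b, rfl⟩ := h.eq_reflection_of_mem hz'sq hz'1 hz'N hz' hz'ne
    exact h.z_mem_zpowers_mul_reflection a b

theorem card_eq (h : DihedralCore N e r s z U) :
    Nat.card G = 4 * e * Nat.card U * (e + Nat.card U) := by
  classical
  have := Fintype.ofFinite G
  set S : Set G := {i : G | i * i = 1 ∧ i ∉ N} with hS
  have hcount := Finset.sum_card_bipartiteAbove_eq_sum_card_bipartiteBelow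
    (s := S.toFinset) (t := Finset.range (2 * e))
    (r := fun t i => s * r ^ i ∈ Subgroup.zpowers (z * t))
  have h1 : ∀ t ∈ S.toFinset, ((Finset.range (2 * e)).bipartiteAbove
      (fun t i => s * r ^ i ∈ Subgroup.zpowers (z * t)) t).card = 1 := by
    intro t ht
    rw [Set.mem_toFinset] at ht
    obtain ⟨i, hi, hit⟩ := h.exists_reflection_mem_zpowers ht.1 ht.2
    rw [Finset.card_eq_one]
    refine ⟨i, ?_⟩
    ext j
    rw [Finset.mem_bipartiteAbove, Finset.mem_range, Finset.mem_singleton]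
    constructor
    · rintro ⟨hj, hjt⟩
      have h2 := involution_unique_of_mem_zpowers hit hjt (h.reflection_sq i)
        (h.reflection_sq j) (h.reflection_ne_one i)
        (h.reflection_ne_one j)
      refine (pow_injOn_Iio_orderOf ?_ ?_ (mul_left_cancel h2)).symm
      · rw [h.orderOf_r]; exact hi
      · rw [h.orderOf_r]; exact hj
    · rintro rfl
      exact ⟨hi, hit⟩
  have h2 : ∀ i ∈ Finset.range (2 * e), (S.toFinset.bipartiteBelow
      (fun t i => s * r ^ i ∈ Subgroup.zpowers (z * t)) i).card =
        if Even i then Nat.card U else e := by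
    intro i _
    have h3 : (S.toFinset.bipartiteBelow (fun t i => s * r ^ i ∈ Subgroup.zpowers (z * t)) i).card
        = {t : G | (t * t = 1 ∧ t ∉ N) ∧ s * r ^ i ∈ Subgroup.zpowers (z * t)}.ncard := by
      rw [Set.ncard_eq_toFinset_card']
      congr 1
      ext t
      rw [Finset.mem_bipartiteBelow, Set.mem_toFinset, Set.mem_toFinset]
      rfl
    rw [h3]
    rcases Nat.even_or_odd' i with ⟨j, rfl | rfl⟩
    · rw [h.ncard_fiber_even, if_pos (even_two_mul j)]
    · rw [h.ncard_fiber_odd, if_neg (Nat.not_even_iff_odd.2 (odd_two_mul_add_one j))]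
  have h3 : ∀ n a b : ℕ, ∑ i ∈ Finset.range (2 * n), (if Even i then a else b) =
      n * (b + a) := by
    intro n a b
    induction n with
    | zero => simp
    | succ n ih =>
      rw [mul_add, Finset.sum_range_succ, Finset.sum_range_succ, ih, if_pos (even_two_mul n),
        if_neg (Nat.not_even_iff_odd.2 (odd_two_mul_add_one n))]
      ring
  rw [Finset.sum_congr rfl h1, Finset.sum_congr rfl h2, h3, Finset.sum_const, smul_eq_mul,
    mul_one, ← Set.ncard_eq_toFinset_card'] at hcount
  rw [← h.ncard_involutions_notMem_mul, ← hS, hcount]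
  ring

end DihedralCore

namespace DihedralCore

variable {G : Type*} [Group G] {N : Subgroup G} {e : ℕ} {r s z : G} {U : Subgroup G}

theorem eq_one_of_dvd (h : DihedralCore N e r s z U) {n : ℕ} (hn : Odd n)
    (hn1 : n ∣ 4 * e * (e + Nat.card U)) (hn2 : n ∣ Nat.card U) : n = 1 := by
  have h1 := h.coprime_of_odd hn
  have h2 := (Nat.dvd_add_left hn2).1 (h1.dvd_of_dvd_mul_left hn1)
  exact Nat.Coprime.eq_one_of_dvd h1 (h2.mul_left 4)

theorem card_dvd_of_comm_s_mul_z (h : DihedralCore N e r s z U) {V : Subgroup G}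
    (hV : ∀ w ∈ V, Odd (orderOf w)) (hVs : ∀ w ∈ V, w * (s * z) = s * z * w) :
    Nat.card V ∣ Nat.card U := by
  obtain ⟨f, hf, -⟩ := h.exists_half
  have h1 : s * z = (r ^ f)⁻¹ * s * r ^ f := by
    rw [h.z_eq, hf, h.reflection_eq_conj]
  have h2 : V.map (MulAut.conj (r ^ f)).toMonoidHom ≤ U := by
    rintro _ ⟨w, hw, rfl⟩
    change r ^ f * w * (r ^ f)⁻¹ ∈ U
    refine h.mem_of_odd_of_comm (by rw [orderOf_conj_mul_inv]; exact hV w hw) ?_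
    have h3 := hVs w hw
    rw [h1] at h3
    calc r ^ f * w * (r ^ f)⁻¹ * s = r ^ f * (w * ((r ^ f)⁻¹ * s * r ^ f)) * (r ^ f)⁻¹ := by group
      _ = s * (r ^ f * w * (r ^ f)⁻¹) := by rw [h3]; group
  rw [← Subgroup.card_map_of_injective (f := (MulAut.conj (r ^ f)).toMonoidHom) (K := V)
    (MulAut.conj (r ^ f)).injective]
  exact Subgroup.card_dvd_of_le h2

variable [Finite G]

theorem comm_s_of_comm (h : DihedralCore N e r s z U) {v : G} (hv : v ∈ U) (hv1 : v ≠ 1) {w : G}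
    (hw : w ∈ N) (hvw : w * v = v * w) : w * s = s * w := by
  have hvodd := h.odd_orderOf hv
  set W : Subgroup G := Subgroup.centralizer {v} ⊓ N with hW
  have mem_W : ∀ {w}, w ∈ W ↔ w * v = v * w ∧ w ∈ N := by
    intro w
    rw [hW, Subgroup.mem_inf, Subgroup.mem_centralizer_singleton_iff]
  have hWodd : ∀ w ∈ W, Odd (orderOf w) := by
    intro w hw
    by_contra hodd
    obtain ⟨i, hi, hi2, hi1⟩ := exists_involution_mem_zpowers hodd
    have hiW := mem_W.1 ((Subgroup.zpowers_le.2 hw) hi)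
    exact hv1 (h.eq_one_of_odd_of_comm_involution hvodd hi2 hi1 hiW.2 hiW.1.symm)
  have hUW : U ≤ W := fun u hu => mem_W.2 ⟨h.commute hu hv, h.le hu⟩
  have hWz : ∀ w ∈ W, z * w * z⁻¹ ∈ W := by
    intro w hw
    have h1 := mem_W.1 hw
    have h2 : Commute w v := h1.1
    refine mem_W.2 ⟨?_, (h.conj_mem_iff _ _).2 h1.2⟩
    have h3 : v = z * v⁻¹ * z⁻¹ := by rw [← conj_inv, h.inverts v hv, inv_inv]
    have h4 : z * w * z⁻¹ * (z * v⁻¹ * z⁻¹) = z * v⁻¹ * z⁻¹ * (z * w * z⁻¹) := by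
      calc _ = z * (w * v⁻¹) * z⁻¹ := by group
        _ = _ := by rw [h2.inv_right.eq]; group
    rwa [← h3] at h4
  have hWs : ∀ w ∈ W, s * w * s⁻¹ ∈ W := by
    intro w hw
    have h1 := mem_W.1 hw
    refine mem_W.2 ⟨?_, (h.conj_mem_iff _ _).2 h1.2⟩
    have h3 : s * v * s⁻¹ = v := by rw [← h.comm_s v hv, mul_inv_cancel_right]
    calc s * w * s⁻¹ * v = s * w * s⁻¹ * (s * v * s⁻¹) := by rw [h3]
      _ = s * (w * v) * s⁻¹ := by group
      _ = s * v * s⁻¹ * (s * w * s⁻¹) := by rw [h1.1]; group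
      _ = _ := by rw [h3]
  have hinv := inverts_of_no_fixed_points h.z_mul_z hWz fun w hw hwz =>
    h.eq_one_of_odd_of_comm_z (hWodd w hw) hwz.symm
  have hcomm := commute_of_inverts hinv
  have hdvd := h.card_dvd_of_comm_s_mul_z (V := W ⊓ Subgroup.centralizer {s * z})
    (fun w hw => hWodd w hw.1) fun w hw => Subgroup.mem_centralizer_singleton_iff.1 hw.2
  set V := W ⊓ Subgroup.centralizer {s * z} with hV
  have hdisj : Disjoint U V := by
    rw [Subgroup.disjoint_def]
    intro w hwU hwV
    refine h.eq_one_of_odd_of_comm_z (h.odd_orderOf hwU) ?_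
    have h1 := Subgroup.mem_centralizer_singleton_iff.1 hwV.2
    rw [← mul_assoc, h.comm_s w hwU, mul_assoc, mul_assoc] at h1
    exact mul_left_cancel h1
  have hdvd2 : Nat.card U * Nat.card V ∣ Nat.card G := by
    rw [← Nat.card_prod]
    have hVW : V ≤ W := inf_le_left
    refine Subgroup.card_dvd_of_injective (MonoidHom.noncommCoprod U.subtype V.subtype
      fun a b => hcomm _ (hUW a.2) _ (hVW b.2)) ((MonoidHom.noncommCoprod_injective _ _ _).2
        ⟨U.subtype_injective, V.subtype_injective, ?_⟩)
    rwa [Subgroup.range_subtype, Subgroup.range_subtype]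
  have hV1 : Nat.card V = 1 := by
    refine h.eq_one_of_dvd (odd_card_of_forall_odd_orderOf fun w hw => hWodd w hw.1) ?_ hdvd
    rw [h.card_eq, show 4 * e * Nat.card U * (e + Nat.card U) =
      Nat.card U * (4 * e * (e + Nat.card U)) by ring] at hdvd2
    exact Nat.dvd_of_mul_dvd_mul_left Nat.card_pos hdvd2
  have hwW : w ∈ W := mem_W.2 ⟨hvw, hw⟩
  have hd : w * (s * w * s⁻¹)⁻¹ ∈ V := by
    have hdW := mul_mem hwW (inv_mem (hWs w hwW))
    refine ⟨hdW, Subgroup.mem_centralizer_singleton_iff.2 ?_⟩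
    have h1 := hinv _ hdW
    have h2 : s * (w * (s * w * s⁻¹)⁻¹) * s⁻¹ = (w * (s * w * s⁻¹)⁻¹)⁻¹ := by
      calc s * (w * (s * w * s⁻¹)⁻¹) * s⁻¹ = s * w * s⁻¹ * ((s * s) * w * (s * s)⁻¹)⁻¹ := by group
        _ = _ := by rw [h.s_mul_s]; group
    generalize w * (s * w * s⁻¹)⁻¹ = d at *
    calc d * (s * z) = s * (s⁻¹ * d * s) * z := by group
      _ = s * (s * d * s⁻¹) * z := by rw [h.s_inv]
      _ = s * (z * d * z⁻¹) * z := by rw [h1, h2]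
      _ = s * z * d := by group
  rw [Subgroup.card_eq_one.1 hV1, Subgroup.mem_bot, mul_inv_eq_one] at hd
  exact mul_inv_eq_iff_eq_mul.1 hd.symm |>.symm

theorem mem_of_comm (h : DihedralCore N e r s z U) {v : G} (hv : v ∈ U) (hv1 : v ≠ 1) {w : G}
    (hw : w ∈ N) (hvw : w * v = v * w) : w ∈ U := by
  rcases h.cover w hw (h.comm_s_of_comm hv hv1 hw hvw) with h1 | h1
  · exact h1
  · refine absurd (h.eq_one_of_odd_of_comm_z (h.odd_orderOf hv) ?_) hv1
    have h2 := h.commute h1 hv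
    rw [mul_assoc, hvw, ← mul_assoc, ← mul_assoc] at h2
    exact (mul_right_cancel h2).symm

theorem mem_or_s_mul_mem_of_comm (h : DihedralCore N e r s z U) {v : G} (hv : v ∈ U)
    (hv1 : v ≠ 1) {g : G} (hvg : g * v = v * g) : g ∈ U ∨ s * g ∈ U := by
  by_cases hg : g ∈ N
  · exact Or.inl (h.mem_of_comm hv hv1 hg hvg)
  · refine Or.inr (h.mem_of_comm hv hv1 ?_ ?_)
    · rw [h.mul_mem_iff]
      have := h.s_notMem
      tauto
    · rw [mul_assoc, hvg, ← mul_assoc, ← mul_assoc, h.comm_s v hv]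

/-- The subgroup `U` is a trivial intersection set, with normalizer the centralizer of `s`. -/
theorem conj_mem_iff_comm_s (h : DihedralCore N e r s z U) {v : G} (hv : v ∈ U) (hv1 : v ≠ 1)
    (g : G) : g * v * g⁻¹ ∈ U ↔ g * s = s * g := by
  constructor
  · intro hg
    have h1 : g⁻¹ * s * g * v = v * (g⁻¹ * s * g) := by
      calc g⁻¹ * s * g * v = g⁻¹ * (s * (g * v * g⁻¹)) * g := by group
        _ = _ := by rw [← h.comm_s _ hg]; group
    have h2 : g⁻¹ * s * g ∉ N := by
      have := h.conj_mem_iff s g⁻¹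
      rw [inv_inv] at this
      rw [this]
      exact h.s_notMem
    have h3 := (h.mem_or_s_mul_mem_of_comm hv hv1 h1).resolve_left fun h3 => h2 (h.le h3)
    have h4 : g⁻¹ * s * g * (g⁻¹ * s * g) = 1 := by
      calc _ = g⁻¹ * (s * s) * g := by group
        _ = 1 := by rw [h.s_mul_s]; group
    have h5 := h.comm_s _ h3
    have h6 : s * (g⁻¹ * s * g) = 1 := by
      refine eq_one_of_odd_of_sq (h.odd_orderOf h3) ?_
      generalize g⁻¹ * s * g = t at *
      calc s * t * (s * t) = s * t * s * t := by group
        _ = s * (s * t) * t := by rw [h5]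
        _ = (s * s) * (t * t) := by group
        _ = 1 := by rw [h.s_mul_s, h4, one_mul]
    have h7 : g⁻¹ * s * g = s := by
      rw [← inv_eq_of_mul_eq_one_right h6, h.s_inv]
    calc g * s = g * (g⁻¹ * s * g) := by rw [h7]
      _ = s * g := by group
  · intro hg
    refine h.mem_of_odd_of_comm (by rw [orderOf_conj_mul_inv]; exact h.odd_orderOf hv) ?_
    have h1 : s * g⁻¹ = g⁻¹ * s := by
      rw [eq_inv_mul_iff_mul_eq, ← mul_assoc, hg, mul_inv_cancel_right]
    rw [mul_assoc, ← h1, ← mul_assoc, mul_assoc g, h.comm_s v hv, ← mul_assoc, hg]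
    group

end DihedralCore

/-- The elements of `N` which are conjugate neither into `U` nor into the subgroup generated by
`r ^ 2`. -/
def residualSet {G : Type*} [Group G] (N : Subgroup G) (r : G) (U : Subgroup G) : Set G :=
  {y | y ∈ N ∧ (∀ g, g * y * g⁻¹ ∉ U) ∧ ∀ g, g * y * g⁻¹ ∉ Subgroup.zpowers (r ^ 2)}

theorem ncard_isConj_mul_card_centralizer {G : Type*} [Group G] [Finite G] (y : G) :
    {y' | IsConj y y'}.ncard * Nat.card (Subgroup.centralizer {y}) = Nat.card G := by
  have h1 := ncard_conj_mul (X := {y}) (M := (Subgroup.centralizer {y} : Set G)) (by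
    rintro x rfl g
    rw [Set.mem_singleton_iff, mul_inv_eq_iff_eq_mul, SetLike.mem_coe,
      Subgroup.mem_centralizer_singleton_iff])
  rw [Set.ncard_singleton, mul_one, ← Nat.card_coe_set_eq (Subgroup.centralizer {y} : Set G),
    SetLike.coe_sort_coe] at h1
  rw [← h1]
  congr 2
  ext y'
  rw [Set.mem_ofPred_eq, isConj_iff]
  simp

namespace DihedralCore

variable {G : Type*} [Group G] {N : Subgroup G} {e : ℕ} {r s z : G} {U : Subgroup G}

theorem z_mem_zpowers_sq (h : DihedralCore N e r s z U) : z ∈ Subgroup.zpowers (r ^ 2) := by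
  obtain ⟨f, hf, -⟩ := h.exists_half
  rw [h.z_eq, hf, pow_mul]
  exact Subgroup.npow_mem_zpowers _ _

theorem zpowers_sq_le (h : DihedralCore N e r s z U) : Subgroup.zpowers (r ^ 2) ≤ N := by
  rw [Subgroup.zpowers_le, h.pow_mem_iff]
  exact even_two

theorem comm_z_of_mem_zpowers (h : DihedralCore N e r s z U) {x : G}
    (hx : x ∈ Subgroup.zpowers (r ^ 2)) : x * z = z * x := by
  obtain ⟨i, rfl⟩ := hx
  exact (show Commute (r ^ 2) z from h.pow_comm_z 2).zpow_left i

theorem not_odd_of_mem_zpowers (h : DihedralCore N e r s z U) {x : G}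
    (hx : x ∈ Subgroup.zpowers (r ^ 2)) (hx1 : x ≠ 1) : ¬ Odd (orderOf x) := fun hodd =>
  hx1 (h.eq_one_of_odd_of_comm_z hodd (h.comm_z_of_mem_zpowers hx))

theorem conj_mem_residualSet (h : DihedralCore N e r s z U) {y : G} (hy : y ∈ residualSet N r U)
    (g : G) : g * y * g⁻¹ ∈ residualSet N r U := by
  have h1 : ∀ k, k * (g * y * g⁻¹) * k⁻¹ = (k * g) * y * (k * g)⁻¹ := fun k => by group
  refine ⟨(h.conj_mem_iff _ _).2 hy.1, fun k => ?_, fun k => ?_⟩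
  · rw [h1]
    exact hy.2.1 _
  · rw [h1]
    exact hy.2.2 _

theorem ne_one_of_mem_residualSet {y : G} (hy : y ∈ residualSet N r U) : y ≠ 1 := by
  rintro rfl
  exact hy.2.1 1 (by simp)

variable [Finite G]

theorem z_mem_zpowers_of_mem (h : DihedralCore N e r s z U) {x : G}
    (hx : x ∈ Subgroup.zpowers (r ^ 2)) (hx1 : x ≠ 1) : z ∈ Subgroup.zpowers x := by
  obtain ⟨i, hi, hi2, hi1⟩ := exists_involution_mem_zpowers (h.not_odd_of_mem_zpowers hx hx1)
  rw [← involution_unique_of_mem_zpowers (Subgroup.zpowers_le.2 hx hi) h.z_mem_zpowers_sq hi2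
    h.z_mul_z hi1 h.z_ne_one]
  exact hi

theorem conj_mem_zpowers_sq_iff (h : DihedralCore N e r s z U) {x : G}
    (hx : x ∈ Subgroup.zpowers (r ^ 2)) (hx1 : x ≠ 1) (g : G) :
    g * x * g⁻¹ ∈ Subgroup.zpowers (r ^ 2) ↔ g * z = z * g := by
  constructor
  · intro hg
    have h1 : g * z * g⁻¹ ∈ Subgroup.zpowers (r ^ 2) :=
      Subgroup.zpowers_le.2 hg ((conj_mem_zpowers_iff g z x).2 (h.z_mem_zpowers_of_mem hx hx1))
    refine mul_inv_eq_iff_eq_mul.1 (involution_unique_of_mem_zpowers h1 h.z_mem_zpowers_sq ?_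
      h.z_mul_z (by simpa using h.z_ne_one) h.z_ne_one)
    calc g * z * g⁻¹ * (g * z * g⁻¹) = g * (z * z) * g⁻¹ := by group
      _ = 1 := by rw [h.z_mul_z]; group
  · intro hg
    have h1 : g * r ^ 2 * g⁻¹ ∈ Subgroup.zpowers (r ^ 2) := by
      obtain ⟨i, rfl | rfl⟩ := h.centralizer g hg
      · rw [← pow_add, add_comm, pow_add, mul_inv_cancel_right]
        exact Subgroup.mem_zpowers _
      · have h2 : s * r ^ i * r ^ 2 * (s * r ^ i)⁻¹ = s * r ^ 2 * s⁻¹ := by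
          rw [mul_assoc s, ← pow_add, add_comm, pow_add]
          group
        rw [h2, h.s_conj_pow]
        exact inv_mem (Subgroup.mem_zpowers _)
    obtain ⟨i, rfl⟩ := hx
    simp only
    rw [← conj_zpow]
    exact zpow_mem h1 i

theorem ncard_conj_U (h : DihedralCore N e r s z U) :
    {y | ∃ g, ∃ x ∈ (U : Set G) \ {1}, g * x * g⁻¹ = y}.ncard =
      e * (e + Nat.card U) * (Nat.card U - 1) := by
  have h1 := ncard_conj_mul (X := (U : Set G) \ {1}) (M := {g : G | g * s = s * g}) (by
    rintro x ⟨hx, hx1⟩ g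
    rw [Set.mem_ofPred_eq, ← h.conj_mem_iff_comm_s hx hx1 g]
    refine and_iff_left ?_
    rw [Set.mem_singleton_iff, conj_eq_one_iff]
    exact hx1)
  rw [Set.ncard_sdiff_singleton_of_mem (one_mem U), ← Nat.card_coe_set_eq (U : Set G),
    SetLike.coe_sort_coe, h.ncard_centralizer_s, h.card_eq] at h1
  refine Nat.eq_of_mul_eq_mul_right (m := 4 * Nat.card U) (by have := Nat.card_pos (α := U); omega)
    (h1.trans ?_)
  ring

theorem ncard_conj_zpowers (h : DihedralCore N e r s z U) :
    {y | ∃ g, ∃ x ∈ (Subgroup.zpowers (r ^ 2) : Set G) \ {1}, g * x * g⁻¹ = y}.ncard =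
      Nat.card U * (e + Nat.card U) * (e - 1) := by
  have h1 := ncard_conj_mul (X := (Subgroup.zpowers (r ^ 2) : Set G) \ {1})
    (M := {g : G | g * z = z * g}) (by
    rintro x ⟨hx, hx1⟩ g
    rw [Set.mem_ofPred_eq, ← h.conj_mem_zpowers_sq_iff hx hx1 g]
    refine and_iff_left ?_
    rw [Set.mem_singleton_iff, conj_eq_one_iff]
    exact hx1)
  have h2 : orderOf (r ^ 2) = e := by
    rw [orderOf_pow_of_dvd two_ne_zero, h.orderOf_r, Nat.mul_div_cancel_left _ two_pos]
    rw [h.orderOf_r]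
    exact dvd_mul_right _ _
  rw [Set.ncard_sdiff_singleton_of_mem (one_mem _),
    ← Nat.card_coe_set_eq (Subgroup.zpowers (r ^ 2) : Set G),
    SetLike.coe_sort_coe, Nat.card_zpowers, h2, h.ncard_centralizer, h.card_eq] at h1
  refine Nat.eq_of_mul_eq_mul_right (m := 4 * e) (by have := h.four_le; omega)
    (h1.trans ?_)
  ring

theorem ncard_residualSet (h : DihedralCore N e r s z U) :
    (residualSet N r U).ncard = (e + Nat.card U) ^ 2 - 1 := by
  have h1 : residualSet N r U = (N : Set G) \ ({1} ∪
      {y | ∃ g, ∃ x ∈ (U : Set G) \ {1}, g * x * g⁻¹ = y} ∪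
      {y | ∃ g, ∃ x ∈ (Subgroup.zpowers (r ^ 2) : Set G) \ {1}, g * x * g⁻¹ = y}) := by
    ext y
    constructor
    · intro hy
      refine ⟨hy.1, ?_⟩
      rintro ((h2 | ⟨g, x, hx, rfl⟩) | ⟨g, x, hx, rfl⟩)
      · exact ne_one_of_mem_residualSet hy h2
      · exact hy.2.1 g⁻¹ (by
          have h2 := hx.1
          rwa [show g⁻¹ * (g * x * g⁻¹) * g⁻¹⁻¹ = x by group])
      · exact hy.2.2 g⁻¹ (by
          have h2 := hx.1
          rwa [show g⁻¹ * (g * x * g⁻¹) * g⁻¹⁻¹ = x by group])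
    · rintro ⟨hyN, hy⟩
      simp only [Set.mem_union, not_or] at hy
      have hconj : ∀ g, g⁻¹ * (g * y * g⁻¹) * g⁻¹⁻¹ = y := fun g => by group
      have hne : ∀ g, g * y * g⁻¹ ∉ ({1} : Set G) := fun g => by
        rw [Set.mem_singleton_iff, conj_eq_one_iff]
        exact hy.1.1
      exact ⟨hyN, fun g hg => hy.1.2 ⟨g⁻¹, _, ⟨hg, hne g⟩, hconj g⟩,
        fun g hg => hy.2 ⟨g⁻¹, _, ⟨hg, hne g⟩, hconj g⟩⟩
  have hN : (N : Set G).ncard = 2 * e * Nat.card U * (e + Nat.card U) := by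
    have h2 := N.card_mul_index
    rw [h.index, h.card_eq] at h2
    rw [← Nat.card_coe_set_eq, SetLike.coe_sort_coe]
    refine Nat.eq_of_mul_eq_mul_right two_pos (h2.trans ?_)
    ring
  rw [h1, Set.ncard_sdiff, Set.ncard_union_eq, Set.ncard_union_eq, h.ncard_conj_U,
    h.ncard_conj_zpowers, hN, Set.ncard_singleton]
  · obtain ⟨a, ha⟩ := Nat.exists_eq_add_of_le' (show 1 ≤ Nat.card U from Nat.card_pos)
    obtain ⟨b, hb⟩ := Nat.exists_eq_add_of_le' (show 1 ≤ e by have := h.four_le; omega)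
    obtain ⟨c, hc⟩ := Nat.exists_eq_add_of_le' (show 1 ≤ (e + Nat.card U) ^ 2 from
      Nat.one_le_pow _ _ (by omega))
    rw [hc]
    rw [ha, hb] at hc ⊢
    simp only [Nat.add_sub_cancel]
    apply Nat.sub_eq_of_eq_add
    linarith
  · rw [Set.disjoint_left]
    rintro _ rfl ⟨g, x, hx, hg⟩
    exact hx.2 ((conj_eq_one_iff).1 hg)
  · rw [Set.disjoint_left]
    rintro _ (rfl | ⟨g, x, hx, rfl⟩) ⟨g', x', hx', hg⟩
    · exact hx'.2 ((conj_eq_one_iff).1 hg)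
    · refine h.not_odd_of_mem_zpowers hx'.1 hx'.2 ?_
      rw [← orderOf_conj_mul_inv g', hg, orderOf_conj_mul_inv]
      exact h.odd_orderOf hx.1
  · rintro _ ((rfl | ⟨g, x, hx, rfl⟩) | ⟨g, x, hx, rfl⟩)
    · exact one_mem N
    · exact (h.conj_mem_iff _ _).2 (h.le hx.1)
    · exact (h.conj_mem_iff _ _).2 (h.zpowers_sq_le hx.1)

theorem mul_self_ne_one_of_mem_residualSet (h : DihedralCore N e r s z U) {y : G}
    (hy : y ∈ residualSet N r U) : y * y ≠ 1 := by
  intro hyy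
  obtain ⟨g, rfl⟩ := isConj_iff.1 (h.isConj_z_of_mem hyy (ne_one_of_mem_residualSet hy) hy.1)
  refine hy.2.2 g⁻¹ ?_
  convert h.z_mem_zpowers_sq using 1
  group

theorem not_comm_involution_of_mem_residualSet (h : DihedralCore N e r s z U) {y i : G}
    (hy : y ∈ residualSet N r U) (hi : i * i = 1) (hi1 : i ≠ 1) : y * i ≠ i * y := by
  intro hyi
  by_cases hiN : i ∈ N
  · obtain ⟨g, rfl⟩ := isConj_iff.1 (h.isConj_z_of_mem hi hi1 hiN)
    have hy' := h.conj_mem_residualSet hy g⁻¹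
    have h1 : g⁻¹ * y * g⁻¹⁻¹ * z = z * (g⁻¹ * y * g⁻¹⁻¹) := by
      calc _ = g⁻¹ * (y * (g * z * g⁻¹)) * g := by group
        _ = _ := by rw [hyi]; group
    generalize g⁻¹ * y * g⁻¹⁻¹ = y' at *
    obtain ⟨j, rfl | rfl⟩ := h.centralizer _ h1
    · obtain ⟨k, rfl⟩ := (h.pow_mem_iff j).1 hy'.1
      refine hy'.2.2 1 ?_
      rw [one_mul, inv_one, mul_one, ← two_mul, pow_mul]
      exact Subgroup.npow_mem_zpowers _ _
    · exact h.mul_self_ne_one_of_mem_residualSet hy' (h.reflection_sq j)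
  · obtain ⟨g, rfl⟩ := isConj_iff.1 (h.isConj_s_of_notMem hi hiN)
    have hy' := h.conj_mem_residualSet hy g⁻¹
    have h1 : g⁻¹ * y * g⁻¹⁻¹ * s = s * (g⁻¹ * y * g⁻¹⁻¹) := by
      calc _ = g⁻¹ * (y * (g * s * g⁻¹)) * g := by group
        _ = _ := by rw [hyi]; group
    generalize g⁻¹ * y * g⁻¹⁻¹ = y' at *
    rcases h.cover _ hy'.1 h1 with h2 | h2
    · refine hy'.2.1 1 ?_
      rwa [one_mul, inv_one, mul_one]
    · refine h.mul_self_ne_one_of_mem_residualSet hy' ?_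
      have h3 := h.z_mul_mul_z h2
      rwa [← mul_assoc z z y', h.z_mul_z, one_mul] at h3

theorem not_comm_of_mem_residualSet (h : DihedralCore N e r s z U) {y c : G} {ρ : ℕ}
    (hρ : ρ.Prime) (hρU : ρ ∣ Nat.card U) (hy : y ∈ residualSet N r U) (hc : orderOf c = ρ) :
    y * c ≠ c * y := by
  intro hyc
  have := Fact.mk hρ
  have hodd : Odd ρ := h.odd.of_dvd_nat hρU
  have hindex : U.index = 4 * e * (e + Nat.card U) := by
    have h1 := U.card_mul_index
    rw [h.card_eq] at h1
    refine Nat.eq_of_mul_eq_mul_left (Nat.card_pos (α := U)) (h1.trans ?_)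
    ring
  obtain ⟨g, hg⟩ := exists_conj_mem_of_not_dvd_index (U := U) (p := ρ) (w := c) (n := 1)
    (fun h1 => hρ.one_lt.ne' (h.eq_one_of_dvd hodd (hindex ▸ h1) hρU))
    (by rw [pow_one, ← hc, pow_orderOf_eq_one])
  refine hy.2.1 g (h.mem_of_comm hg ?_ ((h.conj_mem_iff _ _).2 hy.1) ?_)
  · rw [Ne, conj_eq_one_iff]
    rintro rfl
    rw [orderOf_one] at hc
    exact hρ.one_lt.ne hc
  · calc _ = g * (y * c) * g⁻¹ := by group
      _ = _ := by rw [hyc]; group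

theorem card_centralizer_coprime (h : DihedralCore N e r s z U) {y : G}
    (hy : y ∈ residualSet N r U) :
    (Nat.card (Subgroup.centralizer {y})).Coprime (4 * e * Nat.card U) := by
  refine Nat.coprime_of_dvd fun ρ hρ h1 h2 => ?_
  have := Fact.mk hρ
  obtain ⟨⟨c, hc⟩, hcρ⟩ := exists_prime_orderOf_dvd_card' ρ h1
  rw [Subgroup.orderOf_mk] at hcρ
  have hcy := Subgroup.mem_centralizer_singleton_iff.1 hc
  rcases (hρ.dvd_mul).1 h2 with h2 | h2
  · obtain ⟨k, hk, rfl⟩ := h.e_eq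
    rw [show 4 * 2 ^ k = 2 ^ (k + 2) by ring] at h2
    have h3 := (Nat.prime_dvd_prime_iff_eq hρ Nat.prime_two).1 (hρ.dvd_of_dvd_pow h2)
    subst h3
    refine h.not_comm_involution_of_mem_residualSet hy (i := c) ?_ ?_ hcy.symm
    · rw [← pow_two, ← hcρ, pow_orderOf_eq_one]
    · rintro rfl
      rw [orderOf_one] at hcρ
      omega
  · exact h.not_comm_of_mem_residualSet hρ h2 hy hcρ hcy.symm

theorem card_centralizer_dvd (h : DihedralCore N e r s z U) {y : G}
    (hy : y ∈ residualSet N r U) :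
    Nat.card (Subgroup.centralizer {y}) ∣ e + Nat.card U := by
  have h1 := (Subgroup.centralizer {y}).card_subgroup_dvd_card
  rw [h.card_eq] at h1
  exact (h.card_centralizer_coprime hy).dvd_of_dvd_mul_left h1

theorem dvd_ncard_isConj (h : DihedralCore N e r s z U) {y : G}
    (hy : y ∈ residualSet N r U) : 4 * e * Nat.card U ∣ {y' | IsConj y y'}.ncard := by
  obtain ⟨k, hk⟩ := h.card_centralizer_dvd hy
  refine ⟨k, Nat.eq_of_mul_eq_mul_right (Nat.card_pos (α := Subgroup.centralizer {y})) ?_⟩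
  rw [ncard_isConj_mul_card_centralizer, h.card_eq, hk]
  ring

theorem card_U_eq (h : DihedralCore N e r s z U) :
    Nat.card U = e + 1 ∨ Nat.card U + 1 = e := by
  obtain ⟨k, hk, he⟩ := h.e_eq
  refine eq_or_eq_of_four_mul_dvd hk he h.odd ?_
  rw [← h.ncard_residualSet]
  exact dvd_ncard_of_conj_invariant (fun y hy g => h.conj_mem_residualSet hy g)
    fun y hy => h.dvd_ncard_isConj hy

theorem ncard_residualSet_eq (h : DihedralCore N e r s z U) :
    (residualSet N r U).ncard = 4 * e * Nat.card U := by
  rw [h.ncard_residualSet]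
  apply Nat.sub_eq_of_eq_add
  rcases h.card_U_eq with h1 | h1
  · rw [h1]
    ring
  · rw [← h1]
    ring

theorem setOf_isConj_eq (h : DihedralCore N e r s z U) {y : G} (hy : y ∈ residualSet N r U) :
    {y' | IsConj y y'} = residualSet N r U := by
  refine Set.eq_of_subset_of_ncard_le ?_ ?_
  · intro y' hy'
    obtain ⟨g, rfl⟩ := isConj_iff.1 hy'
    exact h.conj_mem_residualSet hy g
  · rw [h.ncard_residualSet_eq]
    refine Nat.le_of_dvd ?_ (h.dvd_ncard_isConj hy)
    exact (Set.ncard_pos).2 ⟨y, IsConj.refl y⟩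

theorem isConj_of_mem_residualSet (h : DihedralCore N e r s z U) {y y' : G}
    (hy : y ∈ residualSet N r U) (hy' : y' ∈ residualSet N r U) : IsConj y y' := by
  rw [← h.setOf_isConj_eq hy] at hy'
  exact hy'

theorem card_centralizer_eq (h : DihedralCore N e r s z U) {y : G}
    (hy : y ∈ residualSet N r U) :
    Nat.card (Subgroup.centralizer {y}) = e + Nat.card U := by
  have h1 := ncard_isConj_mul_card_centralizer y
  rw [h.setOf_isConj_eq hy, h.ncard_residualSet_eq, h.card_eq] at h1
  refine Nat.eq_of_mul_eq_mul_left ?_ h1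
  have := h.four_le
  have := Nat.card_pos (α := U)
  positivity

theorem exists_mem_residualSet (h : DihedralCore N e r s z U) : ∃ y, y ∈ residualSet N r U := by
  refine (Set.ncard_pos).1 ?_
  rw [h.ncard_residualSet_eq]
  have := h.four_le
  have := Nat.card_pos (α := U)
  positivity

end DihedralCore

namespace DihedralCore

variable {G : Type*} [Group G] {N : Subgroup G} {e : ℕ} {r s z : G} {U : Subgroup G}

theorem odd_add_card (h : DihedralCore N e r s z U) : Odd (e + Nat.card U) := by
  obtain ⟨f, hf, -⟩ := h.exists_half
  rw [hf]
  exact (even_two_mul f).add_odd h.odd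

variable [Finite G]

theorem odd_orderOf_of_comm (h : DihedralCore N e r s z U) {y a : G}
    (hy : y ∈ residualSet N r U) (ha : a * y = y * a) : Odd (orderOf a) := by
  refine odd_orderOf_of_mem_odd_card ?_ (Subgroup.mem_centralizer_singleton_iff.2 ha)
  rw [h.card_centralizer_eq hy]
  exact h.odd_add_card

theorem mem_residualSet_of_comm (h : DihedralCore N e r s z U) {y a : G}
    (hy : y ∈ residualSet N r U) (ha : a * y = y * a) (ha1 : a ≠ 1) :
    a ∈ residualSet N r U := by
  have hodd := h.odd_orderOf_of_comm hy ha
  have hne : ∀ g, g * a * g⁻¹ ≠ 1 := fun g => by rwa [Ne, conj_eq_one_iff]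
  refine ⟨h.mem_of_odd hodd, fun g hg => ?_, fun g hg => ?_⟩
  · refine hy.2.1 g (h.mem_of_comm hg (hne g) ((h.conj_mem_iff _ _).2 hy.1) ?_)
    calc g * y * g⁻¹ * (g * a * g⁻¹) = g * (y * a) * g⁻¹ := by group
      _ = _ := by rw [← ha]; group
  · refine h.not_odd_of_mem_zpowers hg (hne g) ?_
    rwa [orderOf_conj_mul_inv]

theorem exists_involution_inverts (h : DihedralCore N e r s z U) {y : G}
    (hy : y ∈ residualSet N r U) : ∃ τ : G, τ * τ = 1 ∧ τ ≠ 1 ∧ τ * y * τ⁻¹ = y⁻¹ := by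
  have hinv : y⁻¹ ∈ residualSet N r U :=
    h.mem_residualSet_of_comm hy (by group) (inv_ne_one.2 (ne_one_of_mem_residualSet hy))
  obtain ⟨k, hk⟩ := isConj_iff.1 (h.isConj_of_mem_residualSet hy hinv)
  have hk2 : k * k * y = y * (k * k) := by
    rw [← mul_inv_eq_iff_eq_mul]
    calc k * k * y * (k * k)⁻¹ = k * (k * y * k⁻¹) * k⁻¹ := by group
      _ = (k * y * k⁻¹)⁻¹ := by rw [hk, ← conj_inv, hk]
      _ = y := by rw [hk, inv_inv]
  obtain ⟨m, hm⟩ := h.odd_orderOf_of_comm hy hk2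
  have hτy : k ^ (2 * m + 1) * y * (k ^ (2 * m + 1))⁻¹ = y⁻¹ := by
    have h1 : Commute ((k * k) ^ m) y := Commute.pow_left hk2 m
    rw [pow_succ', pow_mul, pow_two]
    calc k * (k * k) ^ m * y * (k * (k * k) ^ m)⁻¹
        = k * ((k * k) ^ m * y) * ((k * k) ^ m)⁻¹ * k⁻¹ := by group
      _ = y⁻¹ := by rw [h1.eq, ← hk]; group
  refine ⟨k ^ (2 * m + 1), ?_, ?_, hτy⟩
  · rw [← pow_two, ← pow_mul, mul_comm, pow_mul, pow_two, ← hm, pow_orderOf_eq_one]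
  · intro h1
    rw [h1, one_mul, inv_one, mul_one] at hτy
    refine h.mul_self_ne_one_of_mem_residualSet hy ?_
    nth_rw 1 [hτy]
    exact inv_mul_cancel y

end DihedralCore

/-- A dihedral core together with a residual element `y` inverted by an involution `τ`. -/
structure DihedralTorus {G : Type*} [Group G] (N : Subgroup G) (e : ℕ) (r s z : G)
    (U : Subgroup G) (y τ : G) : Prop extends DihedralCore N e r s z U where
  mem : y ∈ residualSet N r U
  sq : τ * τ = 1
  ne_one : τ ≠ 1
  conj_eq_inv : τ * y * τ⁻¹ = y⁻¹

theorem DihedralCore.exists_torus {G : Type*} [Group G] [Finite G] {N : Subgroup G} {e : ℕ}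
    {r s z : G} {U : Subgroup G} (h : DihedralCore N e r s z U) :
    ∃ y, DihedralTorus N e r s z U y z ∨ DihedralTorus N e r s z U y s := by
  obtain ⟨y, hy⟩ := h.exists_mem_residualSet
  obtain ⟨τ, hτ, hτ1, hτy⟩ := h.exists_involution_inverts hy
  have key : ∀ g i, g * i * g⁻¹ = τ → i * (g⁻¹ * y * g⁻¹⁻¹) * i⁻¹ = (g⁻¹ * y * g⁻¹⁻¹)⁻¹ := by
    rintro g i rfl
    calc _ = g⁻¹ * (g * i * g⁻¹ * y * (g * i * g⁻¹)⁻¹) * g := by group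
      _ = _ := by rw [hτy]; group
  by_cases hτN : τ ∈ N
  · obtain ⟨g, hg⟩ := isConj_iff.1 (h.isConj_z_of_mem hτ hτ1 hτN)
    exact ⟨g⁻¹ * y * g⁻¹⁻¹, Or.inl ⟨h, h.conj_mem_residualSet hy _, h.z_mul_z, h.z_ne_one,
      key g z hg⟩⟩
  · obtain ⟨g, hg⟩ := isConj_iff.1 (h.isConj_s_of_notMem hτ hτN)
    exact ⟨g⁻¹ * y * g⁻¹⁻¹, Or.inr ⟨h, h.conj_mem_residualSet hy _, h.s_mul_s, h.s_ne_one,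
      key g s hg⟩⟩

/-- The elements of the centralizer of `τ` normalizing the centralizer of `y`. -/
abbrev complementSubgroup {G : Type*} [Group G] (y τ : G) : Subgroup G :=
  Subgroup.centralizer {τ} ⊓ Subgroup.normalizer (Subgroup.centralizer {y} : Set G)

theorem conj_comm_of_mem_complementSubgroup {G : Type*} [Group G] {y τ : G} {l : G}
    (hl : l ∈ complementSubgroup y τ) : l * y * l⁻¹ * y = y * (l * y * l⁻¹) :=
  Subgroup.mem_centralizer_singleton_iff.1 ((Subgroup.mem_normalizer_iff.1 hl.2 y).1
    (Subgroup.mem_centralizer_singleton_iff.2 rfl))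

namespace DihedralTorus

variable {G : Type*} [Group G] [Finite G] {N : Subgroup G} {e : ℕ} {r s z : G} {U : Subgroup G}
  {y τ : G}

theorem eq_one_of_comm (h : DihedralTorus N e r s z U y τ) {a i : G} (ha : a * y = y * a)
    (hi : i * i = 1) (hi1 : i ≠ 1) (hai : a * i = i * a) : a = 1 := by
  by_contra ha1
  exact h.not_comm_involution_of_mem_residualSet (h.mem_residualSet_of_comm h.mem ha ha1)
    hi hi1 hai

theorem inverts_of_normalizes (h : DihedralTorus N e r s z U y τ) {i : G} (hi : i * i = 1)
    (hi1 : i ≠ 1) (hiA : ∀ a ∈ Subgroup.centralizer {y}, i * a * i⁻¹ ∈ Subgroup.centralizer {y}) :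
    ∀ a ∈ Subgroup.centralizer {y}, i * a * i⁻¹ = a⁻¹ :=
  inverts_of_no_fixed_points hi hiA fun _ ha hai => h.eq_one_of_comm
    (Subgroup.mem_centralizer_singleton_iff.1 ha) hi hi1 hai.symm

theorem inverts_centralizer (h : DihedralTorus N e r s z U y τ) :
    ∀ a ∈ Subgroup.centralizer {y}, τ * a * τ⁻¹ = a⁻¹ := by
  refine h.inverts_of_normalizes h.sq h.ne_one fun a ha => ?_
  have ha' : Commute a y := Subgroup.mem_centralizer_singleton_iff.1 ha
  refine Subgroup.mem_centralizer_singleton_iff.2 (Commute.inv_right_iff.1 ?_)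
  rw [← h.conj_eq_inv]
  have h1 : τ * a * τ⁻¹ * (τ * y * τ⁻¹) = τ * (a * y) * τ⁻¹ := by group
  rw [commute_iff_eq, h1, ha'.eq]
  group

theorem comm_of_mem (h : DihedralTorus N e r s z U y τ) {a b : G} (ha : a * y = y * a)
    (hb : b * y = y * b) : a * b = b * a :=
  commute_of_inverts h.inverts_centralizer a (Subgroup.mem_centralizer_singleton_iff.2 ha) b
    (Subgroup.mem_centralizer_singleton_iff.2 hb)

theorem comm_iff (h : DihedralTorus N e r s z U y τ) {a b : G} (ha : a * y = y * a)
    (ha1 : a ≠ 1) : b * a = a * b ↔ b * y = y * b := by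
  have h1 : Subgroup.centralizer {y} = Subgroup.centralizer {a} := by
    refine Subgroup.eq_of_le_of_card_ge (fun b hb => ?_) ?_
    · exact Subgroup.mem_centralizer_singleton_iff.2
        (h.comm_of_mem (Subgroup.mem_centralizer_singleton_iff.1 hb) ha)
    · rw [h.card_centralizer_eq h.mem,
        h.card_centralizer_eq (h.mem_residualSet_of_comm h.mem ha ha1)]
  rw [← Subgroup.mem_centralizer_singleton_iff, ← Subgroup.mem_centralizer_singleton_iff, h1]

theorem mem_normalizer_of_conj_mem (h : DihedralTorus N e r s z U y τ) {g : G}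
    (hg : g * y * g⁻¹ * y = y * (g * y * g⁻¹)) :
    g ∈ Subgroup.normalizer (Subgroup.centralizer {y} : Set G) := by
  have hg1 : g * y * g⁻¹ ≠ 1 := by
    rw [Ne, conj_eq_one_iff]
    exact DihedralCore.ne_one_of_mem_residualSet h.mem
  refine Subgroup.mem_normalizer_iff.2 fun a => ?_
  rw [Subgroup.mem_centralizer_singleton_iff,
    Subgroup.mem_centralizer_singleton_iff, ← h.comm_iff hg hg1 (b := g * a * g⁻¹)]
  have h1 : ∀ u v, g * u * g⁻¹ * (g * v * g⁻¹) = g * (u * v) * g⁻¹ := fun u v => by group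
  rw [h1, h1, mul_left_inj, mul_right_inj]

theorem exists_mem_conj_eq (h : DihedralTorus N e r s z U y τ) {a : G} (ha : a * y = y * a)
    (ha1 : a ≠ 1) : ∃ l ∈ complementSubgroup y τ, l * y * l⁻¹ = a := by
  obtain ⟨g, hg⟩ := isConj_iff.1
    (h.isConj_of_mem_residualSet h.mem (h.mem_residualSet_of_comm h.mem ha ha1))
  have hinv : ∀ a, a * y = y * a → τ * a * τ⁻¹ = a⁻¹ := fun a ha =>
    h.inverts_centralizer a (Subgroup.mem_centralizer_singleton_iff.2 ha)
  set b := τ * g * τ⁻¹ * g⁻¹ with hb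
  have hby : b * y = y * b := by
    rw [← h.comm_iff ha ha1, ← mul_inv_eq_iff_eq_mul]
    calc b * a * b⁻¹ = τ * g * τ⁻¹ * (g⁻¹ * a * g) * τ * g⁻¹ * τ⁻¹ := by rw [hb]; group
      _ = τ * g * τ⁻¹ * y * τ * g⁻¹ * τ⁻¹ := by rw [← hg]; group
      _ = τ * (g * (τ * y * τ⁻¹) * g⁻¹) * τ⁻¹ := by
        rw [inv_eq_of_mul_eq_one_left h.sq]; group
      _ = τ * (g * y * g⁻¹)⁻¹ * τ⁻¹ := by rw [h.conj_eq_inv]; group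
      _ = a := by rw [hg, ← conj_inv, hinv a ha, inv_inv]
  obtain ⟨m, hm⟩ := h.odd_orderOf_of_comm h.mem hby
  set c := b ^ (m + 1) with hc
  have hcc : c * c = b := by
    rw [hc, ← pow_add, show m + 1 + (m + 1) = (2 * m + 1) + 1 by ring, ← hm, pow_succ,
      pow_orderOf_eq_one, one_mul]
  have hcy : c * y = y * c := Commute.pow_left hby _
  have hconj : c * g * y * (c * g)⁻¹ = a := by
    calc c * g * y * (c * g)⁻¹ = c * (g * y * g⁻¹) * c⁻¹ := by group
      _ = a := by rw [hg, h.comm_of_mem hcy ha, mul_inv_cancel_right]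
  refine ⟨c * g, ⟨Subgroup.mem_centralizer_singleton_iff.2 ?_,
    h.mem_normalizer_of_conj_mem (by rw [hconj, ha])⟩, hconj⟩
  symm
  rw [← mul_inv_eq_iff_eq_mul]
  calc τ * (c * g) * τ⁻¹ = (τ * c * τ⁻¹) * b * g := by rw [hb]; group
    _ = c * g := by rw [hinv c hcy, ← hcc, inv_mul_cancel_left]

theorem card_complementSubgroup (h : DihedralTorus N e r s z U y τ) :
    Nat.card (complementSubgroup y τ) = e + Nat.card U - 1 := by
  have h1 : (Subgroup.centralizer {y} : Set G) \ {1} =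
      (fun l => l * y * l⁻¹) '' (complementSubgroup y τ : Set G) := by
    ext a
    constructor
    · rintro ⟨ha, ha1⟩
      exact h.exists_mem_conj_eq (Subgroup.mem_centralizer_singleton_iff.1 ha) ha1
    · rintro ⟨l, hl, rfl⟩
      refine ⟨Subgroup.mem_centralizer_singleton_iff.2 (conj_comm_of_mem_complementSubgroup hl), ?_⟩
      rw [Set.mem_singleton_iff, conj_eq_one_iff]
      exact DihedralCore.ne_one_of_mem_residualSet h.mem
  have h2 : Set.InjOn (fun l => l * y * l⁻¹) (complementSubgroup y τ : Set G) := by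
    intro l hl l' hl' hll
    simp only at hll
    have h3 := mul_mem (inv_mem hl') hl
    have h4 : l'⁻¹ * l * y = y * (l'⁻¹ * l) := by
      calc l'⁻¹ * l * y = l'⁻¹ * (l * y * l⁻¹) * l := by group
        _ = _ := by rw [hll]; group
    have h5 := h.eq_one_of_comm h4 h.sq h.ne_one (Subgroup.mem_centralizer_singleton_iff.1 h3.1)
    exact (inv_mul_eq_one.1 h5).symm
  rw [← h.card_centralizer_eq h.mem, ← SetLike.coe_sort_coe (Subgroup.centralizer {y}),
    Nat.card_coe_set_eq, ← Set.ncard_sdiff_singleton_of_mem (one_mem _), h1,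
    h2.ncard_image, ← Nat.card_coe_set_eq, SetLike.coe_sort_coe]

theorem eq_of_mem_of_sq (h : DihedralTorus N e r s z U y τ) {i : G}
    (hi : i ∈ complementSubgroup y τ) (hi2 : i * i = 1) (hi1 : i ≠ 1) : i = τ := by
  have hiτ : i * τ = τ * i := Subgroup.mem_centralizer_singleton_iff.1 hi.1
  have h1 := h.inverts_of_normalizes hi2 hi1
    (fun a ha => (Subgroup.mem_normalizer_iff.1 hi.2 a).1 ha)
  have hy : y ∈ Subgroup.centralizer {y} := Subgroup.mem_centralizer_singleton_iff.2 rfl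
  by_contra hne
  refine h.not_comm_involution_of_mem_residualSet h.mem (i := i * τ) ?_ ?_ ?_
  · calc i * τ * (i * τ) = i * τ * (τ * i) := by rw [← hiτ]
      _ = i * (τ * τ) * i := by group
      _ = 1 := by rw [h.sq, mul_one, hi2]
  · intro h2
    refine hne ?_
    rw [eq_inv_of_mul_eq_one_left h2, inv_eq_of_mul_eq_one_left h.sq]
  · symm
    rw [← mul_inv_eq_iff_eq_mul]
    calc i * τ * y * (i * τ)⁻¹ = i * (τ * y * τ⁻¹) * i⁻¹ := by group
      _ = y := by rw [h.conj_eq_inv, ← conj_inv, h1 y hy, inv_inv]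

end DihedralTorus

namespace DihedralTorus

variable {G : Type*} [Group G] [Finite G] {N : Subgroup G} {e : ℕ} {r s z : G} {U : Subgroup G}
  {y : G}

theorem ne_add_one_of_z (h : DihedralTorus N e r s z U y z) : Nat.card U ≠ e + 1 := by
  intro hU
  have hcard := h.card_complementSubgroup
  rw [hU, show e + (e + 1) - 1 = 2 * e by omega, ← h.orderOf_r, ← Nat.card_zpowers] at hcard
  have hle : complementSubgroup y z ≤ Subgroup.zpowers r := by
    intro l hl
    obtain ⟨i, rfl | rfl⟩ := h.centralizer l (Subgroup.mem_centralizer_singleton_iff.1 hl.1)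
    · exact Subgroup.npow_mem_zpowers _ _
    · exact absurd (h.eq_of_mem_of_sq hl (h.reflection_sq i) (h.reflection_ne_one i))
        (h.reflection_ne_z i)
  have heq := Subgroup.eq_of_le_of_card_ge hle hcard.ge
  have hr : r ∈ complementSubgroup y z := heq ▸ Subgroup.mem_zpowers r
  have hbot := h.eq_bot (Subgroup.centralizer {y}) (by
      rw [h.card_centralizer_eq h.mem]
      exact h.odd_add_card) (fun a ha b hb => h.comm_of_mem
        (Subgroup.mem_centralizer_singleton_iff.1 ha) (Subgroup.mem_centralizer_singleton_iff.1 hb))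
    fun a ha => (Subgroup.mem_normalizer_iff.1 hr.2 a).1 ha
  refine DihedralCore.ne_one_of_mem_residualSet h.mem ?_
  rw [← Subgroup.mem_bot, ← hbot]
  exact Subgroup.mem_centralizer_singleton_iff.2 rfl

theorem ne_add_one_of_s (h : DihedralTorus N e r s z U y s) : Nat.card U ≠ e + 1 := by
  intro hU
  have hcard := h.card_complementSubgroup
  have hdvd : Nat.card (complementSubgroup y s) ∣ Nat.card (Subgroup.centralizer {s}) :=
    Subgroup.card_dvd_of_le inf_le_left
  have h1 : Nat.card (Subgroup.centralizer {s}) = 4 * Nat.card U := by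
    rw [← h.ncard_centralizer_s, ← SetLike.coe_sort_coe, Nat.card_coe_set_eq]
    congr 1
    ext g
    rw [SetLike.mem_coe, Subgroup.mem_centralizer_singleton_iff]
    rfl
  rw [h1, hcard, hU, show e + (e + 1) - 1 = 2 * e by omega,
    show 4 * (e + 1) = 2 * e * 2 + 4 by ring] at hdvd
  have h2 := Nat.le_of_dvd (by norm_num) ((Nat.dvd_add_right (dvd_mul_right _ _)).1 hdvd)
  have := h.four_le
  omega

theorem add_one_ne_of_z (h : DihedralTorus N e r s z U y z) : Nat.card U + 1 ≠ e := by
  intro hU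
  have hcard := h.card_complementSubgroup
  have hdvd : Nat.card (complementSubgroup y z) ∣ Nat.card (Subgroup.centralizer {z}) :=
    Subgroup.card_dvd_of_le inf_le_left
  have h1 : Nat.card (Subgroup.centralizer {z}) = 4 * e := by
    rw [← h.ncard_centralizer, ← SetLike.coe_sort_coe, Nat.card_coe_set_eq]
    congr 1
    ext g
    rw [SetLike.mem_coe, Subgroup.mem_centralizer_singleton_iff]
    rfl
  rw [h1, hcard, show e + Nat.card U - 1 = Nat.card U * 2 by omega] at hdvd
  have h2 := (h.coprime_of_odd h.odd).eq_one_of_dvd (dvd_of_mul_right_dvd hdvd)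
  have := h.four_le
  omega

theorem mem_U_of_mem (h : DihedralTorus N e r s z U y s) {l : G}
    (hl : l ∈ complementSubgroup y s) (hlN : l ∈ N) : l ∈ U := by
  rcases h.cover l hlN (Subgroup.mem_centralizer_singleton_iff.1 hl.1) with h1 | h1
  · exact h1
  · have h2 := h.z_mul_mul_z h1
    rw [← mul_assoc z z l, h.z_mul_z, one_mul] at h2
    by_cases hl1 : l = 1
    · rw [hl1]
      exact one_mem U
    · exact absurd (h.eq_of_mem_of_sq hl h2 hl1 ▸ hlN) h.s_notMem

theorem s_mem_complementSubgroup (h : DihedralTorus N e r s z U y s) :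
    s ∈ complementSubgroup y s := by
  refine ⟨Subgroup.mem_centralizer_singleton_iff.2 rfl, h.mem_normalizer_of_conj_mem ?_⟩
  rw [h.conj_eq_inv]
  group

theorem z_inverts_complementSubgroup (h : DihedralTorus N e r s z U y s) {l : G}
    (hl : l ∈ complementSubgroup y s) : z * l * z⁻¹ = l⁻¹ := by
  by_cases hlN : l ∈ N
  · exact h.inverts l (h.mem_U_of_mem hl hlN)
  · have h1 := mul_mem h.s_mem_complementSubgroup hl
    have h2 : s * l ∈ U := by
      refine h.mem_U_of_mem h1 ?_
      rw [h.mul_mem_iff]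
      have := h.s_notMem
      tauto
    have hls : l * s = s * l := Subgroup.mem_centralizer_singleton_iff.1 hl.1
    calc z * l * z⁻¹ = z * (s * s) * l * z⁻¹ := by rw [h.s_mul_s, mul_one]
      _ = (z * s) * (s * l) * z⁻¹ := by group
      _ = s * (z * (s * l) * z⁻¹) := by rw [← h.s_comm_z]; group
      _ = s * (l * s)⁻¹ := by rw [h.inverts _ h2, hls]
      _ = l⁻¹ := by rw [_root_.mul_inv_rev, mul_inv_cancel_left]

theorem orderOf_eq_orderOf (h : DihedralTorus N e r s z U y s) {a : G} (ha : a * y = y * a)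
    (ha1 : a ≠ 1) : orderOf a = orderOf y := by
  obtain ⟨l, -, rfl⟩ := h.exists_mem_conj_eq ha ha1
  exact orderOf_conj_mul_inv l y

theorem prime_and_orderOf (h : DihedralTorus N e r s z U y s) (hU : Nat.card U + 1 = e) :
    (e + Nat.card U).Prime ∧ orderOf y = e + Nat.card U := by
  have hcard := h.card_centralizer_eq h.mem
  have he := h.four_le
  obtain ⟨ρ, hρ, hρq⟩ := Nat.exists_prime_and_dvd (show e + Nat.card U ≠ 1 by omega)
  have := Fact.mk hρ
  rw [← hcard] at hρq
  obtain ⟨⟨c, hc⟩, hcρ⟩ := exists_prime_orderOf_dvd_card' ρ hρq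
  rw [Subgroup.orderOf_mk] at hcρ
  have hy : orderOf y = ρ := by
    rw [← hcρ, h.orderOf_eq_orderOf (Subgroup.mem_centralizer_singleton_iff.1 hc)]
    rintro rfl
    rw [orderOf_one] at hcρ
    exact hρ.one_lt.ne hcρ
  have hp : IsPGroup ρ (Subgroup.centralizer {y}) := by
    rintro ⟨a, ha⟩
    refine ⟨1, Subtype.ext ?_⟩
    change a ^ ρ ^ 1 = 1
    rw [pow_one]
    by_cases ha1 : a = 1
    · rw [ha1, one_pow]
    · rw [← hy, ← h.orderOf_eq_orderOf (Subgroup.mem_centralizer_singleton_iff.1 ha) ha1,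
        pow_orderOf_eq_one]
  obtain ⟨j, hj⟩ := IsPGroup.iff_card.1 hp
  obtain ⟨k, hk, hek⟩ := h.e_eq
  have h1 : ρ ^ j + 1 = 2 ^ (k + 1) := by
    rw [← hj, hcard, pow_succ, ← hek]
    omega
  have h2 := exponent_eq_one_of_prime_pow_add_one_eq hρ (by omega) h1
  rw [h2, pow_one, hcard] at hj
  rw [hj]
  exact ⟨hρ, hy⟩

theorem exists_prime_and_mulEquiv (h : DihedralTorus N e r s z U y s)
    (hU : Nat.card U + 1 = e) : ∃ p : ℕ, p.Prime ∧ (∃ n, p = 2 ^ n - 1) ∧ 7 ≤ p ∧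
      Nonempty (G ≃* ProjectiveGeneralLinearGroup 2 (ZMod p)) ∧
      Nonempty (N ≃* PSL(2, ZMod p)) := by
  obtain ⟨hp, hy⟩ := h.prime_and_orderOf hU
  have he := h.four_le
  have hzy : Subgroup.zpowers y = Subgroup.centralizer {y} := by
    refine Subgroup.eq_of_le_of_card_ge ?_ ?_
    · rw [Subgroup.zpowers_le, Subgroup.mem_centralizer_singleton_iff]
    · rw [Nat.card_zpowers, hy, h.card_centralizer_eq h.mem]
  have mem_iff : ∀ a, a ∈ Subgroup.zpowers y ↔ a * y = y * a := fun a => by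
    rw [hzy, Subgroup.mem_centralizer_singleton_iff]
  have hG : Nat.card G = (e + Nat.card U) * ((e + Nat.card U) ^ 2 - 1) := by
    rw [← h.ncard_residualSet, h.ncard_residualSet_eq, h.card_eq, mul_comm]
  have hz : z * y * z⁻¹ ∉ Subgroup.zpowers y := fun hz => by
    refine h.reflection_ne_z 0 ?_
    rw [pow_zero, mul_one]
    exact (h.eq_of_mem_of_sq ⟨Subgroup.mem_centralizer_singleton_iff.2 h.s_comm_z.symm,
      h.mem_normalizer_of_conj_mem ((mem_iff _).1 hz)⟩ h.z_mul_z h.z_ne_one).symm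
  set p := e + Nat.card U with hpdef
  have := Fact.mk hp
  obtain ⟨φ⟩ := nonempty_mulEquiv_PGL_of_regular hy (fun g hg => (mem_iff g).2 hg)
    (complementSubgroup y s) (fun l hl => (mem_iff _).2 (conj_comm_of_mem_complementSubgroup hl))
    (fun a ha ha1 => h.exists_mem_conj_eq ((mem_iff a).1 ha) ha1) h.card_complementSubgroup
    h.z_mul_z (fun l hl => h.z_inverts_complementSubgroup hl) hz hG
  refine ⟨p, hp, ?_, by omega, ⟨φ⟩, ?_⟩
  · obtain ⟨k, hk, hek⟩ := h.e_eq
    refine ⟨k + 1, ?_⟩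
    rw [pow_succ, ← hek]
    omega
  · have hF : (2 : ZMod p) ≠ 0 := by
      intro h2
      have h3 : ((2 : ℕ) : ZMod p) = 0 := by exact_mod_cast h2
      have := Nat.le_of_dvd two_pos ((ZMod.natCast_eq_zero_iff 2 p).1 h3)
      omega
    obtain ⟨ψ⟩ := nonempty_mulEquiv_PSL_of_index_two hF (N.map (φ : G →* _)) (by
      rw [Subgroup.index_map_equiv, h.index])
    exact ⟨(φ.subgroupMap N).trans ψ⟩

end DihedralTorus

theorem DihedralConfig.exists_prime_and_mulEquiv {G : Type*} [Group G] [Finite G]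
    {N : Subgroup G} {e : ℕ} {r s z : G} (h : DihedralConfig N e r s z) :
    ∃ p : ℕ, p.Prime ∧ (∃ n, p = 2 ^ n - 1) ∧ 7 ≤ p ∧
      Nonempty (G ≃* ProjectiveGeneralLinearGroup 2 (ZMod p)) ∧
      Nonempty (N ≃* PSL(2, ZMod p)) := by
  obtain ⟨U, hU⟩ := h.exists_core
  obtain ⟨y, hy | hy⟩ := hU.exists_torus
  · exact hU.card_U_eq.elim (absurd · hy.ne_add_one_of_z) (absurd · hy.add_one_ne_of_z)
  · exact hy.exists_prime_and_mulEquiv (hU.card_U_eq.resolve_left hy.ne_add_one_of_s)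

section

open DihedralGroup

theorem DihedralGroup.exists_rotation {e : ℕ} (he : 2 ≤ e) {z t : DihedralGroup (2 * e)}
    (hz : z * z = 1) (hz1 : z ≠ 1) (hzc : ∀ y, y * z = z * y) (ht : t * t = 1) (ht1 : t ≠ 1)
    (htz : t ≠ z) : ∃ r : DihedralGroup (2 * e), orderOf r = 2 * e ∧ z = r ^ e ∧
      t * r * t = r⁻¹ ∧ ∀ y, ∃ i : ℕ, y = r ^ i ∨ y = t * r ^ i := by
  have : NeZero (2 * e) := ⟨by omega⟩
  have hpow : ∀ i : ZMod (2 * e), r 1 ^ i.val = r i := fun i => by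
    rw [r_one_pow, ZMod.natCast_zmod_val]
  have hrot : ∀ i : ZMod (2 * e), r i * r i = 1 → r i ≠ 1 → r i = r 1 ^ e := by
    intro i h1 h2
    rw [r_mul_r, one_def, r.injEq, ← ZMod.natCast_zmod_val i, ← Nat.cast_add,
      ZMod.natCast_eq_zero_iff, ← two_mul, Nat.mul_dvd_mul_iff_left two_pos] at h1
    obtain ⟨k, hk⟩ := h1
    have h3 := ZMod.val_lt i
    have h4 : i.val ≠ 0 := fun h0 => h2 (by rw [(ZMod.val_eq_zero i).1 h0, one_def])
    have hk0 : k ≠ 0 := fun h0 => h4 (by rw [hk, h0, mul_zero])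
    have hk2 : k < 2 := by
      rw [hk, mul_comm 2 e] at h3
      exact lt_of_mul_lt_mul_left' h3
    have hk1 : k = 1 := by omega
    rw [← hpow, hk, hk1, mul_one]
  have hz' : z = r 1 ^ e := by
    rcases z with i | i
    · exact hrot i hz hz1
    · have h1 := hzc (r 1)
      rw [r_mul_sr, sr_mul_r, sr.injEq, sub_eq_iff_eq_add, add_assoc, left_eq_add] at h1
      have h2 : ((2 : ℕ) : ZMod (2 * e)) = 0 := by
        rw [← h1]
        norm_num
      rw [ZMod.natCast_eq_zero_iff] at h2
      have := Nat.le_of_dvd two_pos h2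
      omega
  rcases t with j | j
  · exact absurd ((hrot j ht ht1).trans hz'.symm) htz
  · refine ⟨r 1, orderOf_r_one, hz', ?_, ?_⟩
    · simp [sr_mul_r, sr_mul_sr, inv_r]
    · rintro (i | i)
      · exact ⟨i.val, Or.inl (hpow i).symm⟩
      · exact ⟨(i - j).val, Or.inr (by rw [hpow, sr_mul_r, add_sub_cancel])⟩

theorem exists_rotation_of_mulEquiv_dihedralGroup {H : Type*} [Group H] {e : ℕ} (he : 2 ≤ e)
    (φ : H ≃* DihedralGroup (2 * e)) {z t : H}
    (hz : z * z = 1) (hz1 : z ≠ 1) (hzc : ∀ y, y * z = z * y) (ht : t * t = 1) (ht1 : t ≠ 1)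
    (htz : t ≠ z) : ∃ r : H, orderOf r = 2 * e ∧ z = r ^ e ∧
      t * r * t = r⁻¹ ∧ ∀ y, ∃ i : ℕ, y = r ^ i ∨ y = t * r ^ i := by
  obtain ⟨r, h1, h2, h3, h4⟩ := DihedralGroup.exists_rotation he (z := φ z) (t := φ t)
    (by rw [← map_mul, hz, map_one]) (by simpa using hz1)
    (fun y => by
      obtain ⟨y, rfl⟩ := φ.surjective y
      rw [← map_mul, hzc, map_mul])
    (by rw [← map_mul, ht, map_one]) (by simpa using ht1) (by simpa using htz)
  obtain ⟨r, rfl⟩ := φ.surjective r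
  refine ⟨r, by rwa [φ.orderOf_eq] at h1, φ.injective (by rw [h2, map_pow]),
    φ.injective (by rw [map_mul, map_mul, h3, map_inv]), fun y => ?_⟩
  obtain ⟨i, hi⟩ := h4 (φ y)
  exact ⟨i, hi.imp (fun h => φ.injective (by rw [h, map_pow]))
    fun h => φ.injective (by rw [h, map_mul, map_pow])⟩

end

/-- A maximal subgroup `Q` of an insoluble group which is a `2`-group and contains all soluble
subgroups through `x`, together with a proper nonabelian minimal normal subgroup `N`. -/
structure SolubilizerConfig {G : Type*} [Group G] (x : G) (Q N : Subgroup G) : Prop where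
  not_isSolvable : ¬ Group.IsSolvable G
  mem : x ∈ Q
  le_of_isSolvable : ∀ S : Subgroup G, Group.IsSolvable S → x ∈ S → S ≤ Q
  isCoatom : IsCoatom Q
  isPGroup : IsPGroup 2 Q
  normal : N.Normal
  ne_bot : N ≠ ⊥
  ne_top : N ≠ ⊤
  eq_bot_of_lt : ∀ M : Subgroup G, M.Normal → M < N → M = ⊥
  not_commute : ¬ ∀ a b : N, a * b = b * a

namespace SolubilizerConfig

variable {G : Type*} [Group G] {x : G} {Q N : Subgroup G}

theorem eq_of_le (h : SolubilizerConfig x Q N) {M : Subgroup G} (hM : M.Normal) (hle : M ≤ N)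
    (hne : M ≠ ⊥) : M = N :=
  hle.eq_of_not_lt fun hlt => hne (h.eq_bot_of_lt M hM hlt)

theorem not_le_centralizer (h : SolubilizerConfig x Q N) : ¬ N ≤ Subgroup.centralizer (N : Set G) :=
  fun hle => h.not_commute fun a b =>
    Subtype.ext (Subgroup.mem_centralizer_iff.1 (hle b.2) a a.2)

theorem commutator_eq_top (h : SolubilizerConfig x Q N) : commutator N = ⊤ := by
  have := h.normal
  have h1 : ⁅N, N⁆ = N := h.eq_of_le inferInstance (Subgroup.commutator_le_self N) fun h0 =>
    h.not_le_centralizer (Subgroup.commutator_eq_bot_iff_le_centralizer.1 h0)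
  apply Subgroup.map_injective N.subtype_injective
  rw [Subgroup.map_subtype_commutator, h1, ← MonoidHom.range_eq_map, Subgroup.range_subtype]

theorem le_of_mem_normalizer (h : SolubilizerConfig x Q N) {R : Subgroup G}
    (hR : Group.IsSolvable R) (hx : x ∈ Subgroup.normalizer (R : Set G)) : R ≤ Q :=
  le_sup_left.trans (h.le_of_isSolvable _ (isSolvable_sup_zpowers hR hx)
    (Subgroup.mem_sup_right (Subgroup.mem_zpowers x)))

theorem conj_inv_mem (_ : SolubilizerConfig x Q N) {z n : G} (hC : ∀ g, g * z = z * g ↔ g ∈ Q)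
    {y : G} (hy : y * (n * z * n⁻¹) = n * z * n⁻¹ * y) : n⁻¹ * y * n⁻¹⁻¹ ∈ Q := by
  rw [← hC, inv_inv]
  calc n⁻¹ * y * n * z = n⁻¹ * (y * (n * z * n⁻¹)) * n := by group
    _ = z * (n⁻¹ * y * n) := by rw [hy]; group

variable [Finite G]

theorem card_eq (h : SolubilizerConfig x Q N) : ∃ n, Nat.card Q = 2 ^ n :=
  IsPGroup.iff_card.1 h.isPGroup

theorem not_le (h : SolubilizerConfig x Q N) : ¬ N ≤ Q := by
  intro hle
  have := h.normal
  have hN : IsPGroup 2 N := h.isPGroup.to_le hle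
  have : Nontrivial N := (Subgroup.nontrivial_iff_ne_bot N).2 h.ne_bot
  have := hN.center_nontrivial
  obtain ⟨c, hc⟩ := exists_ne (1 : Subgroup.center N)
  have hcN : (c : N).1 ∈ N ⊓ Subgroup.centralizer (N : Set G) :=
    ⟨(c : N).2, Subgroup.mem_centralizer_iff.2 fun n hn =>
      congrArg Subtype.val (Subgroup.mem_center_iff.1 c.2 ⟨n, hn⟩)⟩
  have h1 := h.eq_of_le (M := N ⊓ Subgroup.centralizer (N : Set G)) inferInstance inf_le_left
    fun h0 => hc (by
      rw [h0, Subgroup.mem_bot] at hcN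
      exact Subtype.ext (Subtype.ext hcN))
  exact h.not_le_centralizer (inf_eq_left.1 h1)

theorem sup_eq_top (h : SolubilizerConfig x Q N) : Q ⊔ N = ⊤ :=
  h.isCoatom.2 _ (left_lt_sup.2 h.not_le)

theorem normalizer_eq (h : SolubilizerConfig x Q N) {K : Subgroup G} (hKQ : K ≤ Q) (hKN : K ≤ N)
    (hne : K ≠ ⊥) (hQ : Q ≤ Subgroup.normalizer (K : Set G)) :
    Subgroup.normalizer (K : Set G) = Q := by
  rcases hQ.eq_or_lt with h1 | h1
  · exact h1.symm
  · have hn : K.Normal := Subgroup.normalizer_eq_top_iff.1 (h.isCoatom.2 _ h1)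
    exact absurd (h.eq_of_le hn hKN hne ▸ hKQ) h.not_le

theorem eq_bot_of_odd (h : SolubilizerConfig x Q N) {R : Subgroup G} (hR : Group.IsSolvable R)
    (hx : x ∈ Subgroup.normalizer (R : Set G)) (hodd : Odd (Nat.card R)) : R = ⊥ := by
  obtain ⟨n, hn⟩ := h.card_eq
  have hd := Subgroup.card_dvd_of_le (h.le_of_mem_normalizer hR hx)
  rw [hn] at hd
  exact Subgroup.card_eq_one.1 (Nat.Coprime.eq_one_of_dvd (hodd.coprime_two_right.pow_right n) hd)

theorem odd_index (h : SolubilizerConfig x Q N) : ¬ 2 ∣ Q.index := by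
  obtain ⟨P, hP⟩ := h.isPGroup.exists_le_sylow
  rcases hP.eq_or_lt with h1 | h1
  · rw [h1]
    exact P.not_dvd_index
  · refine absurd ?_ h.not_isSolvable
    have h2 := h.isCoatom.2 _ h1
    have h3 : IsPGroup 2 (⊤ : Subgroup G) := h2 ▸ P.2
    have h4 : IsPGroup 2 G := h3.of_equiv Subgroup.topEquiv
    have := h4.isNilpotent
    infer_instance

theorem inf_ne_bot (h : SolubilizerConfig x Q N) : Q ⊓ N ≠ ⊥ := by
  intro h0
  have := h.normal
  have hodd : Odd (Nat.card N) := by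
    by_contra hcon
    obtain ⟨v, hv⟩ := exists_prime_orderOf_dvd_card' 2 (Nat.not_odd_iff_even.1 hcon).two_dvd
    have hv2 : (v : G) ^ 2 ^ 1 = 1 := by
      rw [pow_one, ← hv, ← Subgroup.orderOf_coe, pow_orderOf_eq_one]
    obtain ⟨g, hg⟩ := exists_conj_mem_of_not_dvd_index h.odd_index hv2
    have h1 : g * v * g⁻¹ ∈ Q ⊓ N := ⟨hg, h.normal.conj_mem _ v.2 g⟩
    rw [h0, Subgroup.mem_bot, conj_eq_one_iff] at h1
    rw [← Subgroup.orderOf_coe, h1, orderOf_one] at hv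
    omega
  obtain ⟨p, hp, hpd⟩ := Nat.exists_prime_and_dvd
    (show Nat.card N ≠ 1 from fun h1 => h.ne_bot (Subgroup.card_eq_one.1 h1))
  have := Fact.mk hp
  let := MulAction.compHom (Sylow p N) ((MulAut.conjNormal (H := N)).comp Q.subtype)
  have hS : ¬ 2 ∣ Nat.card (Sylow p N) := fun hd =>
    Nat.not_even_iff_odd.2 hodd (even_iff_two_dvd.2
      (hd.trans ((Sylow.card_dvd_index default).trans (Subgroup.index_dvd_card _))))
  obtain ⟨P, hP⟩ := h.isPGroup.nonempty_fixed_point_of_prime_not_dvd_card (Sylow p N) hS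
  have hxP : MulAut.conjNormal (H := N) x • P = P := hP ⟨x, h.mem⟩
  have hx : x ∈ Subgroup.normalizer (((P : Subgroup N).map N.subtype : Subgroup G) : Set G) := by
    refine Subgroup.mem_normalizer_fintype ?_
    rintro _ ⟨a, ha, rfl⟩
    refine ⟨MulAut.conjNormal (H := N) x a, ?_, MulAut.conjNormal_apply x a⟩
    have h1 : MulAut.conjNormal (H := N) x • a ∈ (MulAut.conjNormal (H := N) x • P : Sylow p N) :=
      Set.smul_mem_smul_set ha
    rwa [hxP] at h1
  have hPp : IsPGroup p ((P : Subgroup N).map N.subtype) := P.2.map _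
  have := hPp.isNilpotent
  have h1 := h.eq_bot_of_odd inferInstance hx
    (hodd.of_dvd_nat (Subgroup.card_dvd_of_le (Subgroup.map_subtype_le _)))
  rw [Subgroup.map_eq_bot_iff_of_injective _ N.subtype_injective] at h1
  exact P.ne_bot_of_dvd_card hpd h1

theorem exists_central_involution (h : SolubilizerConfig x Q N) :
    ∃ z ∈ N, z * z = 1 ∧ z ≠ 1 ∧ ∀ g, g * z = z * g ↔ g ∈ Q := by
  have := h.normal
  let := MulAction.compHom (N.subgroupOf Q) (MulAut.conjNormal (H := N.subgroupOf Q))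
  have hne : Nat.card (N.subgroupOf Q) ≠ 1 := fun h1 => by
    rw [Subgroup.card_eq_one, Subgroup.subgroupOf_eq_bot, disjoint_comm, disjoint_iff] at h1
    exact h.inf_ne_bot h1
  have hd : 2 ∣ Nat.card (N.subgroupOf Q) := by
    obtain ⟨n, hn⟩ := IsPGroup.iff_card.1 (h.isPGroup.to_subgroup (N.subgroupOf Q))
    rw [hn] at hne ⊢
    exact dvd_pow_self 2 fun h0 => hne (by rw [h0, pow_zero])
  obtain ⟨w, hw, hw1⟩ := h.isPGroup.exists_fixed_point_of_prime_dvd_card_of_fixed_point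
    (N.subgroupOf Q) hd (a := 1) (fun q => by
      change MulAut.conjNormal q 1 = 1
      exact map_one _)
  have hwQ : ∀ q ∈ Q, q * w.1.1 = w.1.1 * q := fun q hq => by
    have := congrArg (fun y : N.subgroupOf Q => y.1.1) (hw ⟨q, hq⟩)
    change ((MulAut.conjNormal (⟨q, hq⟩ : Q) w).1 : G) = _ at this
    rw [MulAut.conjNormal_apply] at this
    exact mul_inv_eq_iff_eq_mul.1 this
  have hwN : w.1.1 ∈ N := w.2
  have hodd : ¬ Odd (orderOf w.1.1) := fun ho => by
    obtain ⟨n, hn⟩ := h.card_eq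
    have h2 := Subgroup.orderOf_dvd_natCard Q w.1.2
    rw [hn] at h2
    have h3 := orderOf_eq_one_iff.1
      (Nat.Coprime.eq_one_of_dvd (ho.coprime_two_right.pow_right n) h2)
    exact hw1 (Subtype.ext (Subtype.ext h3)).symm
  obtain ⟨z, hz, hz2, hz1⟩ := exists_involution_mem_zpowers hodd
  have hzN : z ∈ N := (Subgroup.zpowers_le.2 hwN) hz
  have hzQ : z ∈ Q := (Subgroup.zpowers_le.2 w.1.2) hz
  have hcomm : ∀ q ∈ Q, q * z = z * q := fun q hq => by
    obtain ⟨k, rfl⟩ := hz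
    exact (Commute.zpow_right (hwQ q hq) k)
  have hnorm := h.normalizer_eq (K := Subgroup.zpowers z) (Subgroup.zpowers_le.2 hzQ)
    (Subgroup.zpowers_le.2 hzN) (fun h0 => hz1 (Subgroup.zpowers_eq_bot.1 h0))
  have hcn : ∀ g, g * z = z * g →
      g ∈ Subgroup.normalizer (Subgroup.zpowers z : Set G) := fun g hg => by
    rw [Subgroup.mem_normalizer_iff_map_conj_eq, MonoidHom.map_zpowers]
    congr 1
    exact mul_inv_eq_iff_eq_mul.2 hg
  refine ⟨z, hzN, hz2, hz1, fun g => ⟨fun hg => ?_, hcomm g⟩⟩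
  rw [← hnorm fun q hq => hcn q (hcomm q hq)]
  exact hcn g hg

theorem mul_self_ne_one (h : SolubilizerConfig x Q N) : x * x ≠ 1 := by
  intro hx
  have hxi : x⁻¹ = x := inv_eq_of_mul_eq_one_left hx
  have := h.normal
  obtain ⟨z, hzN, hz2, hz1, -⟩ := h.exists_central_involution
  have hall : ∀ g : G, g * g = 1 → g ∈ Q := fun g hg => by
    have hgi : g⁻¹ = g := inv_eq_of_mul_eq_one_left hg
    have hn : x ∈ Subgroup.normalizer (Subgroup.zpowers (x * g) : Set G) := by
      rw [Subgroup.mem_normalizer_iff_map_conj_eq, MonoidHom.map_zpowers]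
      have : (MulAut.conj x : G →* G) (x * g) = (x * g)⁻¹ := by
        simp [hxi, hgi, ← mul_assoc, hx]
      rw [this, Subgroup.zpowers_inv]
    have h1 := h.le_of_mem_normalizer (R := Subgroup.zpowers (x * g)) inferInstance hn
      (Subgroup.mem_zpowers _)
    exact (Q.mul_mem_cancel_left h.mem).1 h1
  have hle : Subgroup.normalClosure {z} ≤ N :=
    Subgroup.normalClosure_le_normal (Set.singleton_subset_iff.2 hzN)
  have heq := h.eq_of_le Subgroup.normalClosure_normal hle fun h0 => hz1 (by
    rw [Subgroup.normalClosure_eq_bot_iff] at h0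
    simpa using h0)
  refine h.not_le ?_
  rw [← heq, Subgroup.normalClosure, Subgroup.closure_le]
  intro y hy
  obtain ⟨z', hz', hc⟩ := Group.mem_conjugatesOfSet_iff.1 hy
  rw [Set.mem_singleton_iff.1 hz'] at hc
  obtain ⟨c, rfl⟩ := isConj_iff.1 hc
  refine hall _ ?_
  calc _ = c * (z * z) * c⁻¹ := by group
    _ = 1 := by rw [hz2]; group

theorem exists_conj_mem_ne (h : SolubilizerConfig x Q N) {z : G} (hzN : z ∈ N)
    (hC : ∀ g, g * z = z * g ↔ g ∈ Q) : ∃ n ∈ N, n * z * n⁻¹ ∈ Q ∧ n * z * n⁻¹ ≠ z := by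
  have := h.normal
  have hidx : ¬ 2 ∣ (Q.subgroupOf N).index := by
    have h1 : N.relIndex Q = N.index := by
      rw [← Subgroup.relIndex_top_right, ← h.sup_eq_top, Subgroup.relIndex_sup_right]
    have h2 : Q.relIndex N * N.index = N.relIndex Q * Q.index := by
      rw [← Subgroup.inf_relIndex_right Q N, ← Subgroup.inf_relIndex_right N Q, inf_comm N Q,
        Subgroup.relIndex_mul_index inf_le_right, Subgroup.relIndex_mul_index inf_le_left]
    rw [h1, mul_comm] at h2
    have h3 : Q.relIndex N = Q.index :=
      Nat.eq_of_mul_eq_mul_left (Nat.pos_of_ne_zero Subgroup.index_ne_zero_of_finite) h2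
    change ¬ 2 ∣ Q.relIndex N
    rw [h3]
    exact h.odd_index
  have hp : IsPGroup 2 (Q.subgroupOf N) := h.isPGroup.comap_subtype
  obtain ⟨n, h1, h2⟩ := exists_conj_ne_of_perfect (hp.toSylow hidx) (z := ⟨z, hzN⟩)
    (fun y => by
      change _ ↔ (y : G) ∈ Q
      rw [← hC, Subtype.ext_iff]
      rfl)
    h.commutator_eq_top (fun h0 => by
      change Q.subgroupOf N = ⊥ at h0
      rw [Subgroup.subgroupOf_eq_bot, disjoint_iff] at h0
      exact h.inf_ne_bot h0)
  exact ⟨n, n.2, h1, fun h3 => h2 (Subtype.ext h3)⟩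

theorem mem_of_conj_mem (h : SolubilizerConfig x Q N) {S : Set G} (hSQ : S ⊆ Q) (hSN : S ⊆ N)
    (hne : ∃ y ∈ S, y ≠ 1) (hQ : ∀ q ∈ Q, ∀ y ∈ S, q * y * q⁻¹ ∈ S) {n : G}
    (hn : ∀ y ∈ S, n * y * n⁻¹ ∈ S) : n ∈ Q := by
  have hle : ∀ g, (∀ y ∈ S, g * y * g⁻¹ ∈ S) →
      g ∈ Subgroup.normalizer (Subgroup.closure S : Set G) := fun g hg =>
    Subgroup.normalizer_le_normalizer_closure S (Subgroup.mem_normalizer_fintype hg)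
  rw [← h.normalizer_eq ((Subgroup.closure_le Q).2 hSQ) ((Subgroup.closure_le N).2 hSN) ?_
    fun q hq => hle q (hQ q hq)]
  · exact hle n hn
  · obtain ⟨y, hy, hy1⟩ := hne
    exact fun h0 => hy1 (Subgroup.mem_bot.1 (h0 ▸ Subgroup.subset_closure hy))

theorem dihedral_or_semidihedral (h : SolubilizerConfig x Q N) (hmeta : IsMetacyclic Q) :
    IsDihedral2Group Q ∨ IsSemidihedralGroup Q := by
  rcases dihedral_or_semidihedral_or_ncard_le h.card_eq hmeta with h1 | h1 | h1
  · exact Or.inl h1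
  · exact Or.inr h1
  exfalso
  have := h.normal
  obtain ⟨z, hzN, hz2, hz1, hC⟩ := h.exists_central_involution
  have hzQ : z ∈ Q := (hC z).1 rfl
  obtain ⟨n, hnN, htQ, htz⟩ := h.exists_conj_mem_ne hzN hC
  obtain ⟨t, ht⟩ : ∃ t, t = n * z * n⁻¹ := ⟨_, rfl⟩
  rw [← ht] at htQ htz
  have htN : t ∈ N := ht ▸ h.normal.conj_mem z hzN n
  have ht2 : t * t = 1 := by
    calc t * t = n * (z * z) * n⁻¹ := by rw [ht]; group
      _ = 1 := by rw [hz2]; group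
  have ht1 : t ≠ 1 := fun h0 => hz1 (conj_eq_one_iff.1 (ht ▸ h0))
  have hcomm : t * z = z * t := (hC t).2 htQ
  set S : Set G := {y | y ∈ Q ∧ y * y = 1} with hS
  have hScard : S.ncard ≤ 4 := by
    have h2 : S = Q.subtype '' {y : Q | y ^ 2 = 1} := by
      ext y
      simp only [hS, Set.mem_ofPred_eq, Set.mem_image, Subgroup.coe_subtype]
      constructor
      · rintro ⟨hy, hy2⟩
        exact ⟨⟨y, hy⟩, Subtype.ext (by simpa [pow_two] using hy2), rfl⟩
      · rintro ⟨y, hy, rfl⟩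
        exact ⟨y.2, by simpa [pow_two] using congrArg Subtype.val hy⟩
    rw [h2, Set.ncard_image_of_injective _ Q.subtype_injective]
    exact h1
  have hsub : ({1, z, t, z * t} : Set G) ⊆ S := by
    rintro y (rfl | rfl | rfl | rfl)
    · exact ⟨one_mem Q, one_mul 1⟩
    · exact ⟨hzQ, hz2⟩
    · exact ⟨htQ, ht2⟩
    · refine ⟨mul_mem hzQ htQ, ?_⟩
      rw [mul_assoc, ← mul_assoc t, hcomm, mul_assoc, ht2, mul_one, hz2]
  have hfour : ({1, z, t, z * t} : Set G).ncard = 4 := by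
    have hzt : z * t ≠ 1 := fun h0 => htz (by
      rw [← inv_eq_of_mul_eq_one_left hz2]
      exact (inv_eq_of_mul_eq_one_right h0).symm)
    rw [Set.ncard_insert_of_notMem, Set.ncard_insert_of_notMem, Set.ncard_pair]
    · exact fun h0 => hz1 (mul_eq_right.1 h0.symm)
    · rintro (h0 | h0)
      · exact htz h0.symm
      · exact ht1 (mul_eq_left.1 (Set.mem_singleton_iff.1 h0).symm)
    · rintro (h0 | h0 | h0)
      · exact hz1 h0.symm
      · exact ht1 h0.symm
      · exact hzt (Set.mem_singleton_iff.1 h0).symm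
  have hSeq : S = {1, z, t, z * t} :=
    (Set.eq_of_subset_of_ncard_le hsub (by rw [hfour]; exact hScard)).symm
  have hSN : S ⊆ N := by
    rw [hSeq]
    rintro y (rfl | rfl | rfl | rfl)
    exacts [one_mem N, hzN, htN, mul_mem hzN htN]
  have hSt : ∀ y ∈ S, y * t = t * y := by
    rw [hSeq]
    rintro y (rfl | rfl | rfl | rfl)
    · rw [one_mul, mul_one]
    · exact hcomm.symm
    · rfl
    · rw [← mul_assoc, hcomm]
  have hconj : ∀ g y : G, y * y = 1 → g * y * g⁻¹ * (g * y * g⁻¹) = 1 := fun g y hy => by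
    calc _ = g * (y * y) * g⁻¹ := by group
      _ = 1 := by rw [hy]; group
  have hn : n⁻¹ ∈ Q := h.mem_of_conj_mem (S := S) (fun y hy => hy.1) hSN ⟨z, ⟨hzQ, hz2⟩, hz1⟩
    (fun q hq y hy => ⟨mul_mem (mul_mem hq hy.1) (inv_mem hq), hconj q y hy.2⟩)
    fun y hy => ⟨h.conj_inv_mem hC (ht ▸ hSt y hy), hconj _ y hy.2⟩
  have hn' : n ∈ Q := inv_mem_iff.1 hn
  exact htz (ht.trans <| mul_inv_eq_iff_eq_mul.2 ((hC n).2 hn'))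

theorem exists_dihedralConfig (h : SolubilizerConfig x Q N) (hQ : IsDihedral2Group Q) :
    ∃ e r s z, DihedralConfig N e r s z := by
  obtain ⟨m, hm, ⟨φ⟩⟩ := hQ
  obtain ⟨k, rfl⟩ : ∃ k, m = k + 3 := ⟨m - 3, by omega⟩
  have he : 2 ^ (k + 3 - 1) = 2 * 2 ^ (k + 1) := by
    rw [← pow_succ']
    rfl
  rw [he] at φ
  have := h.normal
  obtain ⟨z, hzN, hz2, hz1, hC⟩ := h.exists_central_involution
  have hzQ : z ∈ Q := (hC z).1 rfl
  obtain ⟨n, hnN, htQ, htz⟩ := h.exists_conj_mem_ne hzN hC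
  obtain ⟨t, ht⟩ : ∃ t, t = n * z * n⁻¹ := ⟨_, rfl⟩
  rw [← ht] at htQ htz
  have htN : t ∈ N := ht ▸ h.normal.conj_mem z hzN n
  have ht2 : t * t = 1 := by
    calc t * t = n * (z * z) * n⁻¹ := by rw [ht]; group
      _ = 1 := by rw [hz2]; group
  have ht1 : t ≠ 1 := fun h0 => hz1 (conj_eq_one_iff.1 (ht ▸ h0))
  have hti : t⁻¹ = t := inv_eq_of_mul_eq_one_left ht2
  set e := 2 ^ (k + 1) with hek
  have he2 : 2 ≤ e := Nat.le_self_pow (by omega) 2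
  obtain ⟨r, hr, hzr, htr, hall⟩ := exists_rotation_of_mulEquiv_dihedralGroup he2 φ
    (z := ⟨z, hzQ⟩) (t := ⟨t, htQ⟩) (Subtype.ext hz2) (fun h0 => hz1 (congrArg Subtype.val h0))
    (fun y => Subtype.ext ((hC y).2 y.2)) (Subtype.ext ht2)
    (fun h0 => ht1 (congrArg Subtype.val h0)) (fun h0 => htz (congrArg Subtype.val h0))
  obtain ⟨r, hrQ⟩ := r
  rw [← Subgroup.orderOf_coe] at hr
  replace hzr : z = r ^ e := congrArg Subtype.val hzr
  replace htr : t * r * t = r⁻¹ := congrArg Subtype.val htr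
  replace hall : ∀ y ∈ Q, ∃ i : ℕ, y = r ^ i ∨ y = t * r ^ i := fun y hy => by
    obtain ⟨i, hi⟩ := hall ⟨y, hy⟩
    exact ⟨i, hi.imp (congrArg Subtype.val) (congrArg Subtype.val)⟩
  have hrN : r ∉ N := fun hrN => h.ne_top (by
    rw [← h.sup_eq_top, right_eq_sup]
    intro y hy
    obtain ⟨i, rfl | rfl⟩ := hall y hy
    exacts [pow_mem hrN i, mul_mem htN (pow_mem hrN i)])
  have hr2 : r ^ 2 ∈ N := by
    have h1 : r ^ 2 = t * (r⁻¹ * t * r⁻¹⁻¹) := by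
      calc r ^ 2 = r⁻¹⁻¹ * r := by rw [inv_inv, pow_two]
        _ = (t * r * t)⁻¹ * r := by rw [htr]
        _ = _ := by rw [mul_inv_rev, mul_inv_rev, hti]; group
    rw [h1]
    exact mul_mem htN (h.normal.conj_mem t htN r⁻¹)
  have hreven : ∀ i, Even i → r ^ i ∈ N := by
    rintro i ⟨j, rfl⟩
    rw [← two_mul, pow_mul]
    exact pow_mem hr2 j
  have hrodd : ∀ i, ¬ Even i → r ^ i ∉ N := by
    intro i hi hN
    obtain ⟨j, rfl⟩ := Nat.not_even_iff_odd.1 hi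
    rw [pow_succ] at hN
    exact hrN ((N.mul_mem_cancel_left (hreven _ (even_two_mul j))).1 hN)
  have hss : t * r * (t * r) = 1 := by rw [← mul_assoc, htr, inv_mul_cancel]
  have hk : 2 ≤ k + 1 := by
    by_contra hk
    obtain rfl : k = 0 := by omega
    have hzr2 : z = r ^ 2 := hzr
    have hcomm : ∀ y ∈ ((Q ⊓ N : Subgroup G) : Set G), y * t = t * y := by
      rintro y ⟨hyQ, hyN⟩
      have htz' : ∀ j, z ^ j * t = t * z ^ j := fun j =>
        (Commute.pow_right (show Commute t z from (hC t).2 htQ) j).eq.symm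
      obtain ⟨i, hi⟩ := hall y hyQ
      have hri : Even i := by
        by_contra hodd
        rcases hi with rfl | rfl
        · exact hrodd i hodd hyN
        · exact hrodd i hodd ((N.mul_mem_cancel_left htN).1 hyN)
      obtain ⟨j, rfl⟩ := hri
      rw [← two_mul, pow_mul, ← hzr2] at hi
      rcases hi with rfl | rfl
      · exact htz' j
      · rw [mul_assoc, htz' j]
    have hn : n⁻¹ ∈ Q := h.mem_of_conj_mem (S := ((Q ⊓ N : Subgroup G) : Set G))
      (fun y hy => hy.1) (fun y hy => hy.2) ⟨z, ⟨hzQ, hzN⟩, hz1⟩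
      (fun q hq y hy => ⟨Q.mul_mem (Q.mul_mem hq hy.1) (Q.inv_mem hq), h.normal.conj_mem y hy.2 q⟩)
      fun y hy => ⟨h.conj_inv_mem hC (ht ▸ hcomm y hy), h.normal.conj_mem y hy.2 _⟩
    exact htz (ht.trans <| mul_inv_eq_iff_eq_mul.2 ((hC n).2 (inv_mem_iff.1 hn)))
  refine ⟨e, r, t * r, z, h.normal, ?_, ⟨k + 1, hk, rfl⟩, hr, hzr, hss, ?_, hrN,
    fun h0 => hrN ((N.mul_mem_cancel_left htN).1 h0), ?_, ?_, ?_, ?_⟩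
  · rw [Subgroup.index_eq_two_iff_exists_notMem_and]
    refine ⟨r, hrN, fun b => ?_⟩
    have hb : b ∈ N ⊔ Q := by
      rw [sup_comm, h.sup_eq_top]
      trivial
    obtain ⟨a, ha, q, hq, rfl⟩ := Subgroup.mem_sup_of_normal_left.1 hb
    have hpar : ∀ i, r ^ i * r ∈ N ∨ r ^ i ∈ N := fun i => by
      by_cases hi : Even i
      · exact Or.inr (hreven i hi)
      · rw [← pow_succ]
        exact Or.inl (hreven _ (Nat.not_even_iff_odd.1 hi).add_one)
    obtain ⟨i, rfl | rfl⟩ := hall q hq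
    · refine (hpar i).imp (fun h1 => ?_) fun h1 => mul_mem ha h1
      rw [mul_assoc]
      exact mul_mem ha h1
    · refine (hpar i).imp (fun h1 => ?_) fun h1 => mul_mem ha (mul_mem htN h1)
      rw [mul_assoc, mul_assoc]
      exact mul_mem ha (mul_mem htN h1)
  · rw [mul_inv_rev, hti]
    calc t * r * r * (r⁻¹ * t) = t * r * t := by group
      _ = r⁻¹ := htr
  · intro g hg
    obtain ⟨i, hi | hi⟩ := hall g ((hC g).1 hg)
    · exact ⟨i, Or.inl hi⟩
    · rcases i with _ | i
      · refine ⟨2 * e - 1, Or.inr ?_⟩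
        rw [hi, mul_assoc, ← pow_succ', Nat.sub_add_cancel (by omega), ← hr, pow_orderOf_eq_one,
          pow_zero]
      · exact ⟨i, Or.inr (by rw [hi, pow_succ', mul_assoc])⟩
  · refine isConj_iff.2 ⟨r⁻¹ * n, ?_⟩
    calc r⁻¹ * n * z * (r⁻¹ * n)⁻¹ = r⁻¹ * t * r := by rw [ht]; group
      _ = t * r * (t * t) * r := by rw [← htr]; group
      _ = _ := by rw [ht2, mul_one]
  · refine ⟨Q.index, Nat.not_even_iff_odd.1 fun hev => h.odd_index hev.two_dvd, ?_⟩
    rw [← Subgroup.card_mul_index Q, Nat.card_congr φ.toEquiv, DihedralGroup.nat_card]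
    ring
  · intro A hA hcomm hrA
    refine h.eq_bot_of_odd (Group.isSolvable_of_comm fun a b =>
      Subtype.ext (hcomm a a.2 b b.2)) ?_ hA
    have hrA' : r ∈ Subgroup.normalizer (A : Set G) := Subgroup.mem_normalizer_fintype hrA
    obtain ⟨i, hi | hi⟩ := hall x h.mem
    · rw [hi]
      exact pow_mem hrA' i
    · refine absurd ?_ h.mul_self_ne_one
      have h1 : t * r ^ i * t⁻¹ = (r ^ i)⁻¹ := by
        rw [← conj_pow, hti, htr, inv_pow]
      rw [hi, ← mul_assoc]
      nth_rw 2 [← hti]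
      rw [h1, inv_mul_cancel]

end SolubilizerConfig

theorem solubilizerConfig_of_eq_solubilizer {G : Type*} [Group G] [Finite G]
    (hG : ¬ Group.IsSolvable G) (x : G) (Q : Subgroup G) (hQ : (Q : Set G) = solubilizer x)
    (hmax : IsCoatom Q) (h2 : ∃ n : ℕ, Nat.card Q = 2 ^ n)
    (N : Subgroup G) (hNnormal : N.Normal) (hNbot : N ≠ ⊥) (hNtop : N ≠ ⊤)
    (hNmin : ∀ M : Subgroup G, M.Normal → M < N → M = ⊥)
    (hNna : ¬ ∀ a b : ↥N, a * b = b * a) : SolubilizerConfig x Q N := by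
  have hle : ∀ S : Subgroup G, Group.IsSolvable S → x ∈ S → S ≤ Q := by
    intro S hS hx y hy
    have h1 : Subgroup.closure ({x, y} : Set G) ≤ S :=
      (Subgroup.closure_le S).2 (Set.insert_subset hx (Set.singleton_subset_iff.2 hy))
    have h3 : y ∈ solubilizer x :=
      Group.isSolvable_of_isSolvable_injective (Subgroup.inclusion_injective h1)
    rwa [← hQ] at h3
  exact ⟨hG, hle _ (inferInstanceAs (Group.IsSolvable (Subgroup.zpowers x)))
    (Subgroup.mem_zpowers x) (Subgroup.mem_zpowers x), hle, hmax, IsPGroup.iff_card.2 h2, hNnormal,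
    hNbot, hNtop, hNmin, hNna⟩

theorem stmt_18 {G : Type*} [Group G] [Finite G] (hG : ¬ IsSolvable G)
    (x : G) (Q : Subgroup G) (hQ : (Q : Set G) = solubilizer x)
    (hmax : IsCoatom Q) (hmeta : IsMetacyclic ↥Q)
    (h2 : ∃ n : ℕ, Nat.card Q = 2 ^ n)
    (N : Subgroup G) (hNnormal : N.Normal) (hNbot : N ≠ ⊥) (hNtop : N ≠ ⊤)
    (hNmin : ∀ M : Subgroup G, M.Normal → M < N → M = ⊥)
    (hNna : ¬ ∀ a b : ↥N, a * b = b * a) :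
    (IsDihedral2Group ↥Q ∨ IsSemidihedralGroup ↥Q) ∧
      (IsDihedral2Group ↥Q →
        ∃ p : ℕ, p.Prime ∧ (∃ n : ℕ, p = 2 ^ n - 1) ∧ 7 ≤ p ∧
          Nonempty (G ≃* ProjectiveGeneralLinearGroup 2 (ZMod p)) ∧
          Nonempty (↥N ≃* PSL(2, ZMod p))) := by
  have h := solubilizerConfig_of_eq_solubilizer hG x Q hQ hmax h2 N hNnormal hNbot hNtop hNmin hNna
  refine ⟨h.dihedral_or_semidihedral hmeta, fun hD => ?_⟩
  obtain ⟨e, r, s, z, hc⟩ := h.exists_dihedralConfig hD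
  exact hc.exists_prime_and_mulEquiv
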